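/- Let 1/2 < η < 3/5 and set c(η) = (3 − 5η)/(2(1 − η)). Then for every ε > 0 there is an x₀ such that for all x ≥ x₀, the number of primes p ≤ x with ord(A,p) > x^η is at least (c(η) − ε)·π(x), where π(x) is the number of primes up to x. -/

import Mathlib

open Matrix

/-- `matOrd A N` is the order of `A` modulo `N`: the least `k ≥ 1`
with `A^k ≡ I (mod N)`. -/
noncomputable def matOrd (A : Matrix (Fin 2) (Fin 2) ℤ) (N : ℕ) : ℕ :=
  sInf {k | 0 < k ∧ ∀ i j, (N : ℤ) ∣ (A ^ k - 1) i j}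

namespace LO

lemma matOrd_dvd_iff (A : Matrix (Fin 2) (Fin 2) ℤ) (p k : ℕ) :
    (∀ i j, (p : ℤ) ∣ (A ^ k - 1) i j) ↔ (A.map (Int.castRingHom (ZMod p))) ^ k = 1 := by
  have h : (A.map (Int.castRingHom (ZMod p))) ^ k = (A ^ k).map (Int.castRingHom (ZMod p)) := by
    have := map_pow (RingHom.mapMatrix (m := Fin 2) (Int.castRingHom (ZMod p))) A k
    simpa [RingHom.mapMatrix_apply] using this.symm
  rw [h]
  have h1 : (1 : Matrix (Fin 2) (Fin 2) (ZMod p)) =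
      (1 : Matrix (Fin 2) (Fin 2) ℤ).map (Int.castRingHom (ZMod p)) := by
    rw [Matrix.map_one] <;> simp
  rw [h1, ← Matrix.ext_iff]
  refine forall_congr' fun i => forall_congr' fun j => ?_
  rw [← ZMod.intCast_zmod_eq_zero_iff_dvd]
  simp only [Matrix.sub_apply, Matrix.map_apply, Int.cast_sub, Int.coe_castRingHom, sub_eq_zero]

lemma matOrd_eq_orderOf (A : Matrix (Fin 2) (Fin 2) ℤ) (p : ℕ) :
    matOrd A p = orderOf (A.map (Int.castRingHom (ZMod p))) := by
  set B := A.map (Int.castRingHom (ZMod p)) with hB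
  have hset : {k | 0 < k ∧ ∀ i j, (p : ℤ) ∣ (A ^ k - 1) i j} = {k | 0 < k ∧ B ^ k = 1} := by
    ext k; simp only [Set.mem_ofPred_eq, matOrd_dvd_iff, hB]
  unfold matOrd
  rw [hset]
  by_cases h : IsOfFinOrder B
  · apply le_antisymm
    · exact Nat.sInf_le ⟨h.orderOf_pos, pow_orderOf_eq_one B⟩
    · have hne : {k | 0 < k ∧ B ^ k = 1}.Nonempty := ⟨_, h.orderOf_pos, pow_orderOf_eq_one B⟩
      obtain ⟨h1, h2⟩ := Nat.sInf_mem hne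
      exact orderOf_le_of_pow_eq_one h1 h2
  · rw [orderOf_eq_zero h]
    have : {k | 0 < k ∧ B ^ k = 1} = ∅ := by
      ext k
      simp only [Set.mem_ofPred_eq, Set.mem_empty_iff_false, iff_false, not_and]
      intro h1 h2
      exact h (isOfFinOrder_iff_pow_eq_one.2 ⟨k, h1, h2⟩)
    rw [this]; simp

/-- the order divides `p - χ(p)` -/
lemma pow_eq_one_of_legendre (A : Matrix (Fin 2) (Fin 2) ℤ) (hA : A.det = 1) (p : ℕ)
    [Fact p.Prime] (hp2 : p ≠ 2) :
    (legendreSym p (A.trace ^ 2 - 4) = 1 → (A.map (Int.castRingHom (ZMod p))) ^ (p - 1) = 1) ∧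
    (legendreSym p (A.trace ^ 2 - 4) = -1 → (A.map (Int.castRingHom (ZMod p))) ^ (p + 1) = 1) := by
  set B := A.map (Int.castRingHom (ZMod p)) with hB
  set t : ZMod p := (A.trace : ZMod p) with ht
  have hpp : p.Prime := Fact.out
  have h2 : (2 : ZMod p) ≠ 0 := by
    intro h
    have : ((2 : ℕ) : ZMod p) = 0 := by exact_mod_cast h
    rw [ZMod.natCast_eq_zero_iff] at this
    exact hp2 ((Nat.prime_dvd_prime_iff_eq hpp Nat.prime_two).1 this)
  have hdet : A 0 0 * A 1 1 - A 0 1 * A 1 0 = 1 := by rw [← Matrix.det_fin_two]; exact hA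
  have hdet' : B 0 0 * B 1 1 - B 0 1 * B 1 0 = 1 := by
    simp only [hB, Matrix.map_apply]
    have := congrArg (Int.cast : ℤ → ZMod p) hdet
    push_cast at this
    simpa using this
  have htB : t = B 0 0 + B 1 1 := by
    simp [ht, hB, Matrix.trace_fin_two]
  set S : ZMod p → Matrix (Fin 2) (Fin 2) (ZMod p) := fun c => Matrix.scalar (Fin 2) c with hS
  -- Cayley-Hamilton
  have hCH : B * (S t - B) = 1 := by
    ext i j
    fin_cases i <;> fin_cases j <;>
      simp [hS, Matrix.mul_apply, Fin.sum_univ_two, Matrix.scalar_apply, Matrix.diagonal, htB] <;>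
      first | linear_combination hdet' | ring
  set E := S 2 * B - S t with hE
  have hcomm : ∀ c : ZMod p, ∀ M, Commute (S c) M := fun c M => Matrix.scalar_commute c (fun _ => mul_comm _ _) M
  have hE2 : E ^ 2 = S (t ^ 2 - 4) := by
    ext i j
    fin_cases i <;> fin_cases j <;>
      simp [hE, hS, pow_two, Matrix.mul_apply, Fin.sum_univ_two, Matrix.scalar_apply,
        Matrix.diagonal, htB] <;>
      first | linear_combination (-4 : ZMod p) * hdet' | ring
  have hodd : Odd p := hpp.odd_of_ne_two hp2
  obtain ⟨m, hm⟩ := hodd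
  have hEp : E ^ p = S ((t ^ 2 - 4) ^ m) * E := by
    have h1 : E ^ p = E ^ (2 * m + 1) := congrArg (fun k => E ^ k) hm
    rw [h1, pow_succ, pow_mul, hE2]
    simp only [hS, ← map_pow]
  have hleg : ((legendreSym p (A.trace ^ 2 - 4) : ℤ) : ZMod p) = (t ^ 2 - 4) ^ m := by
    rw [legendreSym.eq_pow]
    have : p / 2 = m := by omega
    rw [this, ht]
    push_cast; rfl
  have hfrob : (S 2 * B) ^ p = S t + S ((t ^ 2 - 4) ^ m) * E := by
    have h1 : S 2 * B = S t + E := by rw [hE]; abel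
    rw [h1, add_pow_char_of_commute p (hcomm t E), hEp]
    simp only [hS, ← map_pow, ZMod.pow_card]
  have hfrob2 : S 2 * B ^ p = S t + S ((t ^ 2 - 4) ^ m) * E := by
    rw [← hfrob, (hcomm 2 B).mul_pow]
    simp only [hS, ← map_pow, ZMod.pow_card]
  have hinv : ∀ M N : Matrix (Fin 2) (Fin 2) (ZMod p), S 2 * M = S 2 * N → M = N := by
    intro M N h
    have h3 : S (2⁻¹) * S 2 = 1 := by simp only [hS, ← map_mul]; rw [inv_mul_cancel₀ h2]; simp
    calc M = S (2⁻¹) * (S 2 * M) := by rw [← mul_assoc, h3, one_mul]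
      _ = S (2⁻¹) * (S 2 * N) := by rw [h]
      _ = N := by rw [← mul_assoc, h3, one_mul]
  rw [← hleg] at hfrob2
  constructor
  · intro h
    rw [h] at hfrob2
    have h4 : B ^ p = B := by
      apply hinv
      rw [hfrob2, hE]
      simp [hS]
    have h5 : B ^ (p - 1) * B = 1 * B := by
      rw [← pow_succ, Nat.sub_add_cancel hpp.one_le, h4, one_mul]
    calc B ^ (p - 1) = B ^ (p - 1) * (B * (S t - B)) := by rw [hCH, mul_one]
      _ = 1 := by rw [← mul_assoc, h5, one_mul, hCH]
  · intro h
    rw [h] at hfrob2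
    have h4 : B ^ p = S t - B := by
      apply hinv
      rw [hfrob2, hE]
      have e1 : S ((-1 : ℤ) : ZMod p) = -1 := by
        show Matrix.scalar (Fin 2) _ = _
        rw [Int.cast_neg, Int.cast_one, map_neg, map_one]
      have e2 : S 2 = 2 := map_ofNat (Matrix.scalar (Fin 2)) 2
      rw [e1, e2]; noncomm_ring
    rw [pow_succ', h4, hCH]

lemma matOrd_dvd (A : Matrix (Fin 2) (Fin 2) ℤ) (hA : A.det = 1) (p : ℕ)
    [Fact p.Prime] (hp2 : p ≠ 2) :
    (legendreSym p (A.trace ^ 2 - 4) = 1 → matOrd A p ∣ p - 1) ∧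
    (legendreSym p (A.trace ^ 2 - 4) = -1 → matOrd A p ∣ p + 1) := by
  rw [matOrd_eq_orderOf]
  have := pow_eq_one_of_legendre A hA p hp2
  exact ⟨fun h => orderOf_dvd_of_pow_eq_one (this.1 h), fun h => orderOf_dvd_of_pow_eq_one (this.2 h)⟩

lemma pow_ne_one (A : Matrix (Fin 2) (Fin 2) ℤ) (hA : A.det = 1) (htr : 2 < |A.trace|)
    (k : ℕ) (hk : 0 < k) : A ^ k ≠ 1 := by
  have hdet : A 0 0 * A 1 1 - A 0 1 * A 1 0 = 1 := by rw [← Matrix.det_fin_two]; exact hA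
  have hCH : A ^ 2 = A.trace • A - 1 := by
    ext i j
    rw [Matrix.sub_apply, Matrix.smul_apply, smul_eq_mul, Matrix.trace_fin_two, pow_two,
      Matrix.mul_apply, Fin.sum_univ_two]
    fin_cases i <;> fin_cases j <;> simp <;>
      first | linear_combination (-1 : ℤ) * hdet | ring
  have hrec : ∀ k, (A ^ (k + 2)).trace = A.trace * (A ^ (k + 1)).trace - (A ^ k).trace := by
    intro k
    rw [pow_add, hCH, mul_sub, mul_one, Matrix.trace_sub, Matrix.mul_smul, ← pow_succ,
      Matrix.trace_smul, smul_eq_mul]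
  have hmono : ∀ k, |(A ^ k).trace| < |(A ^ (k + 1)).trace| := by
    intro k
    induction k with
    | zero => simpa using htr
    | succ k ih =>
      rw [hrec k]
      have h1 := abs_sub_abs_le_abs_sub (A.trace * (A ^ (k + 1)).trace) ((A ^ k).trace)
      rw [abs_mul] at h1
      have h2 : 3 ≤ |A.trace| := htr
      nlinarith [abs_nonneg ((A ^ (k + 1)).trace)]
  have h2 : ∀ k, 2 < |(A ^ (k + 1)).trace| := by
    intro k
    induction k with
    | zero => simpa using htr
    | succ k ih => exact ih.trans (hmono _)
  intro h
  obtain ⟨j, rfl⟩ := Nat.exists_eq_succ_of_ne_zero hk.ne'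
  have := h2 j
  rw [Nat.succ_eq_add_one] at h
  rw [h] at this
  simp at this

lemma card_primeFactors_le (n s : ℕ) (hn : n ≠ 0) (h : n ≤ 2 ^ s) : n.primeFactors.card ≤ s := by
  have h1 : 2 ^ n.primeFactors.card ≤ ∏ p ∈ n.primeFactors, p :=
    Finset.pow_card_le_prod _ _ _ (fun p hp => (Nat.prime_of_mem_primeFactors hp).two_le)
  have h2 : ∏ p ∈ n.primeFactors, p ≤ n :=
    Nat.le_of_dvd (Nat.pos_of_ne_zero hn) (Nat.prod_primeFactors_dvd n)
  exact (Nat.pow_le_pow_iff_right (by norm_num : 1 < 2)).1 (h1.trans (h2.trans h))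

lemma entry_bound (A : Matrix (Fin 2) (Fin 2) ℤ) :
    ∃ m : ℕ, ∀ k i j, |(A ^ k) i j| ≤ (m : ℤ) ^ k := by
  refine ⟨(∑ i, ∑ j, |A i j|).natAbs, ?_⟩
  have h0 : ((∑ i, ∑ j, |A i j|).natAbs : ℤ) = ∑ i, ∑ j, |A i j| := by
    rw [Int.natCast_natAbs, abs_of_nonneg]
    exact Finset.sum_nonneg fun i _ => Finset.sum_nonneg fun j _ => abs_nonneg _
  rw [h0]
  set m := ∑ i, ∑ j, |A i j| with hm
  intro k
  induction k with
  | zero =>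
    intro i j
    fin_cases i <;> fin_cases j <;> simp
  | succ k ih =>
    intro i j
    rw [pow_succ, Matrix.mul_apply, pow_succ]
    calc |∑ l, (A ^ k) i l * A l j| ≤ ∑ l, |(A ^ k) i l * A l j| := Finset.abs_sum_le_sum_abs _ _
      _ ≤ ∑ l, m ^ k * |A l j| := by
          refine Finset.sum_le_sum fun l _ => ?_
          rw [abs_mul]
          exact mul_le_mul_of_nonneg_right (ih i l) (abs_nonneg _)
      _ = m ^ k * ∑ l, |A l j| := by rw [Finset.mul_sum]
      _ ≤ m ^ k * m := by
          refine mul_le_mul_of_nonneg_left ?_ ?_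
          · rw [hm]
            refine Finset.sum_le_sum fun l _ => ?_
            exact Finset.single_le_sum (f := fun j => |A l j|) (fun _ _ => abs_nonneg _)
              (Finset.mem_univ j)
          · exact pow_nonneg (Finset.sum_nonneg fun i _ => Finset.sum_nonneg fun j _ => abs_nonneg _) _

lemma small_order_count (A : Matrix (Fin 2) (Fin 2) ℤ) (hA : A.det = 1) (htr : 2 < |A.trace|) :
    ∃ C : ℕ, ∀ (y : ℕ) (T : Finset ℕ), (∀ p ∈ T, p.Prime ∧ 0 < matOrd A p ∧ matOrd A p ≤ y) →
      T.card ≤ C * y ^ 2 := by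
  obtain ⟨m, hm⟩ := entry_bound A
  obtain ⟨s, hs⟩ : ∃ s : ℕ, m + 1 ≤ 2 ^ s := ⟨m + 1, (Nat.lt_two_pow_self).le⟩
  refine ⟨s, fun y T hT => ?_⟩
  have hex : ∀ k : ℕ, 0 < k → ∃ n : ℕ, n ≠ 0 ∧ n ≤ 2 ^ (s * k) ∧
      ∀ p : ℕ, (∀ i j, (p : ℤ) ∣ (A ^ k - 1) i j) → p ∣ n := by
    intro k hk
    have hne : A ^ k - 1 ≠ 0 := sub_ne_zero.2 (pow_ne_one A hA htr k hk)
    obtain ⟨i, j, hij⟩ : ∃ i j, (A ^ k - 1) i j ≠ 0 := by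
      by_contra hcon
      push Not at hcon
      exact hne (by ext i j; simpa using hcon i j)
    refine ⟨((A ^ k - 1) i j).natAbs, Int.natAbs_ne_zero.2 hij, ?_, fun p hp => ?_⟩
    · have h1 : |(A ^ k - 1) i j| ≤ (m : ℤ) ^ k + 1 := by
        rw [Matrix.sub_apply]
        refine (abs_sub _ _).trans (add_le_add (hm k i j) ?_)
        fin_cases i <;> fin_cases j <;> simp
      have h2 : ((m : ℤ) ^ k + 1) ≤ ((m : ℤ) + 1) ^ k := by
        have := pow_add_pow_le (by positivity : (0 : ℤ) ≤ m) (by norm_num : (0 : ℤ) ≤ 1) hk.ne'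
        simpa using this
      have h3 : (m + 1) ^ k ≤ 2 ^ (s * k) := by
        rw [pow_mul]; exact Nat.pow_le_pow_left hs k
      zify
      calc _ ≤ _ := h1.trans h2
        _ ≤ _ := by exact_mod_cast h3
    · exact Int.natCast_dvd.1 (hp i j)
  choose! f hf using hex
  have hsub : T ⊆ (Finset.Icc 1 y).biUnion (fun k => (f k).primeFactors) := by
    intro p hp
    obtain ⟨h1, h2, h3⟩ := hT p hp
    rw [Finset.mem_biUnion]
    refine ⟨matOrd A p, Finset.mem_Icc.2 ⟨h2, h3⟩, ?_⟩
    rw [Nat.mem_primeFactors]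
    refine ⟨h1, (hf _ h2).2.2 p ?_, (hf _ h2).1⟩
    rw [matOrd_dvd_iff, matOrd_eq_orderOf, pow_orderOf_eq_one]
  calc T.card ≤ _ := Finset.card_le_card hsub
    _ ≤ ∑ k ∈ Finset.Icc 1 y, (f k).primeFactors.card := Finset.card_biUnion_le
    _ ≤ ∑ k ∈ Finset.Icc 1 y, s * y := by
        refine Finset.sum_le_sum fun k hk => ?_
        have hk' := Finset.mem_Icc.1 hk
        refine (card_primeFactors_le (f k) (s * k) (hf k hk'.1).1 (hf k hk'.1).2.1).trans ?_
        exact Nat.mul_le_mul_left s hk'.2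
    _ = s * y ^ 2 := by simp; ring

end LO

namespace LO
open MeasureTheory Set Filter Topology

/-- the normalised remainder `ψ(e^t) e^{-t} - 1` -/
noncomputable def rr (t : ℝ) : ℝ := Chebyshev.psi (Real.exp t) * Real.exp (-t) - 1

/-- the continuous extension of `L(Λ,s) - 1/(s-1)` -/
noncomputable def aux1 (s : ℂ) : ℂ :=
  ArithmeticFunction.vonMangoldt.LFunctionResidueClassAux (q := 1) (1 : ZMod 1) s

noncomputable def GG (s : ℂ) : ℂ := (aux1 s - 1) / s

lemma GG_cont : ContinuousOn GG {s | 1 ≤ s.re} := by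
  unfold GG
  refine ContinuousOn.div ?_ continuousOn_id ?_
  · exact (ArithmeticFunction.vonMangoldt.continuousOn_LFunctionResidueClassAux (q := 1) 1).sub
      continuousOn_const
  · intro s hs h
    simp only [Set.mem_ofPred_eq] at hs
    rw [show s = 0 from h] at hs; norm_num at hs

lemma rr_meas : Measurable rr := by
  unfold rr
  have : Measurable Chebyshev.psi := Chebyshev.psi_mono.measurable
  fun_prop

lemma rr_bound : ∃ C : ℝ, 0 < C ∧ ∀ t, |rr t| ≤ C := by
  refine ⟨Real.log 4 + 4 + 1, by positivity, fun t => ?_⟩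
  unfold rr
  have h1 := Chebyshev.psi_le_const_mul_self (Real.exp_pos t).le
  have h0 := Chebyshev.psi_nonneg (Real.exp t)
  have h2 : Chebyshev.psi (Real.exp t) * Real.exp (-t) ≤ Real.log 4 + 4 := by
    calc _ ≤ ((Real.log 4 + 4) * Real.exp t) * Real.exp (-t) := by gcongr
      _ = _ := by rw [mul_assoc, ← Real.exp_add]; simp
  have h3 : 0 ≤ Chebyshev.psi (Real.exp t) * Real.exp (-t) := by positivity
  have : 0 ≤ Real.log 4 := Real.log_nonneg (by norm_num)
  rw [abs_le]; constructor <;> linarith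

lemma LS_vonMangoldt (s : ℂ) (hs : 1 < s.re) :
    LSeries (fun n => ((ArithmeticFunction.vonMangoldt n : ℝ) : ℂ)) s = aux1 s + 1 / (s - 1) := by
  have := ArithmeticFunction.vonMangoldt.eqOn_LFunctionResidueClassAux (q := 1) (a := 1)
    isUnit_one hs
  unfold aux1
  rw [this]
  have h : (ArithmeticFunction.vonMangoldt.residueClass (1 : ZMod 1)) =
      fun n => ArithmeticFunction.vonMangoldt n := by
    funext n
    simp only [ArithmeticFunction.vonMangoldt.residueClass]
    rw [Set.indicator_of_mem]
    exact Subsingleton.elim _ _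
  simp [h]

lemma integrable_exp_tail (z : ℂ) (hz : 0 < z.re) :
    IntegrableOn (fun t : ℝ => Complex.exp (-z * t)) (Ioi 0) := by
  have := integrableOn_exp_mul_complex_Ioi (a := -z) (by simpa using hz) 0
  exact this

lemma rr_integrable (z : ℂ) (hz : 0 < z.re) :
    IntegrableOn (fun t : ℝ => (rr t : ℂ) * Complex.exp (-z * t)) (Ioi 0) := by
  obtain ⟨C, hC, h⟩ := rr_bound
  refine (integrable_exp_tail z hz).bdd_mul (c := C) ?_ ?_
  · exact (Complex.measurable_ofReal.comp rr_meas).aestronglyMeasurable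
  · exact Eventually.of_forall fun t => by simpa using h t

lemma laplace_rr (z : ℂ) (hz : 0 < z.re) :
    ∫ t in Ioi (0 : ℝ), (rr t : ℂ) * Complex.exp (-z * t) = GG (1 + z) := by
  set s : ℂ := 1 + z with hs
  have hsre : 1 < s.re := by simp [hs, hz]
  have hO : (fun n : ℕ => ∑ k ∈ Finset.Icc 1 n, ArithmeticFunction.vonMangoldt k) =O[atTop]
      fun n => (n : ℝ) ^ (1 : ℝ) := by
    refine Asymptotics.IsBigO.of_bound (Real.log 4 + 4) (Eventually.of_forall fun n => ?_)
    have h1 := Chebyshev.psi_le_const_mul_self (x := n) (by positivity)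
    have h0 := Chebyshev.psi_nonneg n
    have h2 : ∑ k ∈ Finset.Icc 1 n, ArithmeticFunction.vonMangoldt k = Chebyshev.psi n := by
      unfold Chebyshev.psi; rw [Nat.floor_natCast]; rfl
    rw [h2, Real.rpow_one, Real.norm_of_nonneg h0, Real.norm_of_nonneg (by positivity)]
    exact h1
  have hmain := LSeries_eq_mul_integral_of_nonneg (fun n => ArithmeticFunction.vonMangoldt n)
    zero_le_one hsre hO (fun n => ArithmeticFunction.vonMangoldt_nonneg)
  rw [LS_vonMangoldt s hsre] at hmain
  have hsub : ∫ t in Set.Ioi (1 : ℝ), (∑ k ∈ Finset.Icc 1 ⌊t⌋₊,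
      ((ArithmeticFunction.vonMangoldt k : ℝ) : ℂ)) * (t : ℂ) ^ (-(s + 1)) =
      ∫ t in Ioi (0 : ℝ), ((rr t : ℂ) + 1) * Complex.exp (-z * t) := by
    have him : Ioi (1 : ℝ) = Real.exp '' Ioi 0 := by rw [Real.image_exp_Ioi, Real.exp_zero]
    rw [him, integral_image_eq_integral_abs_deriv_smul (f' := Real.exp) measurableSet_Ioi
      (fun x _ => (Real.hasDerivAt_exp x).hasDerivWithinAt) Real.exp_injective.injOn]
    refine setIntegral_congr_fun measurableSet_Ioi fun t _ => ?_
    have h2 : ∑ k ∈ Finset.Icc 1 ⌊Real.exp t⌋₊, ((ArithmeticFunction.vonMangoldt k : ℝ) : ℂ) =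
        (Chebyshev.psi (Real.exp t) : ℂ) := by
      unfold Chebyshev.psi; push_cast; rfl
    have h3 : ((Real.exp t : ℝ) : ℂ) ^ (-(s + 1)) = Complex.exp (-(s + 1) * t) := by
      rw [Complex.cpow_def_of_ne_zero (by exact_mod_cast (Real.exp_pos t).ne'),
        ← Complex.ofReal_log (Real.exp_pos t).le, Real.log_exp, mul_comm]
    simp only [h2, h3]
    rw [abs_of_pos (Real.exp_pos t)]
    unfold rr
    push_cast
    rw [Complex.real_smul, sub_add_cancel]
    push_cast
    have h4 : Complex.exp t * Complex.exp (-(s + 1) * t) = Complex.exp (-t) * Complex.exp (-z * t) := by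
      rw [← Complex.exp_add, ← Complex.exp_add]; congr 1; rw [hs]; ring
    linear_combination (Chebyshev.psi (Real.exp t) : ℂ) * h4
  have hz0 : z ≠ 0 := by intro h; rw [h] at hz; simp at hz
  have hs0 : s ≠ 0 := by intro h; rw [h] at hsre; norm_num at hsre
  have hexp : ∫ t in Ioi (0 : ℝ), Complex.exp (-z * t) = 1 / z := by
    have := integral_exp_mul_complex_Ioi (a := -z) (by simpa using hz) 0
    rw [this]; simp
  have hsplit : ∫ t in Ioi (0 : ℝ), ((rr t : ℂ) + 1) * Complex.exp (-z * t) =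
      (∫ t in Ioi (0 : ℝ), (rr t : ℂ) * Complex.exp (-z * t)) + 1 / z := by
    rw [← hexp, ← integral_add (rr_integrable z hz) (integrable_exp_tail z hz)]
    congr 1; funext t; ring
  rw [hsub, hsplit] at hmain
  unfold GG
  have hsz : s - 1 = z := by rw [hs]; ring
  rw [hsz] at hmain
  rw [eq_div_iff hs0]
  generalize (∫ t in Ioi (0 : ℝ), (rr t : ℂ) * Complex.exp (-z * t)) = J at hmain ⊢
  field_simp at hmain
  have : z * (J * s) = z * (aux1 s - 1) := by
    linear_combination (-1 : ℂ) * hmain + hs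
  exact mul_left_cancel₀ hz0 this

end LO

namespace LO
open MeasureTheory Set Filter Topology

/-- Fejer kernel -/
noncomputable def fej (v : ℝ) : ℝ := ∫ y in (0 : ℝ)..1, 2 * (1 - y) * Real.cos (v * y)

lemma fej_eq (v : ℝ) (hv : v ≠ 0) : fej v = 2 * (1 - Real.cos v) / v ^ 2 := by
  unfold fej
  have h : ∀ y ∈ uIcc (0 : ℝ) 1, HasDerivAt
      (fun y => 2 * (1 - y) * Real.sin (v * y) / v - 2 * Real.cos (v * y) / v ^ 2)
      (2 * (1 - y) * Real.cos (v * y)) y := by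
    intro y _
    have h1 : HasDerivAt (fun y => v * y) v y := by simpa using (hasDerivAt_id y).const_mul v
    have h2 := h1.sin
    have h3 := h1.cos
    have h4 : HasDerivAt (fun y : ℝ => 2 * (1 - y)) (-2) y := by
      simpa using ((hasDerivAt_id y).const_sub 1).const_mul 2
    have := ((h4.mul h2).div_const v).sub ((h3.const_mul 2).div_const (v ^ 2))
    refine HasDerivAt.congr_deriv this ?_
    field_simp
    ring
  rw [intervalIntegral.integral_eq_sub_of_hasDerivAt h]
  · simp; ring
  · apply Continuous.intervalIntegrable; fun_prop

lemma fej_cont : Continuous fej := by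
  unfold fej
  apply intervalIntegral.continuous_parametric_intervalIntegral_of_continuous'
  fun_prop

lemma fej_nonneg (v : ℝ) : 0 ≤ fej v := by
  by_cases hv : v = 0
  · subst hv
    unfold fej
    apply intervalIntegral.integral_nonneg zero_le_one
    intro y hy
    simp only [zero_mul, Real.cos_zero, mul_one]
    linarith [hy.2]
  · rw [fej_eq v hv]
    have := Real.cos_le_one v
    have : 0 ≤ 1 - Real.cos v := by linarith
    positivity

lemma fej_le_one (v : ℝ) : fej v ≤ 1 := by
  have : fej v ≤ ∫ y in (0 : ℝ)..1, 2 * (1 - y) := by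
    unfold fej
    apply intervalIntegral.integral_mono_on zero_le_one
    · apply Continuous.intervalIntegrable; fun_prop
    · apply Continuous.intervalIntegrable; fun_prop
    · intro y hy
      have h1 := Real.cos_le_one (v * y)
      have : 0 ≤ 2 * (1 - y) := by linarith [hy.2]
      nlinarith
  refine this.trans (le_of_eq ?_)
  rw [intervalIntegral.integral_const_mul, intervalIntegral.integral_sub]
  · simp; norm_num
  · simp
  · simp

lemma fej_le (v : ℝ) : fej v ≤ 5 * (1 + v ^ 2)⁻¹ := by
  rw [← div_eq_mul_inv, le_div_iff₀ (by positivity)]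
  by_cases hv : v ^ 2 ≤ 4
  · nlinarith [fej_le_one v, fej_nonneg v]
  · have hv0 : v ≠ 0 := by rintro rfl; norm_num at hv
    have h4 : fej v * v ^ 2 ≤ 4 := by
      rw [fej_eq v hv0, div_mul_cancel₀ _ (by positivity)]
      linarith [Real.neg_one_le_cos v]
    push Not at hv
    nlinarith [fej_le_one v]

lemma fej_integrable : Integrable fej := by
  refine (integrable_inv_one_add_sq.const_mul 5).mono' fej_cont.aestronglyMeasurable
    (Eventually.of_forall fun v => ?_)
  rw [Real.norm_of_nonneg (fej_nonneg v)]
  exact fej_le v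

lemma fej_integral_pos : 0 < ∫ v, fej v := by
  rw [integral_pos_iff_support_of_nonneg fej_nonneg fej_integrable]
  have hsub : Ioo (1 : ℝ) 2 ⊆ Function.support fej := by
    intro v hv
    have hv0 : v ≠ 0 := by linarith [hv.1]
    rw [Function.mem_support, fej_eq v hv0]
    have : Real.cos v ≠ 1 := by
      intro h
      rw [Real.cos_eq_one_iff_of_lt_of_lt] at h
      · exact hv0 h
      · linarith [hv.1, Real.pi_gt_three]
      · linarith [hv.2, Real.pi_gt_three]
    have : 1 - Real.cos v ≠ 0 := fun h => this (by linarith)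
    positivity
  refine lt_of_lt_of_le ?_ (measure_mono hsub)
  simp

/-- the smoothed transform on the line -/
noncomputable def HH (l σ u : ℝ) : ℂ :=
  ∫ y in (0 : ℝ)..1, ((2 * (1 - y) : ℝ) : ℂ) * Complex.exp (Complex.I * (l * u * y : ℝ)) *
    GG (1 + (σ + Complex.I * (l * y : ℝ)))

lemma smoothed (l σ u : ℝ) (hσ : 0 < σ) :
    ∫ t in Ioi (0 : ℝ), rr t * Real.exp (-σ * t) * fej (l * (u - t)) = (HH l σ u).re := by
  obtain ⟨C, hC, hCb⟩ := rr_bound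
  set F : ℝ → ℝ → ℂ := fun y t => ((2 * (1 - y) : ℝ) : ℂ) *
    Complex.exp (Complex.I * (l * u * y : ℝ)) *
    ((rr t : ℂ) * Complex.exp (-(σ + Complex.I * (l * y : ℝ)) * t)) with hF
  have hIntegr : Integrable (Function.uncurry F)
      ((volume.restrict (Ioc (0 : ℝ) 1)).prod (volume.restrict (Ioi (0 : ℝ)))) := by
    have hdom : Integrable (fun z : ℝ × ℝ => (2 : ℝ) * (C * Real.exp (-σ * z.2)))
        ((volume.restrict (Ioc (0 : ℝ) 1)).prod (volume.restrict (Ioi (0 : ℝ)))) := by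
      have h1 : Integrable (fun _ : ℝ => (2 : ℝ)) (volume.restrict (Ioc (0 : ℝ) 1)) := by simp
      have h2 : Integrable (fun t : ℝ => C * Real.exp (-σ * t)) (volume.restrict (Ioi (0 : ℝ))) :=
        (exp_neg_integrableOn_Ioi 0 hσ).const_mul C
      exact h1.mul_prod h2
    refine hdom.mono' ?_ ?_
    · apply Measurable.aestronglyMeasurable
      have := rr_meas
      simp only [hF, Function.uncurry_def]
      fun_prop
    · rw [Measure.prod_restrict]
      refine (ae_restrict_iff' (measurableSet_Ioc.prod measurableSet_Ioi)).2
        (Eventually.of_forall fun z hz => ?_)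
      obtain ⟨hz1, hz2⟩ := hz
      simp only [hF, Function.uncurry_def, norm_mul, Complex.norm_real, Complex.norm_exp]
      have e1 : (Complex.I * ((l * u * z.1 : ℝ) : ℂ)).re = 0 := by simp
      have e2 : (-(σ + Complex.I * ((l * z.1 : ℝ) : ℂ)) * (z.2 : ℂ)).re = -σ * z.2 := by
        simp [Complex.mul_re]
      rw [e1, e2, Real.exp_zero, mul_one]
      have e3 : ‖2 * (1 - z.1)‖ ≤ 2 := by
        rw [Real.norm_eq_abs, abs_le]; constructor <;> linarith [hz1.1, hz1.2]
      have e4 : ‖rr z.2‖ ≤ C := hCb z.2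
      simp only [norm_mul, Real.norm_eq_abs] at e3 e4 ⊢
      gcongr
  have hH : HH l σ u = ∫ t in Ioi (0 : ℝ), ∫ y in Ioc (0 : ℝ) 1, F y t := by
    rw [← integral_integral_swap hIntegr]
    unfold HH
    rw [intervalIntegral.integral_of_le zero_le_one]
    congr 1
    funext y
    rw [← laplace_rr _ (by simpa using hσ), ← integral_const_mul]
  have hint2 : Integrable (fun t => ∫ y in Ioc (0 : ℝ) 1, F y t) (volume.restrict (Ioi (0 : ℝ))) :=
    hIntegr.integral_prod_right
  have hre := integral_re hint2
  simp only [RCLike.re_eq_complex_re] at hre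
  rw [hH, ← hre]
  refine setIntegral_congr_fun measurableSet_Ioi fun t _ => ?_
  have hy : IntegrableOn (fun y => F y t) (Ioc (0 : ℝ) 1) := by
    have : Continuous (fun y => F y t) := by simp only [hF]; fun_prop
    exact (this.integrableOn_Icc).mono_set Ioc_subset_Icc_self
  have hre2 := integral_re hy
  simp only [RCLike.re_eq_complex_re] at hre2
  rw [← hre2]
  unfold fej
  rw [intervalIntegral.integral_of_le zero_le_one, ← integral_const_mul]
  congr 1
  funext y
  simp only [hF]
  have e1 : ((2 * (1 - y) : ℝ) : ℂ) * Complex.exp (Complex.I * (l * u * y : ℝ)) *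
    ((rr t : ℂ) * Complex.exp (-(σ + Complex.I * (l * y : ℝ)) * t)) =
    ((rr t * Real.exp (-σ * t) * (2 * (1 - y)) : ℝ) : ℂ) *
      Complex.exp ((l * (u - t) * y : ℝ) * Complex.I) := by
    have : Complex.exp (Complex.I * (l * u * y : ℝ)) *
        Complex.exp (-(σ + Complex.I * (l * y : ℝ)) * t) =
        Complex.exp ((-σ * t : ℝ) : ℂ) * Complex.exp ((l * (u - t) * y : ℝ) * Complex.I) := by
      rw [← Complex.exp_add, ← Complex.exp_add]; congr 1; push_cast; ring
    rw [Complex.ofReal_mul (rr t * _), Complex.ofReal_mul (rr t), Complex.ofReal_exp]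
    linear_combination ((2 * (1 - y) : ℝ) : ℂ) * (rr t : ℂ) * this
  rw [e1, Complex.re_ofReal_mul, Complex.exp_ofReal_mul_I_re]
  ring

lemma smoothed_limit (l u : ℝ) (hl : l ≠ 0) :
    ∫ t in Ioi (0 : ℝ), rr t * fej (l * (u - t)) = (HH l 0 u).re := by
  obtain ⟨C, hC, hCb⟩ := rr_bound
  have hfi : Integrable (fun t => fej (l * (u - t))) := by
    have h1 : Integrable (fun t => fej (l * t)) := fej_integrable.comp_mul_left' hl
    exact h1.comp_sub_left u
  set sq : ℕ → ℝ := fun n => 1 / ((n : ℝ) + 1) with hsq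
  have hsq0 : Tendsto sq atTop (𝓝 0) := tendsto_one_div_add_atTop_nhds_zero_nat
  have hsqpos : ∀ n, 0 < sq n := fun n => by simp only [hsq]; positivity
  have hsqle : ∀ n, sq n ≤ 1 := fun n => by
    simp only [hsq]; rw [div_le_one (by positivity)]; linarith [(Nat.cast_nonneg n : (0 : ℝ) ≤ n)]
  have hL : Tendsto (fun n => ∫ t in Ioi (0 : ℝ), rr t * Real.exp (-sq n * t) * fej (l * (u - t)))
      atTop (𝓝 (∫ t in Ioi (0 : ℝ), rr t * fej (l * (u - t)))) := by
    refine tendsto_integral_of_dominated_convergence (fun t => C * fej (l * (u - t))) ?_ ?_ ?_ ?_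
    · intro n
      have := rr_meas
      have := fej_cont.measurable
      apply Measurable.aestronglyMeasurable
      fun_prop
    · exact (hfi.const_mul C).integrableOn
    · intro n
      refine (ae_restrict_iff' measurableSet_Ioi).2 (Eventually.of_forall fun t ht => ?_)
      rw [norm_mul, norm_mul, Real.norm_of_nonneg (fej_nonneg _), Real.norm_of_nonneg (Real.exp_pos _).le]
      have h1 : Real.exp (-sq n * t) ≤ 1 := by
        rw [Real.exp_le_one_iff]
        have : (0 : ℝ) < t := ht
        nlinarith [hsqpos n]
      have h2 : ‖rr t‖ ≤ C := hCb t
      have h3 := fej_nonneg (l * (u - t))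
      have h4 : ‖rr t‖ * Real.exp (-sq n * t) ≤ C * 1 := by gcongr
      rw [mul_one] at h4
      gcongr
    · refine Eventually.of_forall fun t => ?_
      have h1 : Tendsto (fun n => Real.exp (-sq n * t)) atTop (𝓝 (Real.exp (-0 * t))) :=
        (Real.continuous_exp.tendsto _).comp ((hsq0.neg).mul_const t)
      have h2 := (h1.const_mul (rr t)).mul_const (fej (l * (u - t)))
      simpa using h2
  -- the other side
  have hGb : ∃ B : ℝ, ∀ σ ∈ Icc (0 : ℝ) 1, ∀ y ∈ Icc (0 : ℝ) 1,
      ‖GG (1 + (σ + Complex.I * (l * y : ℝ)))‖ ≤ B := by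
    have hc : ContinuousOn (fun z : ℝ × ℝ => GG (1 + (z.1 + Complex.I * (l * z.2 : ℝ))))
        (Icc (0 : ℝ) 1 ×ˢ Icc (0 : ℝ) 1) := by
      refine GG_cont.comp (by fun_prop) ?_
      intro z hz
      have := hz.1.1
      simpa using this
    obtain ⟨B, hB⟩ := (isCompact_Icc.prod isCompact_Icc).exists_bound_of_continuousOn hc
    exact ⟨B, fun σ hσ y hy => hB (σ, y) ⟨hσ, hy⟩⟩
  obtain ⟨B, hB⟩ := hGb
  have hGc : ∀ σ : ℝ, 0 ≤ σ → Continuous (fun y : ℝ => GG (1 + (σ + Complex.I * (l * y : ℝ)))) := by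
    intro σ hσ
    refine GG_cont.comp_continuous (by fun_prop) ?_
    intro y
    simpa using hσ
  have hR : Tendsto (fun n => HH l (sq n) u) atTop (𝓝 (HH l 0 u)) := by
    unfold HH
    refine intervalIntegral.tendsto_integral_filter_of_dominated_convergence (fun _ => 2 * B) ?_ ?_ ?_ ?_
    · refine Eventually.of_forall fun n => ?_
      have := hGc (sq n) (hsqpos n).le
      apply Continuous.aestronglyMeasurable
      fun_prop
    · refine Eventually.of_forall fun n => Eventually.of_forall fun y hy => ?_
      rw [uIoc_of_le zero_le_one] at hy
      rw [norm_mul, norm_mul, Complex.norm_real, Complex.norm_exp]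
      have e1 : (Complex.I * ((l * u * y : ℝ) : ℂ)).re = 0 := by simp
      rw [e1, Real.exp_zero, mul_one]
      have e3 : ‖2 * (1 - y)‖ ≤ 2 := by
        rw [Real.norm_eq_abs, abs_le]; constructor <;> linarith [hy.1, hy.2]
      have e4 := hB (sq n) ⟨(hsqpos n).le, hsqle n⟩ y ⟨hy.1.le, hy.2⟩
      exact mul_le_mul e3 e4 (norm_nonneg _) (by norm_num)
    · simp
    · refine Eventually.of_forall fun y hy => ?_
      refine Tendsto.const_mul _ ?_
      have h0 := GG_cont (1 + ((0 : ℝ) + Complex.I * (l * y : ℝ))) (by simp)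
      refine h0.tendsto.comp ?_
      refine tendsto_nhdsWithin_iff.2 ⟨?_, Eventually.of_forall fun n => ?_⟩
      · have h1 : Tendsto (fun n => ((sq n : ℝ) : ℂ)) atTop (𝓝 ((0 : ℝ) : ℂ)) :=
          (Complex.continuous_ofReal.tendsto 0).comp hsq0
        exact (h1.add_const _).const_add 1
      · simpa using (hsqpos n).le
  have hR' : Tendsto (fun n => (HH l (sq n) u).re) atTop (𝓝 (HH l 0 u).re) :=
    (Complex.continuous_re.tendsto _).comp hR
  refine tendsto_nhds_unique hL (hR'.congr fun n => ?_)
  rw [smoothed l (sq n) u (hsqpos n)]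

lemma smoothed_tendsto (l : ℝ) (hl : 0 < l) :
    Tendsto (fun u => ∫ t in Ioi (0 : ℝ), rr t * fej (l * (u - t))) atTop (𝓝 0) := by
  simp_rw [fun u => smoothed_limit l u hl.ne']
  have h : Tendsto (fun u => HH l 0 u) atTop (𝓝 0) := by
    set f : ℝ → ℂ := fun y => (Ioc (0 : ℝ) 1).indicator (fun y => ((2 * (1 - y) : ℝ) : ℂ) *
      GG (1 + ((0 : ℝ) + Complex.I * (l * y : ℝ)))) y with hf
    have hRL := Real.tendsto_integral_exp_smul_cocompact f
    have hmap : Tendsto (fun u : ℝ => -(l / (2 * Real.pi)) * u) atTop (cocompact ℝ) := by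
      refine Tendsto.mono_right ?_ atBot_le_cocompact
      refine Tendsto.const_mul_atTop_of_neg ?_ tendsto_id
      have := Real.pi_pos
      have : 0 < l / (2 * Real.pi) := by positivity
      linarith
    refine (hRL.comp hmap).congr fun u => ?_
    simp only [Function.comp]
    unfold HH
    rw [intervalIntegral.integral_of_le zero_le_one, ← integral_indicator measurableSet_Ioc]
    congr 1
    funext y
    simp only [hf]
    by_cases hy : y ∈ Ioc (0 : ℝ) 1
    · rw [indicator_of_mem hy, indicator_of_mem hy, Circle.smul_def, Real.fourierChar_apply, smul_eq_mul]
      have : Complex.exp (((2 * Real.pi * -(y * (-(l / (2 * Real.pi)) * u)) : ℝ) : ℂ) * Complex.I) =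
          Complex.exp (Complex.I * (l * u * y : ℝ)) := by
        congr 1
        have : 2 * Real.pi * -(y * (-(l / (2 * Real.pi)) * u)) = l * u * y := by
          have := Real.pi_ne_zero
          field_simp
        rw [this]; ring
      rw [this]; ring
    · rw [indicator_of_notMem hy, indicator_of_notMem hy, smul_zero]
  have := (Complex.continuous_re.tendsto 0).comp h
  simpa [Function.comp_def] using this

end LO

namespace LO
open MeasureTheory Set Filter Topology

lemma exists_l (e C τ : ℝ) (he : 0 < e) (hC : 0 < C) (hτ : 0 < τ) : ∃ l : ℝ, 0 < l ∧
    ∫ w, fej w * (-e + (C + e) * indicator {w : ℝ | l * τ < |w|} 1 w) < 0 := by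
  have hlim : Tendsto (fun l : ℝ => ∫ w, fej w * (-e + (C + e) * indicator {w : ℝ | l * τ < |w|} 1 w))
      atTop (𝓝 (∫ w, fej w * (-e))) := by
    refine tendsto_integral_filter_of_dominated_convergence (fun w => fej w * (C + e + e)) ?_ ?_ ?_ ?_
    · refine Eventually.of_forall fun l => ?_
      apply Measurable.aestronglyMeasurable
      have := fej_cont.measurable
      have hm : MeasurableSet {w : ℝ | l * τ < |w|} :=
        measurableSet_lt measurable_const (by fun_prop)
      have : Measurable (indicator {w : ℝ | l * τ < |w|} (1 : ℝ → ℝ)) := measurable_one.indicator hm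
      fun_prop
    · refine Eventually.of_forall fun l => Eventually.of_forall fun w => ?_
      rw [norm_mul, Real.norm_of_nonneg (fej_nonneg w)]
      refine mul_le_mul_of_nonneg_left ?_ (fej_nonneg w)
      rw [Real.norm_eq_abs]
      by_cases h : w ∈ {w : ℝ | l * τ < |w|}
      · rw [indicator_of_mem h, abs_le]; constructor <;> simp <;> linarith
      · rw [indicator_of_notMem h, abs_le]; constructor <;> simp <;> linarith
    · exact fej_integrable.mul_const _
    · refine Eventually.of_forall fun w => ?_
      refine tendsto_const_nhds.congr' ?_
      filter_upwards [eventually_gt_atTop (|w| / τ)] with l hl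
      rw [indicator_of_notMem]
      · ring
      · simp only [Set.mem_ofPred_eq, not_lt]
        rw [div_lt_iff₀ hτ] at hl; exact hl.le
  have hneg : ∫ w, fej w * (-e) < 0 := by
    rw [integral_mul_const]
    have := fej_integral_pos
    nlinarith
  have h := (hlim.eventually_lt_const hneg).and (eventually_gt_atTop 0)
  obtain ⟨l, h1, h2⟩ := h.exists
  exact ⟨l, h2, h1⟩

theorem psi_lower (ε : ℝ) (hε : 0 < ε) (hε1 : ε < 1) :
    ∀ᶠ x : ℝ in atTop, (1 - ε) * x ≤ Chebyshev.psi x := by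
  obtain ⟨C, hC, hCb⟩ := rr_bound
  set e := ε / 2 with he
  -- choose tau
  obtain ⟨τ, hτ, hτe⟩ : ∃ τ : ℝ, 0 < τ ∧ (1 - ε) * Real.exp (2 * τ) ≤ 1 - e := by
    refine ⟨Real.log ((1 - e) / (1 - ε)) / 2, ?_, ?_⟩
    · apply div_pos _ (by norm_num)
      apply Real.log_pos
      rw [lt_div_iff₀ (by linarith)]; linarith
    · rw [mul_div_cancel₀ _ (by norm_num), Real.exp_log (div_pos (by linarith) (by linarith)),
        mul_div_cancel₀ _ (by linarith)]
  obtain ⟨l, hl, hneg⟩ := exists_l e C τ (by positivity) hC hτ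
  set K : ℝ → ℝ := fun w => fej w * (-e + (C + e) * indicator {w : ℝ | l * τ < |w|} 1 w) with hK
  have hKint : Integrable K := by
    refine (fej_integrable.mul_const (C + e + e)).mono' ?_ ?_
    · apply Measurable.aestronglyMeasurable
      have := fej_cont.measurable
      have hm : MeasurableSet {w : ℝ | l * τ < |w|} :=
        measurableSet_lt measurable_const (by fun_prop)
      have : Measurable (indicator {w : ℝ | l * τ < |w|} (1 : ℝ → ℝ)) := measurable_one.indicator hm
      fun_prop
    · refine Eventually.of_forall fun w => ?_
      simp only [hK]
      rw [norm_mul, Real.norm_of_nonneg (fej_nonneg w)]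
      refine mul_le_mul_of_nonneg_left ?_ (fej_nonneg w)
      rw [Real.norm_eq_abs]
      by_cases h : w ∈ {w : ℝ | l * τ < |w|}
      · rw [indicator_of_mem h, abs_le]; constructor <;> simp <;> linarith
      · rw [indicator_of_notMem h, abs_le]; constructor <;> simp <;> linarith
  have hlim := smoothed_tendsto l hl
  have hneg' : l⁻¹ * ∫ w, K w < 0 := mul_neg_of_pos_of_neg (inv_pos.2 hl) hneg
  have hev := hlim.eventually_const_lt hneg'
  have hsh : Tendsto (fun x : ℝ => Real.log x - τ) atTop atTop :=
    tendsto_atTop_add_const_right _ _ Real.tendsto_log_atTop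
  filter_upwards [hsh.eventually hev, eventually_gt_atTop (Real.exp (2 * τ))] with x hx hx2
  by_contra hcon
  push Not at hcon
  have hx0 : 0 < x := (Real.exp_pos _).trans hx2
  set u0 := Real.log x with hu0
  have hu0τ : 2 * τ < u0 := by rw [hu0, Real.lt_log_iff_exp_lt hx0]; exact hx2
  set u := u0 - τ with hu
  have hpt : ∀ t, u - τ ≤ t → t ≤ u + τ → rr t ≤ -e := by
    intro t h1 h2
    unfold rr
    have h3 : Chebyshev.psi (Real.exp t) ≤ Chebyshev.psi x := by
      apply Chebyshev.psi_mono
      rw [← Real.exp_log hx0]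
      apply Real.exp_le_exp.2
      linarith
    have h4 : Real.exp (-t) ≤ Real.exp (2 * τ) * x⁻¹ := by
      rw [← Real.exp_log hx0, ← Real.exp_neg, ← Real.exp_add]
      apply Real.exp_le_exp.2; linarith
    have h5 : Chebyshev.psi (Real.exp t) * Real.exp (-t) ≤ ((1 - ε) * x) * (Real.exp (2 * τ) * x⁻¹) := by
      apply mul_le_mul (h3.trans hcon.le) h4 (Real.exp_pos _).le
      apply mul_nonneg _ hx0.le; linarith
    have h6 : ((1 - ε) * x) * (Real.exp (2 * τ) * x⁻¹) = (1 - ε) * Real.exp (2 * τ) := by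
      field_simp
    linarith
  have hKt : ∀ t, rr t * fej (l * (u - t)) ≤ K (l * (u - t)) := by
    intro t
    simp only [hK]
    rw [mul_comm]
    refine mul_le_mul_of_nonneg_left ?_ (fej_nonneg _)
    by_cases h : (l * (u - t)) ∈ {w : ℝ | l * τ < |w|}
    · rw [indicator_of_mem h]; simp; exact (abs_le.1 (hCb t)).2
    · rw [indicator_of_notMem h]
      simp only [Set.mem_ofPred_eq, not_lt] at h
      rw [abs_mul, abs_of_pos hl] at h
      have := abs_le.1 (le_of_mul_le_mul_left h hl)
      have := hpt t (by linarith [this.2]) (by linarith [this.1])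
      simpa using this
  have hK0 : ∀ t, t ≤ 0 → 0 ≤ K (l * (u - t)) := by
    intro t ht
    simp only [hK]
    apply mul_nonneg (fej_nonneg _)
    rw [indicator_of_mem]
    · simp; linarith
    · simp only [Set.mem_ofPred_eq]
      rw [abs_mul, abs_of_pos hl]
      refine mul_lt_mul_of_pos_left ?_ hl
      refine lt_of_lt_of_le ?_ (le_abs_self _)
      linarith
  have hKi : Integrable (fun t => K (l * (u - t))) := by
    have h1 : Integrable (fun t => K (l * t)) := hKint.comp_mul_left' hl.ne'
    exact h1.comp_sub_left u
  have hfi : Integrable (fun t => fej (l * (u - t))) := by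
    have h1 : Integrable (fun t => fej (l * t)) := fej_integrable.comp_mul_left' hl.ne'
    exact h1.comp_sub_left u
  have hri : Integrable (fun t => rr t * fej (l * (u - t))) :=
    hfi.bdd_mul (c := C) rr_meas.aestronglyMeasurable (Eventually.of_forall fun t => hCb t)
  have s1 : ∫ t in Ioi (0 : ℝ), rr t * fej (l * (u - t)) ≤ ∫ t in Ioi (0 : ℝ), K (l * (u - t)) :=
    setIntegral_mono hri.integrableOn hKi.integrableOn hKt
  have s2 : ∫ t in Ioi (0 : ℝ), K (l * (u - t)) ≤ ∫ t, K (l * (u - t)) := by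
    have := intervalIntegral.integral_Iic_add_Ioi (b := 0) hKi.integrableOn hKi.integrableOn
    have h2 : 0 ≤ ∫ t in Iic (0 : ℝ), K (l * (u - t)) :=
      setIntegral_nonneg measurableSet_Iic fun t ht => hK0 t ht
    linarith
  have s3 : ∫ t, K (l * (u - t)) = l⁻¹ * ∫ w, K w := by
    rw [integral_sub_left_eq_self (fun t => K (l * t)) volume u, Measure.integral_comp_mul_left]
    rw [abs_of_pos (inv_pos.2 hl), smul_eq_mul]
  rw [s3] at s2
  linarith

end LO

namespace LO
open Finset

/-- `e(x) = exp(2 π i x)` -/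
noncomputable def ee (x : ℝ) : ℂ := Complex.exp (((2 * Real.pi * x : ℝ) : ℂ) * Complex.I)

lemma ee_add (x y : ℝ) : ee (x + y) = ee x * ee y := by
  unfold ee; rw [← Complex.exp_add]; congr 1; push_cast; ring

lemma ee_zero : ee 0 = 1 := by simp [ee]

lemma norm_ee (x : ℝ) : ‖ee x‖ = 1 := by unfold ee; exact Complex.norm_exp_ofReal_mul_I _

lemma ee_neg (x : ℝ) : ee (-x) = (starRingEnd ℂ) (ee x) := by
  unfold ee
  rw [← Complex.exp_conj]
  congr 1
  rw [map_mul, Complex.conj_ofReal, Complex.conj_I]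
  push_cast; ring

lemma ee_nat_mul (n : ℕ) (x : ℝ) : ee (n * x) = ee x ^ n := by
  unfold ee; rw [← Complex.exp_nat_mul]; congr 1; push_cast; ring

lemma ee_int (k : ℤ) : ee k = 1 := by
  unfold ee
  rw [Complex.exp_eq_one_iff]
  exact ⟨k, by push_cast; ring⟩

lemma ee_fract (x : ℝ) : ee (Int.fract x) = ee x := by
  conv_rhs => rw [← Int.floor_add_fract x, ee_add, ee_int, one_mul]

lemma norm_one_sub_ee (x : ℝ) : ‖1 - ee x‖ = 2 * |Real.sin (Real.pi * x)| := by
  have h : 1 - ee x = ee (x / 2) * (-(2 * Complex.I) * (Real.sin (Real.pi * x) : ℝ)) := by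
    have h1 : ee x = ee (x / 2) * ee (x / 2) := by rw [← ee_add]; congr 1; ring
    have h2 : (1 : ℂ) = ee (x / 2) * ee (-(x / 2)) := by rw [← ee_add]; simp [ee_zero]
    have h3 : ee (-(x / 2)) - ee (x / 2) = -(2 * Complex.I) * (Real.sin (Real.pi * x) : ℝ) := by
      unfold ee
      rw [Complex.exp_mul_I, Complex.exp_mul_I]
      have e1 : ((2 * Real.pi * (x / 2) : ℝ) : ℂ) = ((Real.pi * x : ℝ) : ℂ) := by congr 1; ring
      have e2 : ((2 * Real.pi * -(x / 2) : ℝ) : ℂ) = -((Real.pi * x : ℝ) : ℂ) := by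
        push_cast; ring
      rw [e1, e2, Complex.cos_neg, Complex.sin_neg, Complex.ofReal_sin]
      ring
    rw [← h3]
    linear_combination h2 - h1
  rw [h, norm_mul, norm_ee, one_mul, norm_mul, norm_neg, norm_mul, Complex.norm_I, Complex.norm_real]
  simp

lemma one_sub_ee_lower (t : ℝ) (h0 : 0 < t) (h1 : t < 1) :
    (1 / t + 1 / (1 - t))⁻¹ * 4 ≤ ‖1 - ee t‖ := by
  have key : ∀ s : ℝ, 0 < s → s ≤ 1 / 2 → 2 * s ≤ Real.sin (Real.pi * s) := by
    intro s hs hs2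
    have := Real.mul_le_sin (x := Real.pi * s) (by positivity) (by nlinarith [Real.pi_pos])
    have e : 2 / Real.pi * (Real.pi * s) = 2 * s := by field_simp
    linarith
  have h1t : 0 < 1 - t := by linarith
  rw [norm_one_sub_ee]
  rcases le_total t (1 / 2) with h | h
  · have := key t h0 h
    have h3 : (1 / t + 1 / (1 - t))⁻¹ ≤ t := by
      rw [inv_le_comm₀ (by positivity) h0, inv_eq_one_div]
      linarith [div_pos one_pos h1t]
    have := le_abs_self (Real.sin (Real.pi * t))
    linarith
  · have := key (1 - t) h1t (by linarith)
    have h3 : (1 / t + 1 / (1 - t))⁻¹ ≤ 1 - t := by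
      rw [inv_le_comm₀ (by positivity) h1t, inv_eq_one_div]
      linarith [div_pos one_pos h0]
    have h4 : Real.sin (Real.pi * (1 - t)) = Real.sin (Real.pi * t) := by
      rw [← Real.sin_pi_sub]; congr 1; ring
    rw [h4] at this
    have := le_abs_self (Real.sin (Real.pi * t))
    linarith

lemma geom_bound (N : ℕ) (x : ℝ) (hx : Int.fract x ≠ 0) :
    ‖∑ n ∈ range N, ee (n * x)‖ ≤ (1 / Int.fract x + 1 / (1 - Int.fract x)) / 2 := by
  set t := Int.fract x with ht
  have h0 : 0 < t := lt_of_le_of_ne (Int.fract_nonneg x) (Ne.symm hx)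
  have h1 : t < 1 := Int.fract_lt_one x
  have h1t : 0 < 1 - t := by linarith
  have hl := one_sub_ee_lower t h0 h1
  have hpos : 0 < 1 / t + 1 / (1 - t) := by positivity
  have hl0 : 0 < ‖1 - ee t‖ := lt_of_lt_of_le (by positivity) hl
  have hne : ee x ≠ 1 := by
    rw [← ee_fract x, ← ht]
    intro h; rw [h] at hl0; simp at hl0
  simp_rw [ee_nat_mul]
  rw [geom_sum_eq hne, norm_div]
  have h2 : ‖ee x ^ N - 1‖ ≤ 2 := by
    refine (norm_sub_le _ _).trans ?_
    rw [norm_pow, norm_ee]; norm_num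
  have h3 : ‖ee x - 1‖ = ‖1 - ee t‖ := by rw [ht, ee_fract, norm_sub_rev]
  rw [h3, div_le_iff₀ hl0]
  have : 2 = (1 / t + 1 / (1 - t)) / 2 * ((1 / t + 1 / (1 - t))⁻¹ * 4) := by
    field_simp; norm_num
  calc _ ≤ 2 := h2
    _ = _ := this
    _ ≤ _ := by gcongr

/-- sums of reciprocals of well spaced points in `[δ, 1]`. -/
lemma spaced_sum {ι : Type*} (R : Finset ι) (t : ι → ℝ) (δ : ℝ) (hδ : 0 < δ) (hδ1 : δ ≤ 1)
    (h1 : ∀ r ∈ R, δ ≤ t r) (h2 : ∀ r ∈ R, t r ≤ 1)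
    (hsp : ∀ r ∈ R, ∀ s ∈ R, r ≠ s → δ ≤ |t r - t s|) :
    ∑ r ∈ R, 1 / t r ≤ δ⁻¹ * (1 + Real.log δ⁻¹) := by
  classical
  set j : ι → ℕ := fun r => ⌊t r / δ⌋₊ with hj
  have hj1 : ∀ r ∈ R, 1 ≤ j r := fun r hr => by
    rw [hj, Nat.one_le_floor_iff, one_le_div hδ]; exact h1 r hr
  have hinj : Set.InjOn j R := by
    intro r hr s hs hrs
    by_contra hne
    have := hsp r hr s hs hne
    have a1 : 0 ≤ t r / δ := div_nonneg (hδ.le.trans (h1 r hr)) hδ.le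
    have a2 : 0 ≤ t s / δ := div_nonneg (hδ.le.trans (h1 s hs)) hδ.le
    have b1 := Nat.floor_le a1
    have b2 := Nat.floor_le a2
    have c1 := Nat.lt_floor_add_one (t r / δ)
    have c2 := Nat.lt_floor_add_one (t s / δ)
    simp only [hj] at hrs
    rw [hrs] at b1 c1
    have : |t r / δ - t s / δ| < 1 := by rw [abs_lt]; constructor <;> linarith
    rw [← sub_div, abs_div, abs_of_pos hδ, div_lt_one hδ] at this
    linarith
  have hle : ∀ r ∈ R, 1 / t r ≤ δ⁻¹ * (1 / (j r : ℝ)) := by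
    intro r hr
    have hjp : (0 : ℝ) < j r := by exact_mod_cast hj1 r hr
    have h3 : (j r : ℝ) ≤ t r / δ := Nat.floor_le (div_nonneg (hδ.le.trans (h1 r hr)) hδ.le)
    have h4 : (j r : ℝ) * δ ≤ t r := by rwa [le_div_iff₀ hδ] at h3
    calc 1 / t r ≤ 1 / (j r * δ) := by gcongr
      _ = _ := by field_simp
  calc ∑ r ∈ R, 1 / t r ≤ ∑ r ∈ R, δ⁻¹ * (1 / (j r : ℝ)) := sum_le_sum hle
    _ = δ⁻¹ * ∑ r ∈ R, 1 / (j r : ℝ) := by rw [mul_sum]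
    _ = δ⁻¹ * ∑ k ∈ R.image j, 1 / (k : ℝ) := by
        rw [sum_image (fun r hr s hs h => hinj hr hs h)]
    _ ≤ δ⁻¹ * ∑ k ∈ Icc 1 ⌊δ⁻¹⌋₊, 1 / (k : ℝ) := by
        gcongr
        intro k hk
        obtain ⟨r, hr, rfl⟩ := mem_image.1 hk
        rw [mem_Icc]
        refine ⟨hj1 r hr, Nat.floor_le_floor ?_⟩
        rw [div_eq_mul_inv]
        exact mul_le_of_le_one_left (by positivity) (h2 r hr)
    _ ≤ δ⁻¹ * (1 + Real.log δ⁻¹) := by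
        gcongr
        have := harmonic_floor_le_one_add_log δ⁻¹ ((one_le_inv₀ hδ).2 hδ1)
        refine le_trans (le_of_eq ?_) this
        rw [harmonic_eq_sum_Icc]; push_cast
        simp [one_div]

lemma geom_spaced {ι : Type*} (R : Finset ι) (θ : ι → ℝ) (δ : ℝ) (hδ : 0 < δ) (hδ1 : δ ≤ 1)
    (hsp : ∀ r ∈ R, ∀ s ∈ R, r ≠ s → ∀ k : ℤ, δ ≤ |θ r - θ s - k|) (N : ℕ)
    (x : ℝ) (hx : ∀ r ∈ R, ∀ k : ℤ, δ ≤ |θ r - x - k|) :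
    ∑ r ∈ R, ‖∑ n ∈ range N, ee (n * (θ r - x))‖ ≤ δ⁻¹ * (1 + Real.log δ⁻¹) := by
  set t : ι → ℝ := fun r => Int.fract (θ r - x) with ht
  have h1 : ∀ r ∈ R, δ ≤ t r := fun r hr => by
    have := hx r hr ⌊θ r - x⌋
    rwa [Int.self_sub_floor, abs_of_nonneg (Int.fract_nonneg _)] at this
  have h2 : ∀ r ∈ R, δ ≤ 1 - t r := fun r hr => by
    have := hx r hr (⌊θ r - x⌋ + 1)
    push_cast at this
    rw [← sub_sub, Int.self_sub_floor, abs_of_nonpos] at this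
    · simp only [ht]; linarith
    · linarith [Int.fract_lt_one (θ r - x)]
  have hs1 : ∀ r ∈ R, ∀ s ∈ R, r ≠ s → δ ≤ |t r - t s| := by
    intro r hr s hs hne
    have := hsp r hr s hs hne (⌊θ r - x⌋ - ⌊θ s - x⌋)
    have e : t r - t s = θ r - θ s - ((⌊θ r - x⌋ - ⌊θ s - x⌋ : ℤ) : ℝ) := by
      simp only [ht, Int.fract]; push_cast; ring
    rwa [e]
  have A := spaced_sum R t δ hδ hδ1 h1 (fun r _ => (Int.fract_lt_one _).le) hs1
  have B := spaced_sum R (fun r => 1 - t r) δ hδ hδ1 h2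
    (fun r _ => by linarith [Int.fract_nonneg (θ r - x)])
    (fun r hr s hs hne => by
      have := hs1 r hr s hs hne
      rw [abs_sub_comm] at this
      have e : 1 - t r - (1 - t s) = t s - t r := by ring
      rwa [e])
  calc _ ≤ ∑ r ∈ R, (1 / t r + 1 / (1 - t r)) / 2 := by
        refine sum_le_sum fun r hr => geom_bound N _ ?_
        have := h1 r hr
        simp only [ht] at this
        linarith
    _ = (∑ r ∈ R, 1 / t r + ∑ r ∈ R, 1 / (1 - t r)) / 2 := by
        rw [← sum_div, sum_add_distrib]
    _ ≤ _ := by linarith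

lemma dual_ls {ι : Type*} (R : Finset ι) (θ : ι → ℝ) (δ : ℝ) (hδ : 0 < δ) (hδ1 : δ ≤ 1)
    (hsp : ∀ r ∈ R, ∀ s ∈ R, r ≠ s → ∀ k : ℤ, δ ≤ |θ r - θ s - k|) (N : ℕ) (b : ι → ℂ) :
    ∑ n ∈ range N, ‖∑ r ∈ R, b r * ee (n * θ r)‖ ^ 2 ≤
      (N + δ⁻¹ * (1 + Real.log δ⁻¹)) * ∑ r ∈ R, ‖b r‖ ^ 2 := by
  classical
  set G : ι → ι → ℝ := fun r s => ‖∑ n ∈ range N, ee (n * (θ r - θ s))‖ with hG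
  set B := δ⁻¹ * (1 + Real.log δ⁻¹) with hB
  have hGsum : ∀ s ∈ R, ∑ r ∈ R, G r s ≤ N + B := by
    intro s hs
    rw [← add_sum_erase _ _ hs]
    have h1 : G s s = N := by simp [hG, ee_zero]
    rw [h1]
    gcongr
    refine geom_spaced (R.erase s) θ δ hδ hδ1 ?_ N (θ s) ?_
    · intro r hr s' hs'; exact hsp r (mem_of_mem_erase hr) s' (mem_of_mem_erase hs')
    · intro r hr k; exact hsp r (mem_of_mem_erase hr) s hs (ne_of_mem_erase hr) k
  have hGsymm : ∀ r s, G r s = G s r := by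
    intro r s
    simp only [hG]
    rw [← RCLike.norm_conj, map_sum]
    congr 1
    refine sum_congr rfl fun n _ => ?_
    rw [← ee_neg]; congr 1; ring
  have hexp : ((∑ n ∈ range N, ‖∑ r ∈ R, b r * ee (n * θ r)‖ ^ 2 : ℝ) : ℂ) =
      ∑ r ∈ R, ∑ s ∈ R, b r * (starRingEnd ℂ) (b s) * ∑ n ∈ range N, ee (n * (θ r - θ s)) := by
    push_cast
    have : ∀ n ∈ range N, ((‖∑ r ∈ R, b r * ee (n * θ r)‖ : ℂ)) ^ 2 =
        ∑ r ∈ R, ∑ s ∈ R, b r * (starRingEnd ℂ) (b s) * ee (n * (θ r - θ s)) := by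
      intro n _
      rw [← Complex.mul_conj', map_sum, sum_mul_sum]
      refine sum_congr rfl fun r _ => sum_congr rfl fun s _ => ?_
      rw [map_mul, ← ee_neg]
      have : ee (n * (θ r - θ s)) = ee (n * θ r) * ee (-(n * θ s)) := by rw [← ee_add]; congr 1; ring
      rw [this]; ring
    rw [sum_congr rfl this, sum_comm]
    refine sum_congr rfl fun r _ => ?_
    rw [sum_comm]
    refine sum_congr rfl fun s _ => ?_
    rw [mul_sum]
  have h0 : (0 : ℝ) ≤ ∑ n ∈ range N, ‖∑ r ∈ R, b r * ee (n * θ r)‖ ^ 2 :=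
    sum_nonneg fun _ _ => by positivity
  have h1 : ∑ n ∈ range N, ‖∑ r ∈ R, b r * ee (n * θ r)‖ ^ 2 ≤
      ∑ r ∈ R, ∑ s ∈ R, ‖b r‖ * ‖b s‖ * G r s := by
    calc _ = ‖((∑ n ∈ range N, ‖∑ r ∈ R, b r * ee (n * θ r)‖ ^ 2 : ℝ) : ℂ)‖ := by
          rw [Complex.norm_real, Real.norm_of_nonneg h0]
      _ ≤ _ := by
          rw [hexp]
          refine (norm_sum_le _ _).trans (sum_le_sum fun r _ => ?_)
          refine (norm_sum_le _ _).trans (sum_le_sum fun s _ => ?_)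
          rw [norm_mul, norm_mul, RCLike.norm_conj]
  have h2 : ∑ r ∈ R, ∑ s ∈ R, ‖b r‖ * ‖b s‖ * G r s ≤
      ∑ r ∈ R, ∑ s ∈ R, (‖b r‖ ^ 2 / 2 * G r s + ‖b s‖ ^ 2 / 2 * G r s) := by
    refine sum_le_sum fun r _ => sum_le_sum fun s _ => ?_
    rw [← add_mul]
    have : 0 ≤ G r s := norm_nonneg _
    gcongr
    nlinarith [sq_nonneg (‖b r‖ - ‖b s‖)]
  have h3 : ∑ r ∈ R, ∑ s ∈ R, ‖b r‖ ^ 2 / 2 * G r s ≤ ∑ r ∈ R, ‖b r‖ ^ 2 / 2 * (N + B) := by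
    refine sum_le_sum fun r hr => ?_
    rw [← mul_sum]
    gcongr
    rw [sum_congr rfl fun s _ => hGsymm r s]
    exact hGsum r hr
  have h4 : ∑ r ∈ R, ∑ s ∈ R, ‖b s‖ ^ 2 / 2 * G r s ≤ ∑ r ∈ R, ‖b r‖ ^ 2 / 2 * (N + B) := by
    rw [sum_comm]
    refine sum_le_sum fun r hr => ?_
    rw [← mul_sum]
    gcongr
    exact hGsum r hr
  simp_rw [sum_add_distrib] at h2
  rw [mul_sum]
  have h5 : ∑ i ∈ R, (N + B) * ‖b i‖ ^ 2 = ∑ r ∈ R, ‖b r‖ ^ 2 / 2 * (N + B) +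
     ∑ r ∈ R, ‖b r‖ ^ 2 / 2 * (N + B) := by
    rw [← sum_add_distrib]; refine sum_congr rfl fun r _ => by ring
  rw [h5]
  linarith

theorem large_sieve {ι : Type*} (R : Finset ι) (θ : ι → ℝ) (δ : ℝ) (hδ : 0 < δ) (hδ1 : δ ≤ 1)
    (hsp : ∀ r ∈ R, ∀ s ∈ R, r ≠ s → ∀ k : ℤ, δ ≤ |θ r - θ s - k|) (N : ℕ) (c : ℕ → ℂ) :
    ∑ r ∈ R, ‖∑ n ∈ range N, c n * ee (n * θ r)‖ ^ 2 ≤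
      (N + δ⁻¹ * (1 + Real.log δ⁻¹)) * ∑ n ∈ range N, ‖c n‖ ^ 2 := by
  set T : ι → ℂ := fun r => ∑ n ∈ range N, c n * ee (n * θ r) with hT
  set S := ∑ r ∈ R, ‖T r‖ ^ 2 with hS
  have hS0 : 0 ≤ S := sum_nonneg fun _ _ => by positivity
  set K := (N + δ⁻¹ * (1 + Real.log δ⁻¹)) with hK
  set Cc := ∑ n ∈ range N, ‖c n‖ ^ 2 with hCc
  have hd := dual_ls R θ δ hδ hδ1 hsp N (fun r => (starRingEnd ℂ) (T r))
  simp only [RCLike.norm_conj] at hd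
  have hSe : (S : ℂ) = ∑ n ∈ range N, c n * ∑ r ∈ R, (starRingEnd ℂ) (T r) * ee (n * θ r) := by
    rw [hS]; push_cast
    simp_rw [mul_sum]
    rw [sum_comm]
    refine sum_congr rfl fun r _ => ?_
    rw [← Complex.conj_mul']
    conv_lhs => rw [hT]
    rw [mul_sum]
    refine sum_congr rfl fun n _ => ?_
    simp only [hT]
    ring
  have h1 : S ≤ ∑ n ∈ range N, ‖c n‖ * ‖∑ r ∈ R, (starRingEnd ℂ) (T r) * ee (n * θ r)‖ := by
    calc S = ‖(S : ℂ)‖ := by rw [Complex.norm_real, Real.norm_of_nonneg hS0]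
      _ ≤ _ := by
        rw [hSe]
        refine (norm_sum_le _ _).trans (sum_le_sum fun n _ => ?_)
        rw [norm_mul]
  have h2 := sum_mul_sq_le_sq_mul_sq (range N) (fun n => ‖c n‖)
    (fun n => ‖∑ r ∈ R, (starRingEnd ℂ) (T r) * ee (n * θ r)‖)
  have h3 : S ^ 2 ≤ Cc * (K * S) := by
    calc S ^ 2 ≤ _ := pow_le_pow_left₀ hS0 h1 2
      _ ≤ _ := h2
      _ ≤ Cc * (K * S) := mul_le_mul_of_nonneg_left hd (sum_nonneg fun _ _ => by positivity)
  rcases hS0.eq_or_lt with h | h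
  · rw [← h]
    have hlog : 0 ≤ Real.log δ⁻¹ := Real.log_nonneg ((one_le_inv₀ hδ).2 hδ1)
    have : 0 ≤ K := by positivity
    have : 0 ≤ Cc := sum_nonneg fun _ _ => by positivity
    positivity
  · have : S * S ≤ (K * Cc) * S := by nlinarith
    exact le_of_mul_le_mul_right this h

end LO

namespace LO
open Finset

lemma orth (q : ℕ) (hq : 0 < q) (t : ℤ) :
    ∑ a ∈ range q, ee (a * (t / q : ℝ)) = if (q : ℤ) ∣ t then (q : ℂ) else 0 := by
  have hq' : (q : ℝ) ≠ 0 := by positivity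
  split_ifs with h
  · obtain ⟨k, rfl⟩ := h
    have : ∀ a ∈ range q, ee (a * (((q * k : ℤ) : ℝ) / q)) = 1 := by
      intro a _
      have e : (a : ℝ) * (((q * k : ℤ) : ℝ) / q) = ((a * k : ℤ) : ℝ) := by
        push_cast; field_simp
      rw [e, ee_int]
    rw [sum_congr rfl this]; simp
  · have hne : ee (t / q : ℝ) ≠ 1 := by
      intro h1
      unfold ee at h1
      rw [Complex.exp_eq_one_iff] at h1
      obtain ⟨n, hn⟩ := h1
      apply h
      refine ⟨n, ?_⟩
      have hpi : (2 * Real.pi * Complex.I : ℂ) ≠ 0 := Complex.two_pi_I_ne_zero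
      have h3 : ((t : ℂ) / q) = n := by
        have : (2 * Real.pi * Complex.I : ℂ) * ((t : ℂ) / q) = (2 * Real.pi * Complex.I : ℂ) * n := by
          push_cast at hn
          linear_combination hn
        exact mul_left_cancel₀ hpi this
      rw [div_eq_iff (by exact_mod_cast hq.ne')] at h3
      have : t = n * q := by exact_mod_cast h3
      rw [this]; ring
    simp_rw [ee_nat_mul]
    rw [geom_sum_eq hne, ← ee_nat_mul]
    have : (q : ℝ) * (t / q) = t := by field_simp
    rw [this, ee_int]; simp

/-- reduced residues -/
def red (d : ℕ) : Finset ℕ := (range d).filter (fun a => Nat.Coprime a d)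

lemma farey_spacing (k Q d d' a a' : ℕ) (hd : 1 ≤ d) (hd' : 1 ≤ d') (hdQ : d ≤ Q) (hdQ' : d' ≤ Q)
    (hk : Nat.Coprime k d) (hk' : Nat.Coprime k d') (ha : a ∈ red d) (ha' : a' ∈ red d')
    (hne : ¬ (d = d' ∧ a = a')) (j : ℤ) :
    ((Q : ℝ) ^ 2)⁻¹ ≤ |(k * a / d : ℝ) - (k * a' / d' : ℝ) - j| := by
  simp only [red, mem_filter, mem_range] at ha ha'
  have hd0 : (0 : ℝ) < d := by exact_mod_cast hd
  have hd0' : (0 : ℝ) < d' := by exact_mod_cast hd'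
  set w : ℤ := k * a * d' - k * a' * d - j * d * d' with hw
  have hw0 : w ≠ 0 := by
    intro h
    apply hne
    rw [hw] at h
    have h1 : (d : ℤ) ∣ (k * a : ℕ) * d' := ⟨k * a' + j * d', by push_cast; linarith⟩
    have h2 : (d' : ℤ) ∣ (k * a' : ℕ) * d := ⟨k * a - j * d, by push_cast; linarith⟩
    have h1' : d ∣ k * a * d' := by exact_mod_cast h1
    have h2' : d' ∣ k * a' * d := by exact_mod_cast h2
    have h3 : d ∣ d' := (Nat.Coprime.mul_left hk ha.2).symm.dvd_of_dvd_mul_left h1'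
    have h4 : d' ∣ d := (Nat.Coprime.mul_left hk' ha'.2).symm.dvd_of_dvd_mul_left h2'
    have h5 : d = d' := Nat.dvd_antisymm h3 h4
    refine ⟨h5, ?_⟩
    subst h5
    have hdz : (d : ℤ) ≠ 0 := by exact_mod_cast hd0.ne'
    have h6 : (k : ℤ) * a - k * a' = j * d := by
      apply mul_right_cancel₀ hdz; linarith
    have h7 : (d : ℤ) ∣ k * (a - a') := ⟨j, by linarith⟩
    have h8 : (d : ℤ) ∣ (a - a' : ℤ) := by
      apply IsCoprime.dvd_of_dvd_mul_left _ h7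
      exact (Nat.isCoprime_iff_coprime.2 hk).symm
    have h9 : a' ≡ a [MOD d] := (Nat.modEq_iff_dvd).2 h8
    have := Nat.ModEq.eq_of_lt_of_lt h9 ha'.1 ha.1
    exact this.symm
  have e : (k * a / d : ℝ) - (k * a' / d' : ℝ) - j = w / (d * d') := by
    rw [hw]; push_cast; field_simp
  rw [e, abs_div, abs_of_pos (by positivity : (0 : ℝ) < d * d')]
  have h1 : (1 : ℝ) ≤ |(w : ℝ)| := by
    rw [← Int.cast_abs]; exact_mod_cast Int.one_le_abs hw0
  have h2 : (d * d' : ℝ) ≤ (Q : ℝ) ^ 2 := by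
    rw [sq]; gcongr
  rw [inv_eq_one_div]
  gcongr

theorem farey_ls (k Q : ℕ) (hQ : 1 ≤ Q) (D : Finset ℕ)
    (hD : ∀ d ∈ D, 1 ≤ d ∧ d ≤ Q ∧ Nat.Coprime k d) (N : ℕ) (c : ℕ → ℂ) :
    ∑ d ∈ D, ∑ a ∈ red d, ‖∑ n ∈ range N, c n * ee (n * (k * a / d : ℝ))‖ ^ 2 ≤
      (N + (Q : ℝ) ^ 2 * (1 + 2 * Real.log Q)) * ∑ n ∈ range N, ‖c n‖ ^ 2 := by
  have hQ' : (1 : ℝ) ≤ Q := by exact_mod_cast hQ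
  have := large_sieve (D.sigma fun d => red d) (fun r => (k * r.2 / r.1 : ℝ)) ((Q : ℝ) ^ 2)⁻¹
    (by positivity) (inv_le_one_of_one_le₀ (one_le_pow₀ hQ')) (by
      rintro ⟨d, a⟩ hr ⟨d', a'⟩ hs hne j
      simp only [mem_sigma] at hr hs
      obtain ⟨h1, h2, h3⟩ := hD d hr.1
      obtain ⟨h1', h2', h3'⟩ := hD d' hs.1
      refine farey_spacing k Q d d' a a' h1 h1' h2 h2' h3 h3' hr.2 hs.2 ?_ j
      rintro ⟨rfl, rfl⟩
      exact hne rfl) N c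
  rw [sum_sigma] at this
  rw [inv_inv, Real.log_pow] at this
  exact_mod_cast this

/-- Ramanujan sums at coprime argument -/
lemma ramanujan (d : ℕ) (hd : 0 < d) (n : ℤ) (hn : IsCoprime n (d : ℤ)) :
    ∑ a ∈ red d, ee (a * (n / d : ℝ)) = (ArithmeticFunction.moebius d : ℂ) := by
  classical
  have h1 : ∑ a ∈ red d, ee (a * (n / d : ℝ)) =
      ∑ a ∈ range d, ∑ e ∈ d.divisors, if e ∣ a then
        (ArithmeticFunction.moebius e : ℂ) * ee (a * (n / d : ℝ)) else 0 := by
    rw [red, sum_filter]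
    refine sum_congr rfl fun a _ => ?_
    rw [← sum_filter, ← sum_mul]
    have e1 : d.divisors.filter (fun e => e ∣ a) = (Nat.gcd a d).divisors := by
      ext e
      simp only [mem_filter, Nat.mem_divisors, Nat.dvd_gcd_iff]
      have : Nat.gcd a d ≠ 0 := Nat.gcd_ne_zero_right hd.ne'
      have := hd.ne'
      constructor
      · rintro ⟨⟨h1, -⟩, h2⟩; exact ⟨⟨h2, h1⟩, by assumption⟩
      · rintro ⟨⟨h1, h2⟩, -⟩; exact ⟨⟨h2, hd.ne'⟩, h1⟩
    rw [e1]
    have e2 : (∑ i ∈ (Nat.gcd a d).divisors, (ArithmeticFunction.moebius i : ℂ)) =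
        if Nat.gcd a d = 1 then 1 else 0 := by
      have := ArithmeticFunction.moebius_mul_coe_zeta
      have h3 := congrArg (fun f => f (Nat.gcd a d)) this
      rw [ArithmeticFunction.one_apply] at h3
      have h2 : ((∑ i ∈ (Nat.gcd a d).divisors, ArithmeticFunction.moebius i : ℤ) : ℂ) =
        ((if Nat.gcd a d = 1 then 1 else 0 : ℤ) : ℂ) := by rw [← h3]; congr 1; exact ArithmeticFunction.coe_mul_zeta_apply.symm
      push_cast at h2
      exact h2
    rw [e2]
    simp only [Nat.Coprime]
    split_ifs <;> simp
  rw [h1, sum_comm]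
  have h2 : ∀ e ∈ d.divisors, (∑ a ∈ range d, if e ∣ a then
      (ArithmeticFunction.moebius e : ℂ) * ee (a * (n / d : ℝ)) else 0) =
      if e = d then (ArithmeticFunction.moebius d : ℂ) else 0 := by
    intro e he
    obtain ⟨⟨f, rfl⟩, -⟩ := Nat.mem_divisors.1 he
    have he0 : 0 < e := Nat.pos_of_mul_pos_right hd
    have hf0 : 0 < f := Nat.pos_of_mul_pos_left hd
    have hset : (range (e * f)).filter (fun a => e ∣ a) = (range f).image (fun b => e * b) := by
      ext a
      simp only [mem_filter, mem_range, mem_image]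
      constructor
      · rintro ⟨h, b, rfl⟩
        exact ⟨b, Nat.lt_of_mul_lt_mul_left h, rfl⟩
      · rintro ⟨b, h, rfl⟩
        exact ⟨Nat.mul_lt_mul_of_pos_left h he0, dvd_mul_right _ _⟩
    rw [← sum_filter, hset, sum_image (by
      intro a _ b _ h; exact Nat.eq_of_mul_eq_mul_left he0 h), ← mul_sum]
    have he0' : (e : ℝ) ≠ 0 := by positivity
    have hf0' : (f : ℝ) ≠ 0 := by positivity
    have : ∀ b ∈ range f, ee (((e * b : ℕ) : ℝ) * (n / ((e * f : ℕ) : ℝ))) = ee (b * (n / f : ℝ)) := by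
      intro b _; congr 1; push_cast; field_simp
    rw [sum_congr rfl this, orth f hf0 n]
    by_cases hf : f = 1
    · subst hf; simp
    · rw [if_neg, if_neg, mul_zero]
      · intro h
        have : e * f = e * 1 := by omega
        exact hf (Nat.eq_of_mul_eq_mul_left he0 this)
      · intro h
        have h3 : IsCoprime n (f : ℤ) := by
          push_cast at hn; exact hn.of_mul_right_right
        have h4 : IsUnit (f : ℤ) := h3.isUnit_of_dvd' h (dvd_refl _)
        rw [Int.ofNat_isUnit] at h4
        exact hf (Nat.isUnit_iff.1 h4)
  rw [sum_congr rfl h2, sum_ite_eq' d.divisors d, if_pos (Nat.mem_divisors_self d hd.ne')]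

end LO

namespace LO
open Finset

noncomputable def LL (k Q : ℕ) : ℝ :=
  ∑ d ∈ (Icc 1 Q).filter (fun d => Squarefree d ∧ Nat.Coprime k d), 1 / (Nat.totient d : ℝ)

lemma card_red (d : ℕ) : (red d).card = Nat.totient d := by
  rw [red, Nat.totient]
  congr 1
  ext a
  simp [Nat.coprime_comm]

lemma sieve_bound (k c Q N : ℕ) (hQ : 1 ≤ Q) (S : Finset ℕ) (hSN : S ⊆ range N)
    (hS : ∀ n ∈ S, (k * n + c).Prime ∧ Q < k * n + c) :
    (S.card : ℝ) * LL k Q ≤ N + (Q : ℝ) ^ 2 * (1 + 2 * Real.log Q) := by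
  classical
  set cc : ℕ → ℂ := fun n => if n ∈ S then 1 else 0 with hcc
  set D := (Icc 1 Q).filter (fun d => Squarefree d ∧ Nat.Coprime k d) with hD
  have hDm : ∀ d ∈ D, 1 ≤ d ∧ d ≤ Q ∧ Nat.Coprime k d := by
    intro d hd
    simp only [hD, mem_filter, mem_Icc] at hd
    exact ⟨hd.1.1, hd.1.2, hd.2.2⟩
  have hls := farey_ls k Q hQ D hDm N cc
  have hn : ∑ n ∈ range N, ‖cc n‖ ^ 2 = S.card := by
    have : ∀ n ∈ range N, ‖cc n‖ ^ 2 = if n ∈ S then (1 : ℝ) else 0 := by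
      intro n _; simp only [hcc]; split_ifs <;> simp
    rw [sum_congr rfl this, ← sum_filter]
    have : (range N).filter (fun n => n ∈ S) = S := by
      ext n; simp only [mem_filter]; exact ⟨fun h => h.2, fun h => ⟨hSN h, h⟩⟩
    rw [this]; simp
  rw [hn] at hls
  have hd : ∀ d ∈ D, (S.card : ℝ) ^ 2 * (1 / (Nat.totient d : ℝ)) ≤
      ∑ a ∈ red d, ‖∑ n ∈ range N, cc n * ee (n * (k * a / d : ℝ))‖ ^ 2 := by
    intro d hd
    obtain ⟨h1, h2, h3⟩ := hDm d hd
    have hsq : Squarefree d := by simp only [hD, mem_filter] at hd; exact hd.2.1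
    have hφ : (0 : ℝ) < Nat.totient d := by exact_mod_cast Nat.totient_pos.2 h1
    set T : ℕ → ℂ := fun a => ∑ n ∈ range N, cc n * ee (n * (k * a / d : ℝ)) with hT
    have hsum : (∑ a ∈ red d, ee (a * c / d : ℝ) * T a) =
        S.card * (ArithmeticFunction.moebius d : ℂ) := by
      have : ∀ a ∈ red d, ee (a * c / d : ℝ) * T a =
          ∑ n ∈ S, ee (a * (((k * n + c : ℕ) : ℤ) / d : ℝ)) := by
        intro a _
        simp only [hT, hcc]
        have e1 : ∀ n ∈ range N, (if n ∈ S then (1 : ℂ) else 0) * ee (n * (k * a / d : ℝ)) =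
            if n ∈ S then ee (n * (k * a / d : ℝ)) else 0 := by
          intro n _; split_ifs <;> simp
        rw [sum_congr rfl e1, ← sum_filter]
        have : (range N).filter (fun n => n ∈ S) = S := by
          ext n; simp only [mem_filter]; exact ⟨fun h => h.2, fun h => ⟨hSN h, h⟩⟩
        rw [this, mul_sum]
        refine sum_congr rfl fun n _ => ?_
        rw [← ee_add]; congr 1; push_cast; ring
      rw [sum_congr rfl this, sum_comm]
      have : ∀ n ∈ S, ∑ a ∈ red d, ee (a * (((k * n + c : ℕ) : ℤ) / d : ℝ)) =
          (ArithmeticFunction.moebius d : ℂ) := by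
        intro n hn
        refine ramanujan d h1 _ ?_
        rw [Nat.isCoprime_iff_coprime]
        obtain ⟨hp, hQp⟩ := hS n hn
        rw [Nat.Prime.coprime_iff_not_dvd hp]
        intro hdvd
        have := Nat.le_of_dvd h1 hdvd
        omega
      rw [sum_congr rfl this]; simp
    have hmu : ‖(ArithmeticFunction.moebius d : ℂ)‖ = 1 := by
      rw [ArithmeticFunction.moebius_apply_of_squarefree hsq]
      simp
    have hnorm : (S.card : ℝ) ≤ ∑ a ∈ red d, ‖T a‖ := by
      calc (S.card : ℝ) = ‖(S.card * (ArithmeticFunction.moebius d : ℂ))‖ := by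
            rw [norm_mul, hmu]; simp
        _ ≤ _ := by
            rw [← hsum]
            refine (norm_sum_le _ _).trans (sum_le_sum fun a _ => ?_)
            rw [norm_mul, norm_ee, one_mul]
    have hcs := sq_sum_le_card_mul_sum_sq (s := red d) (f := fun a => ‖T a‖)
    rw [card_red] at hcs
    rw [mul_one_div, div_le_iff₀ hφ]
    calc (S.card : ℝ) ^ 2 ≤ _ := pow_le_pow_left₀ (by positivity) hnorm 2
      _ ≤ _ := hcs
      _ = _ := by rw [mul_comm]
  have hfin : (S.card : ℝ) ^ 2 * LL k Q ≤ (N + (Q : ℝ) ^ 2 * (1 + 2 * Real.log Q)) * S.card := by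
    rw [LL, mul_sum]
    exact (sum_le_sum hd).trans hls
  rcases Nat.eq_zero_or_pos S.card with h0 | h0
  · rw [h0]
    have : 0 ≤ Real.log Q := Real.log_nonneg (by exact_mod_cast hQ)
    simp; positivity
  · have h0' : (0 : ℝ) < S.card := by exact_mod_cast h0
    have : ((S.card : ℝ) * LL k Q) * S.card ≤ (N + (Q : ℝ) ^ 2 * (1 + 2 * Real.log Q)) * S.card := by
      nlinarith
    exact le_of_mul_le_mul_right this h0'

lemma factored_sum_le (K : ℕ) (hK : 0 < K) (T : Finset ℕ)
    (hT : ∀ m ∈ T, m ∈ Nat.factoredNumbers K.primeFactors) :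
    ∑ m ∈ T, 1 / (m : ℝ) ≤ K / Nat.totient K := by
  have hf := EulerProduct.summable_and_hasSum_factoredNumbers_prod_filter_prime_geometric
    (F := ℝ) (f := (⟨⟨fun n : ℕ => (n : ℝ)⁻¹, by simp⟩, by intro a b; push_cast; rw [mul_inv]⟩ : ℕ →* ℝ)) (by
      intro p hp
      change ‖((p : ℝ))⁻¹‖ < 1
      rw [norm_inv, Real.norm_natCast]
      apply inv_lt_one_of_one_lt₀
      exact_mod_cast hp.one_lt) K.primeFactors
  obtain ⟨hs, hsum⟩ := hf
  have hprod : ∏ p ∈ K.primeFactors with p.Prime, (1 - (p : ℝ)⁻¹)⁻¹ = K / Nat.totient K := by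
    have h1 := Nat.totient_eq_mul_prod_factors K
    have h2 : (Nat.totient K : ℝ) = K * ∏ p ∈ K.primeFactors, (1 - (p : ℝ)⁻¹) := by
      have h3 := congrArg (fun x : ℚ => (x : ℝ)) h1
      push_cast at h3
      exact h3
    rw [filter_true_of_mem (fun p hp => Nat.prime_of_mem_primeFactors hp), prod_inv_distrib, h2]
    have : (K : ℝ) ≠ 0 := by positivity
    field_simp
  have h3 : HasSum (fun m : Nat.factoredNumbers K.primeFactors => ((m : ℕ) : ℝ)⁻¹)
    (K / Nat.totient K : ℝ) := by
    rw [← hprod]; exact hsum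
  classical
  have h4 := sum_le_hasSum (T.subtype (fun m => m ∈ Nat.factoredNumbers K.primeFactors))
    (fun _ _ => by positivity) h3
  rw [sum_subtype_of_mem (fun m : ℕ => (m : ℝ)⁻¹) hT] at h4
  simpa [one_div] using h4

lemma LL_lower (k Q : ℕ) (hk : 0 < k) (hQ : 1 ≤ Q) :
    (Nat.totient k : ℝ) / k * Real.log Q ≤ LL k Q := by
  classical
  set D := (Icc 1 Q).filter (fun d => Squarefree d ∧ Nat.Coprime k d) with hD
  have hφk : (0 : ℝ) < Nat.totient k := by exact_mod_cast Nat.totient_pos.2 hk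
  have hk' : (0 : ℝ) < k := by exact_mod_cast hk
  set rad : ℕ → ℕ := fun n => ∏ p ∈ n.primeFactors.filter (fun p => ¬ p ∣ k), p with hrad
  have hradpf : ∀ n, (rad n).primeFactors = n.primeFactors.filter (fun p => ¬ p ∣ k) := by
    intro n
    exact Nat.primeFactors_prod (fun p hp => Nat.prime_of_mem_primeFactors (mem_filter.1 hp).1)
  have hraddvd : ∀ n, rad n ∣ n := by
    intro n
    exact (prod_dvd_prod_of_subset _ _ _ (filter_subset _ _)).trans (Nat.prod_primeFactors_dvd n)
  have hradD : ∀ n ∈ Icc 1 Q, rad n ∈ D := by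
    intro n hn
    rw [mem_Icc] at hn
    have hpos : 0 < rad n := Nat.pos_of_dvd_of_pos (hraddvd n) hn.1
    simp only [hD, mem_filter, mem_Icc]
    refine ⟨⟨hpos, (Nat.le_of_dvd hn.1 (hraddvd n)).trans hn.2⟩, ?_, ?_⟩
    · refine Squarefree.squarefree_of_dvd
        (prod_dvd_prod_of_subset _ _ _ (filter_subset _ _)) (?_ : Squarefree (∏ p ∈ n.primeFactors, p))
      refine Finset.squarefree_prod_of_pairwise_isCoprime (fun _ hp _ hq hpq => ?_)
        fun _ hp => (Nat.prime_of_mem_primeFactors hp).squarefree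
      simp only [Function.onFun, ← Nat.coprime_iff_isRelPrime]
      exact (Nat.coprime_primes (Nat.prime_of_mem_primeFactors hp)
        (Nat.prime_of_mem_primeFactors hq)).mpr hpq
    · rw [Nat.coprime_comm]
      refine Nat.Coprime.prod_left fun p hp => ?_
      simp only [mem_filter] at hp
      exact (Nat.Prime.coprime_iff_not_dvd (Nat.prime_of_mem_primeFactors hp.1)).2 hp.2
  have h1 : ∑ n ∈ Icc 1 Q, 1 / (n : ℝ) ≤ ∑ d ∈ D, (k / Nat.totient k) * (1 / (Nat.totient d : ℝ)) := by
    rw [← sum_fiberwise_of_maps_to hradD]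
    refine sum_le_sum fun d hd => ?_
    have hd' := hd
    simp only [hD, mem_filter, mem_Icc] at hd'
    obtain ⟨⟨hd1, hd2⟩, hdsq, hdc⟩ := hd'
    have hd0 : (0 : ℝ) < d := by exact_mod_cast hd1
    have hφd : (0 : ℝ) < Nat.totient d := by exact_mod_cast Nat.totient_pos.2 hd1
    set F := (Icc 1 Q).filter (fun n => rad n = d) with hF
    have hFm : ∀ n ∈ F, d ∣ n ∧ 0 < n := by
      intro n hn
      simp only [hF, mem_filter, mem_Icc] at hn
      exact ⟨hn.2 ▸ hraddvd n, hn.1.1⟩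
    have e1 : ∑ n ∈ F, 1 / (n : ℝ) = (1 / d : ℝ) * ∑ m ∈ F.image (fun n => n / d), 1 / (m : ℝ) := by
      rw [sum_image, mul_sum]
      · refine sum_congr rfl fun n hn => ?_
        obtain ⟨m, rfl⟩ := (hFm n hn).1
        rw [Nat.mul_div_cancel_left _ hd1]
        push_cast
        rw [one_div_mul_one_div]
      · intro a ha b hb hab
        obtain ⟨a', rfl⟩ := (hFm a ha).1
        obtain ⟨b', rfl⟩ := (hFm b hb).1
        simp only [Nat.mul_div_cancel_left _ hd1] at hab
        rw [hab]
    rw [e1]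
    have e2 := factored_sum_le (k * d) (by positivity) (F.image (fun n => n / d)) (by
      intro m hm
      obtain ⟨n, hn, rfl⟩ := mem_image.1 hm
      have hn' := hFm n hn
      obtain ⟨⟨m, rfl⟩, hpos⟩ := hn'
      rw [Nat.mul_div_cancel_left _ hd1]
      have hm0 : m ≠ 0 := by rintro rfl; simp at hpos
      rw [Nat.mem_factoredNumbers_iff_primeFactors_subset]
      refine ⟨hm0, fun p hp => ?_⟩
      have hpp := Nat.prime_of_mem_primeFactors hp
      have hpd := Nat.dvd_of_mem_primeFactors hp
      rw [Nat.mem_primeFactors]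
      refine ⟨hpp, ?_, by positivity⟩
      by_cases hpk : p ∣ k
      · exact hpk.mul_right d
      · have hrn : rad (d * m) = d := (mem_filter.1 hn).2
        have : p ∈ (rad (d * m)).primeFactors := by
          rw [hradpf, mem_filter, Nat.mem_primeFactors]
          exact ⟨⟨hpp, hpd.mul_left d, hpos.ne'⟩, hpk⟩
        rw [hrn] at this
        exact (Nat.dvd_of_mem_primeFactors this).mul_left k)
    rw [Nat.totient_mul hdc] at e2
    calc _ ≤ (1 / d : ℝ) * (((k * d : ℕ) : ℝ) / ((Nat.totient k * Nat.totient d : ℕ) : ℝ)) := by gcongr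
      _ = _ := by push_cast; field_simp
  rw [← mul_sum] at h1
  have h2 : Real.log Q ≤ ∑ n ∈ Icc 1 Q, 1 / (n : ℝ) := by
    have := log_add_one_le_harmonic Q
    rw [harmonic_eq_sum_Icc] at this
    push_cast at this
    simp only [one_div]
    refine le_trans ?_ this
    apply Real.log_le_log (by exact_mod_cast hQ)
    linarith
  have h3 : Real.log Q ≤ k / Nat.totient k * LL k Q := h2.trans h1
  calc (Nat.totient k : ℝ) / k * Real.log Q ≤ (Nat.totient k : ℝ) / k * (k / Nat.totient k * LL k Q) := by
        gcongr
    _ = _ := by field_simp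

theorem brun_titchmarsh (k c X Q : ℕ) (hk : 0 < k) (hQ : 2 ≤ Q) :
    (((Icc 1 X).filter (fun p => p.Prime ∧ p ≡ c [MOD k])).card : ℝ) ≤
      Q + (X / k + 1 + (Q : ℝ) ^ 2 * (1 + 2 * Real.log Q)) * (k / (Nat.totient k * Real.log Q)) := by
  classical
  have hφk : (0 : ℝ) < Nat.totient k := by exact_mod_cast Nat.totient_pos.2 hk
  have hk' : (0 : ℝ) < k := by exact_mod_cast hk
  have hlog : 0 < Real.log Q := Real.log_pos (by exact_mod_cast hQ)
  set P := (Icc 1 X).filter (fun p => p.Prime ∧ p ≡ c [MOD k]) with hP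
  set P1 := P.filter (fun p => Q < p) with hP1
  set S := P1.image (fun p => p / k) with hS
  have hmem : ∀ p ∈ P1, p = k * (p / k) + c % k := by
    intro p hp
    simp only [hP1, hP, mem_filter] at hp
    have : p % k = c % k := hp.1.2.2
    rw [← this]; exact (Nat.div_add_mod p k).symm
  have hScard : S.card = P1.card := by
    apply card_image_of_injOn
    intro a ha b hb hab
    have := hmem a ha
    have h2 := hmem b hb
    simp only at hab
    rw [this, h2, hab]
  have hb := sieve_bound k (c % k) Q (X / k + 1) (by omega) S (by
    intro n hn
    obtain ⟨p, hp, rfl⟩ := mem_image.1 hn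
    simp only [hP1, hP, mem_filter, mem_Icc] at hp
    rw [mem_range]
    have := Nat.div_le_div_right (c := k) hp.1.1.2
    omega) (by
    intro n hn
    obtain ⟨p, hp, rfl⟩ := mem_image.1 hn
    rw [← hmem p hp]
    simp only [hP1, hP, mem_filter, mem_Icc] at hp
    exact ⟨hp.1.2.1, hp.2⟩)
  have hL := LL_lower k Q hk (by omega)
  have h1 : (P.card : ℝ) ≤ Q + P1.card := by
    have : P.card ≤ (Icc 1 Q).card + P1.card := by
      refine (card_le_card ?_).trans (card_union_le _ _)
      intro p hp
      rw [mem_union]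
      by_cases h : Q < p
      · right; exact mem_filter.2 ⟨hp, h⟩
      · left
        rw [mem_Icc]
        exact ⟨(mem_Icc.1 (mem_filter.1 hp).1).1, by omega⟩
    rw [Nat.card_Icc] at this
    exact_mod_cast (by simpa using this)
  rw [hScard] at hb
  have hXk : ((X / k + 1 : ℕ) : ℝ) ≤ X / k + 1 := by
    push_cast; linarith [Nat.cast_div_le (α := ℝ) (m := X) (n := k)]
  have h2 : (P1.card : ℝ) * ((Nat.totient k : ℝ) / k * Real.log Q) ≤
      X / k + 1 + (Q : ℝ) ^ 2 * (1 + 2 * Real.log Q) := by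
    calc _ ≤ (P1.card : ℝ) * LL k Q := by gcongr
      _ ≤ _ := hb
      _ ≤ _ := by linarith
  have h3 : (P1.card : ℝ) ≤ (X / k + 1 + (Q : ℝ) ^ 2 * (1 + 2 * Real.log Q)) *
      (k / (Nat.totient k * Real.log Q)) := by
    have e : (P1.card : ℝ) = (P1.card : ℝ) * ((Nat.totient k : ℝ) / k * Real.log Q) *
      (k / (Nat.totient k * Real.log Q)) := by field_simp
    rw [e]
    gcongr
  linarith

end LO

namespace LO
open Finset

/-- the centred indicator of a residue class -/
noncomputable def hh (q : ℕ) (a : ℤ) (n : ℕ) : ℝ :=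
  (if (q : ℤ) ∣ (n : ℤ) - a then 1 else 0) - (if q ∣ n then 0 else 1 / ((q : ℝ) - 1))

noncomputable def VV (q : ℕ) (f : ℕ → ℂ) (N : ℕ) : ℝ :=
  ∑ r ∈ red q, ‖∑ n ∈ range N, f n * ee (n * (r / q : ℝ))‖ ^ 2

lemma variance {ι : Type*} (U : Finset ι) (f : ι → ℂ) (μ c : ℂ) (h : ∑ x ∈ U, (f x - μ) = 0) :
    ∑ x ∈ U, ‖f x - c‖ ^ 2 = ∑ x ∈ U, ‖f x - μ‖ ^ 2 + U.card * ‖μ - c‖ ^ 2 := by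
  have : ∀ x ∈ U, ‖f x - c‖ ^ 2 = ‖f x - μ‖ ^ 2 + 2 * inner ℝ (f x - μ) (μ - c) + ‖μ - c‖ ^ 2 := by
    intro x _
    rw [← norm_add_sq_real]; congr 2; ring
  rw [sum_congr rfl this, sum_add_distrib, sum_add_distrib, ← mul_sum, ← sum_inner, h]
  simp

lemma red_prime (q : ℕ) (hq : q.Prime) : range q = insert 0 (red q) := by
  ext a
  simp only [red, mem_range, mem_insert, mem_filter]
  constructor
  · intro h
    by_cases h0 : a = 0
    · left; exact h0
    · right
      refine ⟨h, ?_⟩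
      rw [Nat.coprime_comm, hq.coprime_iff_not_dvd]
      exact fun hd => by have := Nat.le_of_dvd (Nat.pos_of_ne_zero h0) hd; omega
  · rintro (rfl | h)
    · exact hq.pos
    · exact h.1

lemma zero_notMem_red (q : ℕ) (hq : q.Prime) : 0 ∉ red q := by
  simp only [red, mem_filter, not_and]
  intro _ h
  rw [Nat.coprime_zero_left] at h
  exact hq.one_lt.ne' h

section
variable (q : ℕ) [Fact q.Prime]

noncomputable def AA (f : ℕ → ℂ) (N : ℕ) (x : ZMod q) : ℂ :=
  ∑ n ∈ (range N).filter (fun n : ℕ => (n : ZMod q) = x), f n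

lemma sum_AA (f : ℕ → ℂ) (N : ℕ) (w : ZMod q → ℂ) :
    ∑ n ∈ range N, f n * w n = ∑ x : ZMod q, AA q f N x * w x := by
  classical
  rw [← sum_fiberwise (range N) (fun n : ℕ => (n : ZMod q))]
  refine sum_congr rfl fun x _ => ?_
  rw [AA, sum_mul]
  refine sum_congr rfl fun n hn => ?_
  rw [(mem_filter.1 hn).2]

lemma plancherel (f : ℕ → ℂ) (N : ℕ) : ∃ μ : ℂ,
    ∑ x : ZMod q, ‖AA q f N x - μ‖ ^ 2 = (1 / (q : ℝ)) * VV q f N := by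
  classical
  have hq : q.Prime := Fact.out
  have hq0 : (0 : ℝ) < q := by exact_mod_cast hq.pos
  set S : ℕ → ℂ := fun r => ∑ n ∈ range N, f n * ee (n * (r / q : ℝ)) with hS
  have hS1 : ∀ r, S r = ∑ x : ZMod q, AA q f N x * ee (x.val * (r / q : ℝ)) := by
    intro r
    rw [← sum_AA q f N (fun x => ee (x.val * (r / q : ℝ)))]
    simp only [hS]
    refine sum_congr rfl fun n _ => ?_
    congr 1
    rw [ZMod.val_natCast]
    have : (n : ℝ) = q * (n / q : ℕ) + (n % q : ℕ) := by exact_mod_cast (Nat.div_add_mod n q).symm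
    have e : (n : ℝ) * (r / q) = ((((n / q * r : ℕ) : ℤ)) : ℝ) + (n % q : ℕ) * (r / q : ℝ) := by
      have e2 : (((n / q * r : ℕ) : ℤ) : ℝ) = ((n / q : ℕ) : ℝ) * r := by
        rw [Int.cast_natCast, Nat.cast_mul]
      rw [e2, this]
      generalize ((n / q : ℕ) : ℝ) = t
      generalize ((n % q : ℕ) : ℝ) = s
      field_simp
    rw [e, ee_add, ee_int, one_mul]
  have hpar : ∑ r ∈ range q, ‖S r‖ ^ 2 = q * ∑ x : ZMod q, ‖AA q f N x‖ ^ 2 := by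
    have : ((∑ r ∈ range q, ‖S r‖ ^ 2 : ℝ) : ℂ) = ((q * ∑ x : ZMod q, ‖AA q f N x‖ ^ 2 : ℝ) : ℂ) := by
      push_cast
      have h1 : ∀ r ∈ range q, (‖S r‖ : ℂ) ^ 2 = ∑ x : ZMod q, ∑ y : ZMod q,
          AA q f N x * (starRingEnd ℂ) (AA q f N y) * ee (r * (((x.val : ℤ) - y.val : ℤ) / q : ℝ)) := by
        intro r _
        rw [← Complex.mul_conj', hS1, map_sum, sum_mul_sum]
        refine sum_congr rfl fun x _ => sum_congr rfl fun y _ => ?_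
        rw [map_mul, ← ee_neg]
        have : ee (r * (((x.val : ℤ) - y.val : ℤ) / q : ℝ)) = ee (x.val * (r / q : ℝ)) *
          ee (-(y.val * (r / q : ℝ))) := by rw [← ee_add]; congr 1; push_cast; ring
        rw [this]; ring
      rw [sum_congr rfl h1, sum_comm, mul_sum]
      refine sum_congr rfl fun x _ => ?_
      rw [sum_comm]
      simp_rw [← mul_sum]
      have h2 : ∀ y : ZMod q, (∑ r ∈ range q, ee (r * (((x.val : ℤ) - y.val : ℤ) / q : ℝ))) =
          if y = x then (q : ℂ) else 0 := by
        intro y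
        rw [orth q hq.pos]
        congr 1
        rw [eq_iff_iff, ← ZMod.intCast_zmod_eq_zero_iff_dvd]
        push_cast
        rw [ZMod.natCast_zmod_val, ZMod.natCast_zmod_val, sub_eq_zero, eq_comm]
      simp_rw [h2]
      simp only [mul_ite, mul_zero, sum_ite_eq', mem_univ, if_true]
      rw [Complex.mul_conj']; ring
    exact_mod_cast this
  set tot : ℂ := ∑ x : ZMod q, AA q f N x with htot
  have hS0 : S 0 = tot := by rw [hS1]; simp [ee_zero, htot]
  refine ⟨tot / q, ?_⟩
  have hqc : (q : ℂ) ≠ 0 := by exact_mod_cast hq.ne_zero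
  have hv := variance (univ : Finset (ZMod q)) (AA q f N) (tot / q) 0 (by
    rw [sum_sub_distrib, ← htot]
    simp [ZMod.card]
    field_simp; ring)
  simp only [sub_zero, card_univ, ZMod.card] at hv
  rw [red_prime q hq, sum_insert (zero_notMem_red q hq), hS0] at hpar
  have hVV : VV q f N = ∑ r ∈ red q, ‖S r‖ ^ 2 := rfl
  rw [hVV]
  rw [norm_div, Complex.norm_natCast, div_pow] at hv
  have h5 : ∑ r ∈ red q, ‖S r‖ ^ 2 = q * ∑ x : ZMod q, ‖AA q f N x‖ ^ 2 - ‖tot‖ ^ 2 := by linarith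
  rw [h5, hv]
  generalize ∑ x : ZMod q, ‖AA q f N x - tot / q‖ ^ 2 = Y
  field_simp
  ring

lemma bilinear (a : ℤ) (ha : ¬ (q : ℤ) ∣ a) (α β : ℕ → ℂ) (M N : ℕ) :
    ‖∑ m ∈ range M, ∑ n ∈ range N, α m * β n * (hh q a (m * n) : ℂ)‖ ≤
      (1 / (q : ℝ)) * (Real.sqrt (VV q α M) * Real.sqrt (VV q β N)) := by
  classical
  have hq : q.Prime := Fact.out
  have hq0 : (0 : ℝ) < q := by exact_mod_cast hq.pos
  have hq1 : (1 : ℝ) < q := by exact_mod_cast hq.one_lt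
  have ha0 : (a : ZMod q) ≠ 0 := by
    rwa [Ne, ZMod.intCast_zmod_eq_zero_iff_dvd]
  set A := AA q α M with hA
  set B := AA q β N with hB
  set H : ZMod q → ℂ := fun z => (if z = a then 1 else 0) - (if z = 0 then 0 else 1 / ((q : ℂ) - 1))
    with hH
  have hHh : ∀ n : ℕ, (hh q a n : ℂ) = H n := by
    intro n
    simp only [hh, hH]
    have e1 : ((n : ZMod q) = a) ↔ (q : ℤ) ∣ (n : ℤ) - a := by
      rw [← ZMod.intCast_zmod_eq_zero_iff_dvd]; push_cast; rw [sub_eq_zero]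
    have e2 : ((n : ZMod q) = 0) ↔ q ∣ n := ZMod.natCast_eq_zero_iff n q
    simp only [e1, e2]
    split_ifs <;> push_cast <;> rfl
  have h1 : ∑ m ∈ range M, ∑ n ∈ range N, α m * β n * (hh q a (m * n) : ℂ) =
      ∑ x : ZMod q, A x * ∑ y : ZMod q, B y * H (x * y) := by
    rw [← sum_AA q α M (fun x => ∑ y : ZMod q, B y * H (x * y))]
    refine sum_congr rfl fun m _ => ?_
    rw [← sum_AA q β N (fun y => H (m * y)), mul_sum]
    refine sum_congr rfl fun n _ => ?_
    rw [hHh, Nat.cast_mul]; ring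
  set U := (univ : Finset (ZMod q)).erase 0 with hU
  have hUcard : (U.card : ℂ) = q - 1 := by
    rw [hU, card_erase_of_mem (mem_univ _), card_univ, ZMod.card, Nat.cast_sub hq.one_lt.le]; simp
  have hq1c : (q : ℂ) - 1 ≠ 0 := by
    rw [sub_ne_zero]; exact_mod_cast hq.one_lt.ne'
  set b : ℂ := (∑ y ∈ U, B y) / (q - 1) with hb
  have hH0 : H 0 = 0 := by simp [hH, ha0.symm]
  have hin : ∀ x ∈ U, ∑ y : ZMod q, B y * H (x * y) = B (a / x) - b := by
    intro x hx
    have hx0 : x ≠ 0 := (mem_erase.1 hx).1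
    rw [← add_sum_erase _ _ (mem_univ (0 : ZMod q)), mul_zero, hH0, mul_zero, zero_add]
    have : ∀ y ∈ U, B y * H (x * y) = (if y = a / x then B y else 0) - B y / (q - 1) := by
      intro y hy
      have hy0 : y ≠ 0 := (mem_erase.1 hy).1
      simp only [hH]
      have e1 : (x * y = a) ↔ y = a / x := by
        rw [eq_div_iff hx0, mul_comm]
      simp only [e1, mul_eq_zero, hx0, hy0, or_self, if_false]
      split_ifs <;> ring
    rw [sum_congr rfl this, sum_sub_distrib, ← sum_div, sum_ite_eq' U]
    rw [if_pos]
    exact mem_erase.2 ⟨div_ne_zero ha0 hx0, mem_univ _⟩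
  obtain ⟨c, hc⟩ := plancherel q α M
  obtain ⟨c', hc'⟩ := plancherel q β N
  have hbij : ∀ F : ZMod q → ℂ, ∑ x ∈ U, F (a / x) = ∑ x ∈ U, F x := by
    intro F
    refine sum_nbij' (fun x => a / x) (fun x => a / x) ?_ ?_ ?_ ?_ ?_
    · intro x hx; exact mem_erase.2 ⟨div_ne_zero ha0 (mem_erase.1 hx).1, mem_univ _⟩
    · intro x hx; exact mem_erase.2 ⟨div_ne_zero ha0 (mem_erase.1 hx).1, mem_univ _⟩
    · intro x hx; have := (mem_erase.1 hx).1; field_simp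
    · intro x hx; have := (mem_erase.1 hx).1; field_simp
    · intro x hx; rfl
  have hbijR : ∀ F : ZMod q → ℝ, ∑ x ∈ U, F (a / x) = ∑ x ∈ U, F x := by
    intro F
    have := hbij (fun x => (F x : ℂ))
    exact_mod_cast this
  have hzero : ∑ x ∈ U, (B x - b) = 0 := by
    rw [sum_sub_distrib, sum_const, nsmul_eq_mul, hUcard, hb]; field_simp; ring
  have hzero2 : ∑ x ∈ U, (B (a / x) - b) = 0 := by
    rw [hbij (fun x => B x - b)]; exact hzero
  have h2 : ∑ x : ZMod q, A x * ∑ y : ZMod q, B y * H (x * y) =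
      ∑ x ∈ U, (A x - c) * (B (a / x) - b) := by
    rw [← add_sum_erase _ _ (mem_univ (0 : ZMod q))]
    simp only [zero_mul, hH0, mul_zero, sum_const_zero, zero_add]
    have : ∑ x ∈ U, (A x - c) * (B (a / x) - b) = ∑ x ∈ U, A x * (B (a / x) - b)
        - c * ∑ x ∈ U, (B (a / x) - b) := by
      rw [mul_sum, ← sum_sub_distrib]; refine sum_congr rfl fun x _ => by ring
    rw [this, hzero2, mul_zero, sub_zero]
    refine sum_congr rfl fun x hx => ?_
    rw [hin x hx]
  rw [h1, h2]
  have h3 : ∑ x ∈ U, ‖A x - c‖ ^ 2 ≤ (1 / (q : ℝ)) * VV q α M := by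
    rw [← hc]
    exact sum_le_sum_of_subset_of_nonneg (erase_subset _ _) fun _ _ _ => by positivity
  have h4 : ∑ x ∈ U, ‖B (a / x) - b‖ ^ 2 ≤ (1 / (q : ℝ)) * VV q β N := by
    rw [hbijR (fun x => ‖B x - b‖ ^ 2), ← hc']
    have := variance U B b c' hzero
    calc _ ≤ ∑ x ∈ U, ‖B x - c'‖ ^ 2 := by
          rw [this]; have : (0 : ℝ) ≤ U.card * ‖b - c'‖ ^ 2 := by positivity
          linarith
      _ ≤ _ := sum_le_sum_of_subset_of_nonneg (erase_subset _ _) fun _ _ _ => by positivity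
  calc _ ≤ ∑ x ∈ U, ‖A x - c‖ * ‖B (a / x) - b‖ := by
        refine (norm_sum_le _ _).trans (sum_le_sum fun x _ => ?_)
        rw [norm_mul]
    _ ≤ Real.sqrt (∑ x ∈ U, ‖A x - c‖ ^ 2) * Real.sqrt (∑ x ∈ U, ‖B (a / x) - b‖ ^ 2) :=
        Real.sum_mul_le_sqrt_mul_sqrt _ _ _
    _ ≤ Real.sqrt ((1 / (q : ℝ)) * VV q α M) * Real.sqrt ((1 / (q : ℝ)) * VV q β N) := by gcongr
    _ = _ := by
        rw [Real.sqrt_mul (by positivity), Real.sqrt_mul (by positivity)]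
        have := Real.mul_self_sqrt (by positivity : (0 : ℝ) ≤ 1 / q)
        linear_combination (√(VV q α M) * √(VV q β N)) * this

end

end LO

namespace LO
open Finset

noncomputable def EE (Q : ℕ) : ℝ := ((2 * Q : ℕ) : ℝ) ^ 2 * (1 + 2 * Real.log ((2 * Q : ℕ) : ℝ))

lemma EE_nonneg (Q : ℕ) : 0 ≤ EE Q := by
  unfold EE
  have := Real.log_natCast_nonneg (2 * Q)
  positivity

lemma sum_VV (P : Finset ℕ) (Q : ℕ) (hQ : 1 ≤ Q)
    (hP : ∀ q ∈ P, q.Prime ∧ Q ≤ q ∧ q ≤ 2 * Q) (f : ℕ → ℂ) (N : ℕ) :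
    ∑ q ∈ P, VV q f N ≤ (N + EE Q) * ∑ n ∈ range N, ‖f n‖ ^ 2 := by
  have := farey_ls 1 (2 * Q) (by omega) P (fun d hd => ⟨(hP d hd).1.pos, (hP d hd).2.2, by simp⟩) N f
  simp only [Nat.cast_one, one_mul] at this
  exact this

lemma bilinear_sum (P : Finset ℕ) (Q : ℕ) (hQ : 1 ≤ Q)
    (hP : ∀ q ∈ P, q.Prime ∧ Q ≤ q ∧ q ≤ 2 * Q) (a : ℤ) (ha : ∀ q ∈ P, ¬ (q : ℤ) ∣ a)
    (α β : ℕ → ℂ) (M N : ℕ) :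
    ∑ q ∈ P, ‖∑ m ∈ range M, ∑ n ∈ range N, α m * β n * (hh q a (m * n) : ℂ)‖ ≤
      (1 / (Q : ℝ)) * (Real.sqrt ((M + EE Q) * ∑ n ∈ range M, ‖α n‖ ^ 2) *
        Real.sqrt ((N + EE Q) * ∑ n ∈ range N, ‖β n‖ ^ 2)) := by
  have hQ0 : (0 : ℝ) < Q := by exact_mod_cast hQ
  have hVn : ∀ q f N, 0 ≤ VV q f N := fun q f N => sum_nonneg fun _ _ => by positivity
  calc _ ≤ ∑ q ∈ P, (1 / (Q : ℝ)) * (Real.sqrt (VV q α M) * Real.sqrt (VV q β N)) := by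
        refine sum_le_sum fun q hq => ?_
        obtain ⟨h1, h2, h3⟩ := hP q hq
        haveI := Fact.mk h1
        refine (bilinear q a (ha q hq) α β M N).trans ?_
        gcongr
    _ = (1 / (Q : ℝ)) * ∑ q ∈ P, (Real.sqrt (VV q α M) * Real.sqrt (VV q β N)) := by rw [mul_sum]
    _ ≤ (1 / (Q : ℝ)) * (Real.sqrt (∑ q ∈ P, VV q α M) * Real.sqrt (∑ q ∈ P, VV q β N)) := by
        gcongr
        refine (Real.sum_mul_le_sqrt_mul_sqrt _ _ _).trans (le_of_eq ?_)
        simp only [Real.sq_sqrt (hVn _ _ _)]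
    _ ≤ _ := by
        gcongr
        · exact sum_VV P Q hQ hP α M
        · exact sum_VV P Q hQ hP β N

/-- weights in the separation of variables -/
noncomputable def ww (N j : ℕ) : ℝ :=
  if j = 0 then 1 else (1 / (j : ℝ) + 1 / ((N : ℝ) - j)) / 2

lemma ww_nonneg (N j : ℕ) (h : j < N) : 0 ≤ ww N j := by
  unfold ww
  split_ifs
  · norm_num
  · have : (j : ℝ) < N := by exact_mod_cast h
    have : 0 < (N : ℝ) - j := by linarith
    positivity

lemma sum_ww (N : ℕ) (hN : 1 ≤ N) : ∑ j ∈ range N, ww N j ≤ 2 + Real.log N := by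
  obtain ⟨L, rfl⟩ : ∃ L, N = L + 1 := ⟨N - 1, by omega⟩
  rw [sum_range_succ']
  have h1 : ∀ j ∈ range L, ww (L + 1) (j + 1) = (1 / ((j + 1 : ℕ) : ℝ) + 1 / ((L : ℝ) - j)) / 2 := by
    intro j _
    rw [ww, if_neg (by omega)]
    push_cast
    congr 3; ring
  rw [sum_congr rfl h1, ← sum_div, sum_add_distrib]
  have h2 : ∑ j ∈ range L, 1 / ((L : ℝ) - j) = ∑ j ∈ range L, 1 / ((j + 1 : ℕ) : ℝ) := by
    rw [← sum_range_reflect]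
    refine sum_congr rfl fun j hj => ?_
    rw [mem_range] at hj
    have : ((L - 1 - j : ℕ) : ℝ) = L - 1 - j := by
      rw [Nat.cast_sub (by omega), Nat.cast_sub (by omega)]; simp
    rw [this]; push_cast; congr 1; ring
  rw [h2]
  have h3 : ∑ j ∈ range L, 1 / ((j + 1 : ℕ) : ℝ) ≤ 1 + Real.log (L + 1 : ℕ) := by
    have := harmonic_le_one_add_log L
    rw [harmonic] at this
    push_cast at this ⊢
    simp only [one_div]
    refine this.trans ?_
    have hlog : Real.log (L : ℝ) ≤ Real.log ((L : ℝ) + 1) := by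
      rcases Nat.eq_zero_or_pos L with h | h
      · subst h; simp
      · exact Real.log_le_log (by exact_mod_cast h) (by linarith)
    linarith
  have h4 : ww (L + 1) 0 = 1 := by simp [ww]
  rw [h4]; linarith

/-- Fourier coefficients of an initial segment -/
noncomputable def cK (N K j : ℕ) : ℂ := (1 / (N : ℂ)) * ∑ k ∈ range (K + 1), ee (k * (j / N : ℝ))

lemma norm_cK (N K j : ℕ) (hK : K < N) (hj : j < N) : ‖cK N K j‖ ≤ ww N j := by
  have hN : (0 : ℝ) < N := by exact_mod_cast (by omega : 0 < N)
  unfold cK ww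
  rw [norm_mul, norm_div, norm_one, Complex.norm_natCast]
  split_ifs with h
  · subst h
    simp only [CharP.cast_eq_zero, zero_div, mul_zero, ee_zero, sum_const, card_range, nsmul_eq_mul,
      mul_one]
    rw [Complex.norm_natCast, one_div, inv_mul_le_iff₀ hN, mul_one]
    exact_mod_cast hK
  · have hj0 : (0 : ℝ) < j := by exact_mod_cast Nat.pos_of_ne_zero h
    have hjN : (j : ℝ) < N := by exact_mod_cast hj
    have hf : Int.fract (j / N : ℝ) = j / N := by
      rw [Int.fract_eq_self]; exact ⟨by positivity, (div_lt_one hN).2 hjN⟩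
    have hg := geom_bound (K + 1) (j / N : ℝ) (by rw [hf]; positivity)
    rw [hf] at hg
    have hs : 0 < (N : ℝ) - j := by linarith
    calc _ ≤ 1 / (N : ℝ) * ((1 / (j / N : ℝ) + 1 / (1 - j / N)) / 2) := by gcongr
      _ = _ := by
        have : (1 - j / N : ℝ) = (N - j) / N := by field_simp
        rw [this]; field_simp

lemma cK_expand (N K n : ℕ) (hK : K < N) (hn : n < N) :
    (if n ≤ K then (1 : ℂ) else 0) = ∑ j ∈ range N, cK N K j * ee (-(n * (j / N : ℝ))) := by
  have hN : (N : ℂ) ≠ 0 := by exact_mod_cast (by omega : N ≠ 0)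
  have h1 : ∀ j ∈ range N, cK N K j * ee (-(n * (j / N : ℝ))) =
      (1 / (N : ℂ)) * ∑ k ∈ range (K + 1), ee (j * (((k : ℤ) - n : ℤ) / N : ℝ)) := by
    intro j _
    rw [cK, mul_assoc, sum_mul]
    congr 1
    refine sum_congr rfl fun k _ => ?_
    rw [← ee_add]; congr 1; push_cast; ring
  rw [sum_congr rfl h1, ← mul_sum, sum_comm]
  have h2 : ∀ k ∈ range (K + 1), ∑ j ∈ range N, ee (j * (((k : ℤ) - n : ℤ) / N : ℝ)) =
      if k = n then (N : ℂ) else 0 := by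
    intro k hk
    rw [mem_range] at hk
    rw [orth N (by omega)]
    congr 1
    rw [eq_iff_iff]
    constructor
    · intro h
      have := (Nat.modEq_iff_dvd.2 h).eq_of_lt_of_lt hn (by omega)
      exact this.symm
    · rintro rfl; simp
  rw [sum_congr rfl h2, sum_ite_eq' (range (K + 1))]
  simp only [mem_range, Nat.lt_succ_iff]
  split_ifs
  · field_simp
  · simp

theorem bilinear_trunc (P : Finset ℕ) (Q : ℕ) (hQ : 1 ≤ Q)
    (hP : ∀ q ∈ P, q.Prime ∧ Q ≤ q ∧ q ≤ 2 * Q) (a : ℤ) (ha : ∀ q ∈ P, ¬ (q : ℤ) ∣ a)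
    (α β : ℕ → ℂ) (M N : ℕ) (hN : 1 ≤ N) (K : ℕ → ℕ) (hK : ∀ m, α m ≠ 0 → K m < N) :
    ∑ q ∈ P, ‖∑ m ∈ range M, ∑ n ∈ range N,
        if n ≤ K m then α m * β n * (hh q a (m * n) : ℂ) else 0‖ ≤
      (2 + Real.log N) * ((1 / (Q : ℝ)) * (Real.sqrt ((M + EE Q) * ∑ n ∈ range M, ‖α n‖ ^ 2) *
        Real.sqrt ((N + EE Q) * ∑ n ∈ range N, ‖β n‖ ^ 2))) := by
  set bound := ((1 / (Q : ℝ)) * (Real.sqrt ((M + EE Q) * ∑ n ∈ range M, ‖α n‖ ^ 2) *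
        Real.sqrt ((N + EE Q) * ∑ n ∈ range N, ‖β n‖ ^ 2))) with hbound
  have hb0 : 0 ≤ bound := by positivity
  set αj : ℕ → ℕ → ℂ := fun j m => α m * cK N (K m) j with hαj
  set βj : ℕ → ℕ → ℂ := fun j n => β n * ee (-(n * (j / N : ℝ))) with hβj
  have hexp : ∀ q, ∑ m ∈ range M, ∑ n ∈ range N,
        (if n ≤ K m then α m * β n * (hh q a (m * n) : ℂ) else 0) =
      ∑ j ∈ range N, ∑ m ∈ range M, ∑ n ∈ range N, αj j m * βj j n * (hh q a (m * n) : ℂ) := by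
    intro q
    symm
    rw [sum_comm]
    refine sum_congr rfl fun m _ => ?_
    rw [sum_comm]
    refine sum_congr rfl fun n hn => ?_
    symm
    rw [mem_range] at hn
    by_cases hm : α m = 0
    · simp [hαj, hm]
    have hx := cK_expand N (K m) n (hK m hm) hn
    have : (if n ≤ K m then α m * β n * (hh q a (m * n) : ℂ) else 0) =
      (if n ≤ K m then (1 : ℂ) else 0) * (α m * β n * (hh q a (m * n) : ℂ)) := by
      split_ifs <;> simp
    rw [this, hx, sum_mul]
    refine sum_congr rfl fun j _ => ?_
    simp only [hαj, hβj]; ring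
  calc _ ≤ ∑ q ∈ P, ∑ j ∈ range N,
        ‖∑ m ∈ range M, ∑ n ∈ range N, αj j m * βj j n * (hh q a (m * n) : ℂ)‖ := by
        refine sum_le_sum fun q _ => ?_
        rw [hexp]
        exact norm_sum_le _ _
    _ = ∑ j ∈ range N, ∑ q ∈ P,
        ‖∑ m ∈ range M, ∑ n ∈ range N, αj j m * βj j n * (hh q a (m * n) : ℂ)‖ := sum_comm
    _ ≤ ∑ j ∈ range N, ww N j * bound := by
        refine sum_le_sum fun j hj => ?_
        rw [mem_range] at hj
        have hw := ww_nonneg N j hj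
        refine (bilinear_sum P Q hQ hP a ha (αj j) (βj j) M N).trans ?_
        have e1 : ∑ n ∈ range M, ‖αj j n‖ ^ 2 ≤ (ww N j) ^ 2 * ∑ n ∈ range M, ‖α n‖ ^ 2 := by
          rw [mul_sum]
          refine sum_le_sum fun m _ => ?_
          simp only [hαj]
          by_cases hm : α m = 0
          · simp [hm]
          rw [norm_mul, mul_pow, mul_comm]
          gcongr
          exact norm_cK N (K m) j (hK m hm) hj
        have e2 : ∑ n ∈ range N, ‖βj j n‖ ^ 2 = ∑ n ∈ range N, ‖β n‖ ^ 2 := by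
          refine sum_congr rfl fun n _ => ?_
          simp only [hβj]
          rw [norm_mul, norm_ee, mul_one]
        rw [e2]
        have hE := EE_nonneg Q
        calc _ ≤ (1 / (Q : ℝ)) * (Real.sqrt ((M + EE Q) * ((ww N j) ^ 2 * ∑ n ∈ range M, ‖α n‖ ^ 2)) *
              Real.sqrt ((N + EE Q) * ∑ n ∈ range N, ‖β n‖ ^ 2)) := by gcongr
          _ = ww N j * bound := by
            have e3 : ((M : ℝ) + EE Q) * ((ww N j) ^ 2 * ∑ n ∈ range M, ‖α n‖ ^ 2) =
                (ww N j) ^ 2 * ((M + EE Q) * ∑ n ∈ range M, ‖α n‖ ^ 2) := by ring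
            rw [e3, Real.sqrt_mul (sq_nonneg _), Real.sqrt_sq hw, hbound]
            ring
    _ = (∑ j ∈ range N, ww N j) * bound := by rw [sum_mul]
    _ ≤ _ := by
        gcongr
        exact sum_ww N hN

end LO

namespace LO
open Finset

noncomputable def HZ (q : ℕ) (a : ℤ) (x : ZMod q) : ℝ :=
  (if x = (a : ZMod q) then 1 else 0) - (if x = 0 then 0 else 1 / ((q : ℝ) - 1))

lemma hh_eq (q : ℕ) (a : ℤ) (n : ℕ) : hh q a n = HZ q a (n : ZMod q) := by
  unfold hh HZ
  congr 1
  · congr 1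
    rw [← ZMod.intCast_zmod_eq_zero_iff_dvd, Int.cast_sub, sub_eq_zero, Int.cast_natCast]
  · congr 1
    rw [ZMod.natCast_eq_zero_iff]

lemma sum_affine (q : ℕ) [Fact q.Prime] (F : ZMod q → ℝ) (c d : ZMod q) (hd : d ≠ 0) :
    ∑ k ∈ range q, F (c + d * k) = ∑ x : ZMod q, F x := by
  have h1 : ∑ k ∈ range q, F (c + d * k) = ∑ x : ZMod q, F (c + d * x) := by
    refine sum_bij (fun k _ => (k : ZMod q)) (fun _ _ => mem_univ _) ?_ ?_ (fun _ _ => rfl)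
    · intro a ha b hb h
      rw [mem_range] at ha hb
      have := (ZMod.natCast_eq_natCast_iff a b q).1 h
      exact Nat.ModEq.eq_of_lt_of_lt this ha hb
    · intro x _
      exact ⟨x.val, by rw [mem_range]; exact ZMod.val_lt x, by simp⟩
  rw [h1]
  exact Fintype.sum_equiv ((Equiv.mulLeft₀ d hd).trans (Equiv.addLeft c)) _ _ (fun x => by simp)

lemma sum_blocks (M k : ℕ) (f : ℕ → ℝ) :
    ∑ n ∈ range (M * k), f n = ∑ b ∈ range M, ∑ j ∈ range k, f (b + M * j) := by
  rw [sum_comm]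
  induction k with
  | zero => simp
  | succ k ih =>
    rw [sum_range_succ, ← ih, Nat.mul_succ, sum_range_add]
    congr 1
    refine sum_congr rfl fun b _ => ?_
    rw [add_comm]

lemma sum_HZ (q : ℕ) [Fact q.Prime] (a : ℤ) (ha : ¬ (q : ℤ) ∣ a) :
    ∑ x : ZMod q, HZ q a x = 0 ∧ ∑ x : ZMod q, |HZ q a x| ≤ 2 := by
  have hq : q.Prime := Fact.out
  have hq1 : (0 : ℝ) < q - 1 := by
    have : (1 : ℝ) < q := by exact_mod_cast hq.one_lt
    linarith
  have h1 : ∑ x : ZMod q, (if x = (a : ZMod q) then (1 : ℝ) else 0) = 1 := by simp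
  have h2 : ∑ x : ZMod q, (if x = 0 then (0 : ℝ) else 1 / ((q : ℝ) - 1)) = 1 := by
    have : ∀ x : ZMod q, (if x = 0 then (0 : ℝ) else 1 / ((q : ℝ) - 1)) =
      1 / ((q : ℝ) - 1) - (if x = 0 then 1 / ((q : ℝ) - 1) else 0) := by
      intro x; split_ifs <;> simp
    rw [sum_congr rfl fun x _ => this x, sum_sub_distrib]
    simp only [sum_const, card_univ, ZMod.card, nsmul_eq_mul, sum_ite_eq', mem_univ, if_true]
    field_simp
  constructor
  · unfold HZ
    rw [sum_sub_distrib, h1, h2]; ring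
  · calc _ ≤ ∑ x : ZMod q, ((if x = (a : ZMod q) then (1 : ℝ) else 0) +
          (if x = 0 then (0 : ℝ) else 1 / ((q : ℝ) - 1))) := by
          refine sum_le_sum fun x _ => ?_
          unfold HZ
          refine (abs_sub _ _).trans (le_of_eq ?_)
          rw [abs_of_nonneg, abs_of_nonneg]
          · split_ifs <;> positivity
          · split_ifs <;> positivity
      _ = 2 := by rw [sum_add_distrib, h1, h2]; norm_num

lemma typeI (M : ℕ) (hM : 0 < M) (g : ℕ → ℝ) (hg : ∀ n, |g n| ≤ 1) (hper : ∀ n, g (n + M) = g n)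
    (q : ℕ) (hq : q.Prime) (hqM : ¬ q ∣ M) (a : ℤ) (ha : ¬ (q : ℤ) ∣ a) (m Y : ℕ) :
    |∑ n ∈ range Y, g n * hh q a (m * n)| ≤ 2 * M := by
  have : Fact q.Prime := ⟨hq⟩
  by_cases hm : q ∣ m
  · have : ∀ n ∈ range Y, g n * hh q a (m * n) = 0 := by
      intro n _
      have h1 : q ∣ m * n := hm.mul_right n
      have h2 : ¬ (q : ℤ) ∣ ((m * n : ℕ) : ℤ) - a := by
        intro h
        apply ha
        have h3 : (q : ℤ) ∣ ((m * n : ℕ) : ℤ) := by exact_mod_cast h1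
        exact (dvd_sub_right h3).1 h
      unfold hh
      rw [if_neg h2, if_pos h1]; simp
    rw [sum_eq_zero this]; simp
  have hgj : ∀ b j, g (b + M * j) = g b := by
    intro b j
    induction j with
    | zero => simp
    | succ j ih => rw [Nat.mul_succ, ← add_assoc, hper, ih]
  have hd : (m : ZMod q) * (M : ZMod q) ≠ 0 := by
    rw [mul_ne_zero_iff]
    constructor
    · rwa [Ne, ZMod.natCast_eq_zero_iff]
    · rwa [Ne, ZMod.natCast_eq_zero_iff]
  have haff : ∀ b j : ℕ, ((m * (b + M * j) : ℕ) : ZMod q) = (m * b : ZMod q) + (m * M : ZMod q) * j := by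
    intro b j; push_cast; ring
  obtain ⟨s1, s2⟩ := sum_HZ q a ha
  have hzero : ∑ n ∈ range (M * q), g n * hh q a (m * n) = 0 := by
    rw [sum_blocks]
    refine sum_eq_zero fun b _ => ?_
    simp only [hgj, ← mul_sum, hh_eq, haff]
    rw [sum_affine q _ _ _ hd, s1, mul_zero]
  have habs : ∑ n ∈ range (M * q), |hh q a (m * n)| ≤ 2 * M := by
    rw [sum_blocks]
    simp only [hh_eq, haff]
    calc _ = ∑ b ∈ range M, ∑ x : ZMod q, |HZ q a x| := by
          refine sum_congr rfl fun b _ => ?_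
          exact sum_affine q (fun x => |HZ q a x|) _ _ hd
      _ ≤ ∑ b ∈ range M, (2 : ℝ) := sum_le_sum fun _ _ => s2
      _ = 2 * M := by simp [mul_comm]
  have hMq : 0 < M * q := Nat.mul_pos hM hq.pos
  induction Y using Nat.strong_induction_on with
  | _ Y ih =>
    rcases lt_or_ge Y (M * q) with h | h
    · refine (abs_sum_le_sum_abs _ _).trans (le_trans ?_ habs)
      refine (sum_le_sum (g := fun n => |hh q a (m * n)|) fun n _ => ?_).trans
        (sum_le_sum_of_subset_of_nonneg (range_subset_range.2 h.le) fun _ _ _ => abs_nonneg _)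
      rw [abs_mul]
      exact mul_le_of_le_one_left (abs_nonneg _) (hg n)
    · obtain ⟨Z, rfl⟩ := Nat.exists_eq_add_of_le h
      rw [sum_range_add, hzero, zero_add]
      have : ∀ n ∈ range Z, g (M * q + n) * hh q a (m * (M * q + n)) = g n * hh q a (m * n) := by
        intro n _
        rw [add_comm, hgj, hh_eq, hh_eq]
        congr 2
        push_cast
        simp
      rw [sum_congr rfl this]
      exact ih Z (by omega)

lemma abel_log (u : ℕ → ℝ) (C : ℝ) (h : ∀ Y, |∑ n ∈ range Y, u n| ≤ C) (Y : ℕ) :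
    |∑ n ∈ range (Y + 1), Real.log n * u n| ≤ 2 * C * Real.log Y := by
  have hC : 0 ≤ C := (abs_nonneg _).trans (h 0)
  have := sum_range_by_parts (fun n : ℕ => Real.log n) u (Y + 1)
  simp only [smul_eq_mul, Nat.add_sub_cancel] at this
  rw [this]
  have hmono : ∀ i : ℕ, 0 ≤ Real.log ((i + 1 : ℕ) : ℝ) - Real.log i := by
    intro i
    rcases Nat.eq_zero_or_pos i with rfl | hi
    · simp
    · rw [sub_nonneg]
      exact Real.log_le_log (by exact_mod_cast hi) (by push_cast; linarith)
  have hlogY := Real.log_natCast_nonneg Y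
  refine (abs_sub _ _).trans ?_
  have h1 : |Real.log Y * ∑ i ∈ range (Y + 1), u i| ≤ C * Real.log Y := by
    rw [abs_mul, abs_of_nonneg hlogY, mul_comm]
    exact mul_le_mul_of_nonneg_right (h _) hlogY
  have h2 : |∑ i ∈ range Y, (Real.log ((i + 1 : ℕ) : ℝ) - Real.log i) * ∑ j ∈ range (i + 1), u j| ≤
      C * Real.log Y := by
    calc _ ≤ ∑ i ∈ range Y, (Real.log ((i + 1 : ℕ) : ℝ) - Real.log i) * C := by
          refine (abs_sum_le_sum_abs _ _).trans (sum_le_sum fun i _ => ?_)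
          rw [abs_mul, abs_of_nonneg (hmono i)]
          exact mul_le_mul_of_nonneg_left (h _) (hmono i)
      _ = _ := by
          rw [← sum_mul, sum_range_sub (fun i : ℕ => Real.log (i : ℝ))]
          simp [mul_comm]
  linarith

end LO

namespace LO
open Finset ArithmeticFunction
open scoped ArithmeticFunction.zeta ArithmeticFunction.Moebius

lemma conv_sum (F G : ArithmeticFunction ℝ) (w : ℕ → ℝ) (X : ℕ) :
    ∑ n ∈ Ioc 0 X, (F * G) n * w n =
      ∑ m ∈ Ioc 0 X, ∑ k ∈ Ioc 0 (X / m), F m * G k * w (m * k) := by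
  have h1 : ∑ n ∈ Ioc 0 X, (F * G) n * w n =
      ∑ x ∈ (Ioc 0 X ×ˢ Ioc 0 X).filter (fun x => x.1 * x.2 ≤ X), F x.1 * G x.2 * w (x.1 * x.2) := by
    simp only [ArithmeticFunction.mul_apply, sum_mul]
    trans ∑ n ∈ Ioc 0 X, ∑ x ∈ (Ioc 0 X ×ˢ Ioc 0 X).filter (fun x => x.1 * x.2 = n),
      F x.1 * G x.2 * w (x.1 * x.2)
    · refine sum_congr rfl fun n hn ↦ ?_
      simp only [mem_Ioc] at hn
      rw [Nat.divisorsAntidiagonal_eq_prod_filter_of_le hn.1.ne' hn.2]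
      refine sum_congr rfl fun x hx => ?_
      rw [(mem_filter.1 hx).2]
    · simp_rw [sum_filter]
      rw [sum_comm]
      refine sum_congr rfl fun x hx => ?_
      simp only [mem_product, mem_Ioc] at hx
      rw [sum_ite_eq (Ioc 0 X)]
      simp only [mem_Ioc]
      have : 0 < x.1 * x.2 := Nat.mul_pos hx.1.1 hx.2.1
      simp [this]
  rw [h1, sum_filter, sum_product]
  refine sum_congr rfl fun n hn => ?_
  rw [← sum_filter]
  refine sum_congr ?_ fun _ _ => rfl
  ext k
  simp only [mem_filter, mem_Ioc] at hn ⊢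
  constructor
  · rintro ⟨⟨h1, h2⟩, h3⟩
    exact ⟨h1, by rw [Nat.le_div_iff_mul_le hn.1]; linarith⟩
  · rintro ⟨h1, h2⟩
    rw [Nat.le_div_iff_mul_le hn.1] at h2
    exact ⟨⟨h1, by nlinarith⟩, by linarith⟩

noncomputable def tr1 (z : ℕ) (f : ArithmeticFunction ℝ) : ArithmeticFunction ℝ :=
  ⟨fun n => if n ≤ z then f n else 0, by simp⟩
noncomputable def tr2 (z : ℕ) (f : ArithmeticFunction ℝ) : ArithmeticFunction ℝ :=
  ⟨fun n => if n ≤ z then 0 else f n, by simp⟩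

lemma tr1_apply (z f n) : tr1 z f n = if n ≤ z then f n else 0 := rfl
lemma tr2_apply (z f n) : tr2 z f n = if n ≤ z then 0 else f n := rfl

lemma tr_add (z f) : tr1 z f + tr2 z f = f := by
  ext n
  rw [ArithmeticFunction.add_apply, tr1_apply, tr2_apply]
  split_ifs <;> simp

noncomputable def muR : ArithmeticFunction ℝ := (μ : ArithmeticFunction ℝ)
noncomputable def zR : ArithmeticFunction ℝ := (ζ : ArithmeticFunction ℝ)

lemma muR_abs (n : ℕ) : |muR n| ≤ 1 := by
  unfold muR
  rw [intCoe_apply]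
  exact_mod_cast (abs_moebius_le_one (n := n))

/-- the second factor in the bilinear part of the Vaughan identity -/
noncomputable def bb (z : ℕ) : ArithmeticFunction ℝ := tr2 z Λ * zR

lemma vaughan_id (z : ℕ) : Λ + (tr1 z muR * tr1 z Λ) * zR = tr1 z Λ + tr1 z muR * log +
    tr2 z muR * bb z := by
  have h1 : zR * muR = 1 := by unfold muR zR; exact coe_zeta_mul_coe_moebius
  have h2 : Λ * zR = log := vonMangoldt_mul_zeta
  have h3 := tr_add z Λ
  have h4 := tr_add z muR
  unfold bb
  have h5 : Λ = tr1 z Λ + tr1 z muR * ((tr1 z Λ + tr2 z Λ) * zR) - (tr1 z muR * tr1 z Λ) * zR +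
      tr2 z muR * (tr2 z Λ * zR) := by
    calc Λ = tr1 z Λ + tr2 z Λ * (zR * muR) := by rw [h1, mul_one, h3]
      _ = tr1 z Λ + tr2 z Λ * (zR * (tr1 z muR + tr2 z muR)) := by rw [h4]
      _ = _ := by ring
  rw [h3, h2] at h5
  linear_combination h5

lemma bb_nonneg (z n : ℕ) : 0 ≤ bb z n := by
  unfold bb zR
  rw [coe_mul_zeta_apply]
  refine sum_nonneg fun i _ => ?_
  rw [tr2_apply]; split_ifs
  · exact le_rfl
  · exact vonMangoldt_nonneg

lemma bb_le (z n : ℕ) : bb z n ≤ Real.log n := by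
  unfold bb zR
  rw [coe_mul_zeta_apply, ← vonMangoldt_sum]
  refine sum_le_sum fun i _ => ?_
  rw [tr2_apply]; split_ifs
  · exact vonMangoldt_nonneg
  · exact le_rfl

lemma bb_zero (z n : ℕ) (h : n ≤ z) : bb z n = 0 := by
  unfold bb zR
  rw [coe_mul_zeta_apply]
  refine sum_eq_zero fun i hi => ?_
  rw [tr2_apply, if_pos ((Nat.divisor_le hi).trans h)]

lemma cc_le (z n : ℕ) : |(tr1 z muR * tr1 z Λ) n| ≤ Real.log n := by
  have : Real.log n = (zR * Λ) n := by
    have := congrArg (fun f : ArithmeticFunction ℝ => f n) zeta_mul_vonMangoldt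
    exact this.symm
  rw [this, ArithmeticFunction.mul_apply, ArithmeticFunction.mul_apply]
  refine (abs_sum_le_sum_abs _ _).trans (sum_le_sum fun x hx => ?_)
  have hx1 : x.1 ≠ 0 := by
    have := Nat.mem_divisorsAntidiagonal.1 hx
    rintro h
    rw [h, zero_mul] at this
    exact this.2 this.1.symm
  rw [abs_mul]
  have e1 : |tr1 z muR x.1| ≤ zR x.1 := by
    have : zR x.1 = 1 := by unfold zR; rw [natCoe_apply, zeta_apply_ne hx1]; simp
    rw [this, tr1_apply]; split_ifs
    · exact muR_abs _
    · simp
  have e2 : |tr1 z Λ x.2| ≤ Λ x.2 := by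
    rw [tr1_apply]; split_ifs
    · rw [abs_of_nonneg vonMangoldt_nonneg]
    · simpa using vonMangoldt_nonneg
  exact mul_le_mul e1 e2 (abs_nonneg _) (by linarith [abs_nonneg (tr1 z muR x.1)])

lemma cc_zero (z n : ℕ) (h : z * z < n) : (tr1 z muR * tr1 z Λ) n = 0 := by
  rw [ArithmeticFunction.mul_apply]
  refine sum_eq_zero fun x hx => ?_
  have := (Nat.mem_divisorsAntidiagonal.1 hx).1
  rw [tr1_apply, tr1_apply]
  by_cases h1 : x.1 ≤ z
  · by_cases h2 : x.2 ≤ z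
    · exfalso
      have := Nat.mul_le_mul h1 h2
      omega
    · rw [if_neg h2, mul_zero]
  · rw [if_neg h1, zero_mul]

lemma vaughan_bound (X z : ℕ) (hz : 1 ≤ z) (w : ℕ → ℝ) (C : ℝ) (hw : ∀ n, |w n| ≤ 1)
    (h1 : ∀ m Y, |∑ k ∈ Ioc 0 Y, w (m * k)| ≤ C)
    (h2 : ∀ m Y : ℕ, |∑ k ∈ Ioc 0 Y, Real.log k * w (m * k)| ≤ 2 * C * Real.log Y) :
    |∑ n ∈ Ioc 0 X, Λ n * w n| ≤ (1 + 3 * C) * z ^ 2 * Real.log X +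
      |∑ m ∈ Ioc 0 X, ∑ k ∈ Ioc 0 (X / m), tr2 z muR m * bb z k * w (m * k)| := by
  have hC : 0 ≤ C := (abs_nonneg _).trans (h1 0 0)
  have hL := Real.log_natCast_nonneg X
  have hz1 : (1 : ℝ) ≤ z := by exact_mod_cast hz
  have hzz : (z : ℝ) ≤ z ^ 2 := by nlinarith
  have hlog : ∀ n ∈ Ioc 0 X, Real.log n ≤ Real.log X := by
    intro n hn
    rw [mem_Ioc] at hn
    exact Real.log_le_log (by exact_mod_cast hn.1) (by exact_mod_cast hn.2)
  have key : ∀ (y : ℕ) (f : ℕ → ℝ) (B : ℝ), 0 ≤ B → (∀ n ∈ Ioc 0 X, |f n| ≤ B) → (∀ n, y < n → f n = 0) →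
      |∑ n ∈ Ioc 0 X, f n| ≤ y * B := by
    intro y f B hB hf hf0
    refine (abs_sum_le_sum_abs _ _).trans ?_
    calc _ ≤ ∑ n ∈ Ioc 0 X, (if n ∈ Ioc 0 y then B else 0) := by
          refine sum_le_sum fun n hn => ?_
          split_ifs with h
          · exact hf n hn
          · rw [mem_Ioc] at h hn
            rw [hf0 n (by omega), abs_zero]
      _ = ((Ioc 0 X).filter (fun n => n ∈ Ioc 0 y)).card * B := by
          rw [← sum_filter, sum_const, nsmul_eq_mul]
      _ ≤ _ := by
          gcongr
          have : (Ioc 0 X).filter (fun n => n ∈ Ioc 0 y) ⊆ Ioc 0 y := fun n hn => (mem_filter.1 hn).2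
          simpa using card_le_card this
  have t0 : |∑ n ∈ Ioc 0 X, tr1 z Λ n * w n| ≤ z * Real.log X := by
    refine key z _ _ hL ?_ ?_
    · intro n hn
      rw [abs_mul, tr1_apply]
      refine (mul_le_of_le_one_right (abs_nonneg _) (hw n)).trans ?_
      split_ifs
      · rw [abs_of_nonneg vonMangoldt_nonneg]
        exact vonMangoldt_le_log.trans (hlog n hn)
      · simpa using hL
    · intro n hn
      rw [tr1_apply, if_neg (by omega), zero_mul]
  have t1 : |∑ n ∈ Ioc 0 X, (tr1 z muR * log) n * w n| ≤ z * (2 * C * Real.log X) := by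
    rw [conv_sum]
    refine key z _ _ (by positivity) ?_ ?_
    · intro m hm
      have : ∑ k ∈ Ioc 0 (X / m), tr1 z muR m * log k * w (m * k) =
          tr1 z muR m * ∑ k ∈ Ioc 0 (X / m), Real.log k * w (m * k) := by
        rw [mul_sum]; refine sum_congr rfl fun k _ => ?_
        rw [log_apply]; ring
      rw [this, abs_mul]
      have e1 : |tr1 z muR m| ≤ 1 := by
        rw [tr1_apply]; split_ifs
        · exact muR_abs _
        · simp
      refine (mul_le_of_le_one_left (abs_nonneg _) e1).trans ((h2 m _).trans ?_)
      refine mul_le_mul_of_nonneg_left ?_ (by positivity)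
      rcases Nat.eq_zero_or_pos (X / m) with h | h
      · rw [h]; simpa using hL
      · exact Real.log_le_log (by exact_mod_cast h) (by exact_mod_cast Nat.div_le_self X m)
    · intro m hm
      refine sum_eq_zero fun k _ => ?_
      rw [tr1_apply, if_neg (by omega)]; ring
  have t2 : |∑ n ∈ Ioc 0 X, ((tr1 z muR * tr1 z Λ) * zR) n * w n| ≤ (z * z : ℕ) * (C * Real.log X) := by
    rw [conv_sum]
    refine key (z * z) _ _ (by positivity) ?_ ?_
    · intro m hm
      have : ∑ k ∈ Ioc 0 (X / m), (tr1 z muR * tr1 z Λ) m * zR k * w (m * k) =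
          (tr1 z muR * tr1 z Λ) m * ∑ k ∈ Ioc 0 (X / m), w (m * k) := by
        rw [mul_sum]; refine sum_congr rfl fun k hk => ?_
        rw [mem_Ioc] at hk
        have : zR k = 1 := by unfold zR; rw [natCoe_apply, zeta_apply_ne (by omega)]; simp
        rw [this]; ring
      rw [this, abs_mul, mul_comm C]
      exact mul_le_mul ((cc_le z m).trans (hlog m hm)) (h1 m _) (abs_nonneg _) hL
    · intro m hm
      refine sum_eq_zero fun k _ => ?_
      rw [cc_zero z m hm]; ring
  have hid : ∑ n ∈ Ioc 0 X, Λ n * w n = ∑ n ∈ Ioc 0 X, tr1 z Λ n * w n +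
      ∑ n ∈ Ioc 0 X, (tr1 z muR * log) n * w n - ∑ n ∈ Ioc 0 X, ((tr1 z muR * tr1 z Λ) * zR) n * w n +
      ∑ n ∈ Ioc 0 X, (tr2 z muR * bb z) n * w n := by
    rw [← sum_add_distrib, ← sum_sub_distrib, ← sum_add_distrib]
    refine sum_congr rfl fun n _ => ?_
    have := congrArg (fun f : ArithmeticFunction ℝ => f n) (vaughan_id z)
    simp only [ArithmeticFunction.add_apply] at this
    linear_combination (w n) * this
  rw [hid, ← conv_sum]
  push_cast at t2
  set A0 := ∑ n ∈ Ioc 0 X, tr1 z Λ n * w n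
  set A1 := ∑ n ∈ Ioc 0 X, (tr1 z muR * log) n * w n
  set A2 := ∑ n ∈ Ioc 0 X, ((tr1 z muR * tr1 z Λ) * zR) n * w n
  set A3 := ∑ n ∈ Ioc 0 X, (tr2 z muR * bb z) n * w n
  have tri : |A0 + A1 - A2 + A3| ≤ |A0| + |A1| + |A2| + |A3| := by
    have e1 := abs_add_le (A0 + A1 - A2) A3
    have e2 := abs_sub (A0 + A1) A2
    have e3 := abs_add_le A0 A1
    linarith
  have s0 : z * Real.log X ≤ (z : ℝ) ^ 2 * Real.log X := by gcongr
  have s1 : z * (2 * C * Real.log X) ≤ (z : ℝ) ^ 2 * (2 * C * Real.log X) := by gcongr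
  linarith

end LO

namespace LO
open Finset

lemma typeII_algebra (Mr Nr E Qr Xr zr L B ℓ : ℝ) (hM : 0 ≤ Mr) (hN : 0 ≤ Nr) (hE : 0 ≤ E) (hQ : 0 < Qr)
    (hX : 0 ≤ Xr) (hz : 0 < zr) (hL : 0 ≤ L) (hB : 1 ≤ B) (hℓ : 0 ≤ ℓ)
    (hEB : E ≤ (B * Qr) ^ 2) (hMN : Mr * Nr ≤ 4 * Xr) (hMN2 : Mr + Nr ≤ 6 * Xr / zr) :
    ℓ * ((1 / Qr) * (Real.sqrt ((Mr + E) * Mr) * Real.sqrt ((Nr + E) * (Nr * L ^ 2)))) ≤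
      ℓ * L * B ^ 2 * (4 * Xr / Qr + 6 * Xr / Real.sqrt zr + 2 * Qr * Real.sqrt Xr) := by
  have hsz : 0 < Real.sqrt zr := Real.sqrt_pos.2 hz
  have hsx : Real.sqrt Xr ^ 2 = Xr := Real.sq_sqrt hX
  have h1 : Real.sqrt ((Mr + E) * Mr) * Real.sqrt ((Nr + E) * (Nr * L ^ 2)) =
      L * (Real.sqrt (Mr * Nr) * Real.sqrt ((Mr + E) * (Nr + E))) := by
    rw [← Real.sqrt_mul (by positivity), ← Real.sqrt_mul (by positivity)]
    have : (Mr + E) * Mr * ((Nr + E) * (Nr * L ^ 2)) = L ^ 2 * (Mr * Nr * ((Mr + E) * (Nr + E))) := by ring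
    rw [this, Real.sqrt_mul (sq_nonneg L), Real.sqrt_sq hL]
  have h2 : Real.sqrt (Mr * Nr) ≤ 2 * Real.sqrt Xr := by
    rw [Real.sqrt_le_left (by positivity), mul_pow, hsx]; linarith
  have h3 : Real.sqrt ((Mr + E) * (Nr + E)) ≤
      2 * Real.sqrt Xr + 3 * (B * Qr) * (Real.sqrt Xr / Real.sqrt zr) + (B * Qr) ^ 2 := by
    rw [Real.sqrt_le_left (by positivity)]
    have hr : (Real.sqrt Xr / Real.sqrt zr) ^ 2 = Xr / zr := by
      rw [div_pow, hsx, Real.sq_sqrt hz.le]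
    set r := Real.sqrt Xr / Real.sqrt zr
    have hr0 : 0 ≤ r := by positivity
    set s := Real.sqrt Xr
    have hs0 : 0 ≤ s := by positivity
    set D := B * Qr
    have hD0 : 0 ≤ D := by positivity
    have e1 : E * (Mr + Nr) ≤ D ^ 2 * (6 * r ^ 2) := by
      rw [hr]
      refine mul_le_mul hEB (hMN2.trans (le_of_eq (by ring))) (by positivity) (by positivity)
    have e2 : E ^ 2 ≤ (D ^ 2) ^ 2 := by gcongr
    have e3 : (Mr + E) * (Nr + E) = Mr * Nr + E * (Mr + Nr) + E ^ 2 := by ring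
    rw [e3]
    have e4 : (2 * s + 3 * D * r + D ^ 2) ^ 2 = 4 * s ^ 2 + 9 * D ^ 2 * r ^ 2 + (D ^ 2) ^ 2 +
      (12 * s * D * r + 4 * s * D ^ 2 + 6 * D ^ 3 * r) := by ring
    rw [e4, hsx]
    have e5 : 0 ≤ 12 * s * D * r + 4 * s * D ^ 2 + 6 * D ^ 3 * r := by positivity
    have e6 : 0 ≤ D ^ 2 * r ^ 2 := by positivity
    linarith
  rw [h1]
  calc ℓ * (1 / Qr * (L * (Real.sqrt (Mr * Nr) * Real.sqrt ((Mr + E) * (Nr + E)))))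
      ≤ ℓ * (1 / Qr * (L * (2 * Real.sqrt Xr * (2 * Real.sqrt Xr +
        3 * (B * Qr) * (Real.sqrt Xr / Real.sqrt zr) + (B * Qr) ^ 2)))) := by gcongr
    _ = ℓ * L * (4 * (Real.sqrt Xr ^ 2) / Qr + B * (6 * (Real.sqrt Xr ^ 2) / Real.sqrt zr) +
        B ^ 2 * (2 * Qr * Real.sqrt Xr)) := by field_simp; ring
    _ = ℓ * L * (1 * (4 * Xr / Qr) + B * (6 * Xr / Real.sqrt zr) +
        B ^ 2 * (2 * Qr * Real.sqrt Xr)) := by rw [hsx]; ring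
    _ ≤ ℓ * L * (B ^ 2 * (4 * Xr / Qr) + B ^ 2 * (6 * Xr / Real.sqrt zr) +
        B ^ 2 * (2 * Qr * Real.sqrt Xr)) := by
        gcongr
        · nlinarith
        · nlinarith
    _ = _ := by ring

lemma log_ge (X : ℕ) (hX : 2 ≤ X) : (0.69 : ℝ) ≤ Real.log X := by
  have h1 := Real.log_two_gt_d9
  have h2 : Real.log 2 ≤ Real.log X := Real.log_le_log (by norm_num) (by exact_mod_cast hX)
  linarith

lemma typeII_ij (P : Finset ℕ) (Q : ℕ) (hQ : 1 ≤ Q)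
    (hP : ∀ q ∈ P, q.Prime ∧ Q ≤ q ∧ q ≤ 2 * Q) (a : ℤ) (ha : ∀ q ∈ P, ¬ (q : ℤ) ∣ a)
    (X z : ℕ) (hX : 2 ≤ X) (hz : 1 ≤ z) (hQX : 2 * Q ≤ X) (α β : ℕ → ℝ) (hα : ∀ n, |α n| ≤ 1)
    (hβ : ∀ n, |β n| ≤ Real.log n) (hα0 : ∀ n ≤ z, α n = 0) (hβ0 : ∀ n ≤ z, β n = 0) (i : ℕ) :
    ∑ q ∈ P, |∑ m ∈ Ico (2 ^ i) (2 ^ (i + 1)), ∑ k ∈ Ioc 0 (X / m), α m * β k * hh q a (m * k)| ≤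
      576 * Real.log X ^ 3 * (X / Q + X / Real.sqrt z + Q * Real.sqrt X) := by
  have hL := log_ge X hX
  have hQ0 : (0 : ℝ) < Q := by exact_mod_cast hQ
  have hz0 : (0 : ℝ) < z := by exact_mod_cast hz
  have hXr : (0 : ℝ) < X := by exact_mod_cast (by omega : 0 < X)
  by_cases hc1 : 2 ^ (i + 1) ≤ z
  · rw [sum_eq_zero]
    · positivity
    · intro q _
      rw [sum_eq_zero, abs_zero]
      intro m hm
      rw [mem_Ico] at hm
      refine sum_eq_zero fun k _ => ?_
      rw [hα0 m (by omega)]; ring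
  by_cases hc2 : X / 2 ^ i ≤ z
  · rw [sum_eq_zero]
    · positivity
    · intro q _
      rw [sum_eq_zero, abs_zero]
      intro m hm
      rw [mem_Ico] at hm
      refine sum_eq_zero fun k hk => ?_
      rw [mem_Ioc] at hk
      have : X / m ≤ X / 2 ^ i := Nat.div_le_div_left hm.1 (by positivity)
      rw [hβ0 k (by omega)]; ring
  push Not at hc1 hc2
  set N := X / 2 ^ i + 1 with hN
  set M := 2 ^ (i + 1) with hM
  set αi : ℕ → ℂ := fun m => if 2 ^ i ≤ m then (α m : ℂ) else 0 with hαi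
  set βi : ℕ → ℂ := fun n => (β n : ℂ) with hβi
  have hb := bilinear_trunc P Q hQ hP a ha αi βi M N (by omega) (fun m => X / m) (by
    intro m hm
    have hm' : 2 ^ i ≤ m := by
      by_contra h
      exact hm (by simp [hαi, h])
    have : X / m ≤ X / 2 ^ i := Nat.div_le_div_left hm' (by positivity)
    omega)
  have heq : ∀ q, |∑ m ∈ Ico (2 ^ i) M, ∑ k ∈ Ioc 0 (X / m), α m * β k * hh q a (m * k)| =
      ‖∑ m ∈ range M, ∑ n ∈ range N,
        if n ≤ X / m then αi m * βi n * (hh q a (m * n) : ℂ) else 0‖ := by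
    intro q
    rw [← Real.norm_eq_abs, ← Complex.norm_real]
    congr 1
    have hsub : Ico (2 ^ i) M ⊆ range M := fun m hm => by
      rw [mem_Ico] at hm; rw [mem_range]; exact hm.2
    rw [← sum_subset hsub]
    · push_cast
      refine sum_congr rfl fun m hm => ?_
      rw [mem_Ico] at hm
      rw [← sum_filter]
      have hle : X / m ≤ X / 2 ^ i := Nat.div_le_div_left hm.1 (by positivity)
      have hsub2 : Ioc 0 (X / m) ⊆ (range N).filter (fun n => n ≤ X / m) := fun n hn => by
        rw [mem_Ioc] at hn; rw [mem_filter, mem_range]; exact ⟨by omega, hn.2⟩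
      rw [← sum_subset hsub2]
      · refine sum_congr rfl fun k _ => ?_
        simp only [hαi, hβi, if_pos hm.1]
      · intro n hn hn'
        rw [mem_filter] at hn
        rw [mem_Ioc] at hn'
        have : n = 0 := by omega
        subst this
        simp [hβi, hβ0 0 (by omega)]
    · intro m hm hm'
      rw [mem_range] at hm
      rw [mem_Ico] at hm'
      refine sum_eq_zero fun n _ => ?_
      have : αi m = 0 := by simp only [hαi]; rw [if_neg (by omega)]
      rw [this]; simp
  rw [sum_congr rfl fun q _ => heq q]
  refine hb.trans ?_
  have hsα : ∑ n ∈ range M, ‖αi n‖ ^ 2 ≤ M := by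
    calc _ ≤ ∑ n ∈ range M, (1 : ℝ) := by
          refine sum_le_sum fun n _ => ?_
          have : ‖αi n‖ ≤ 1 := by
            simp only [hαi]; split_ifs
            · rw [Complex.norm_real]; exact hα n
            · simp
          exact pow_le_one₀ (norm_nonneg _) this
      _ = M := by simp
  have hNX : N ≤ X + 1 := by
    have := Nat.div_le_self X (2 ^ i)
    omega
  have hsβ : ∑ n ∈ range N, ‖βi n‖ ^ 2 ≤ N * Real.log X ^ 2 := by
    calc _ ≤ ∑ n ∈ range N, (Real.log X) ^ 2 := by
          refine sum_le_sum fun n hn => ?_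
          rw [mem_range] at hn
          have : ‖βi n‖ ≤ Real.log X := by
            simp only [hβi]; rw [Complex.norm_real]
            refine (hβ n).trans ?_
            rcases Nat.eq_zero_or_pos n with h | h
            · subst h; simp; positivity
            · exact Real.log_le_log (by exact_mod_cast h) (by exact_mod_cast (by omega : n ≤ X))
          gcongr
      _ = _ := by simp
  have hlogN : Real.log N ≤ 1 + Real.log X := by
    have h1 : (N : ℝ) ≤ X + 1 := by exact_mod_cast hNX
    have h2 : (N : ℝ) ≤ Real.exp 1 * X := by
      have := Real.add_one_le_exp 1
      have h3 : (2 : ℝ) ≤ X := by exact_mod_cast hX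
      nlinarith
    have h4 := Real.log_le_log (by exact_mod_cast (by omega : 0 < N)) h2
    rw [Real.log_mul (Real.exp_pos 1).ne' hXr.ne', Real.log_exp] at h4
    exact h4
  have hE := EE_nonneg Q
  have hlogN0 := Real.log_natCast_nonneg N
  have hlQ : Real.log ((2 * Q : ℕ) : ℝ) ≤ Real.log X :=
    Real.log_le_log (by exact_mod_cast (by omega : 0 < 2 * Q)) (by exact_mod_cast hQX)
  have hlQ0 := Real.log_natCast_nonneg (2 * Q)
  set B := Real.sqrt (16 * Real.log X) with hBdef
  have hB2 : B ^ 2 = 16 * Real.log X := Real.sq_sqrt (by positivity)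
  have hB1 : 1 ≤ B := by
    rw [hBdef, Real.one_le_sqrt]; linarith
  have hpow : (0 : ℝ) < 2 ^ i := by positivity
  have hMr : (M : ℝ) = 2 * 2 ^ i := by rw [hM]; push_cast; ring
  have hdiv : ((X / 2 ^ i : ℕ) : ℝ) ≤ X / 2 ^ i := by
    have := @Nat.cast_div_le ℝ _ _ _ X (2 ^ i)
    push_cast at this; exact this
  have hN2 : (N : ℝ) ≤ 2 * (X / 2 ^ i) := by
    have h1 : (1 : ℝ) ≤ ((X / 2 ^ i : ℕ) : ℝ) := by exact_mod_cast (by omega : 1 ≤ X / 2 ^ i)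
    rw [hN]; push_cast [-Nat.cast_div] at hdiv h1 ⊢; linarith
  have hzi : (z : ℝ) ≤ X / 2 ^ i := by
    have h1 : (z : ℝ) ≤ ((X / 2 ^ i : ℕ) : ℝ) := by exact_mod_cast hc2.le
    exact h1.trans hdiv
  have hzM : (z : ℝ) ≤ 2 * 2 ^ i := by
    rw [← hMr]; exact_mod_cast hc1.le
  calc _ ≤ (2 + Real.log N) * ((1 / (Q : ℝ)) * (Real.sqrt ((M + EE Q) * M) *
        Real.sqrt ((N + EE Q) * (N * Real.log X ^ 2)))) := by gcongr
    _ ≤ (2 + Real.log N) * Real.log X * B ^ 2 *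
        (4 * X / Q + 6 * X / Real.sqrt z + 2 * Q * Real.sqrt X) := by
        refine typeII_algebra M N (EE Q) Q X z (Real.log X) B (2 + Real.log N) (by positivity) (by positivity)
          hE hQ0 hXr.le hz0 (by linarith) hB1 (by positivity) ?_ ?_ ?_
        · rw [mul_pow, hB2]
          unfold EE
          push_cast at hlQ ⊢
          have : (2 * (Q : ℝ)) ^ 2 * (1 + 2 * Real.log (2 * (Q : ℝ))) ≤
            (2 * (Q : ℝ)) ^ 2 * (4 * Real.log X) := by
            gcongr; linarith
          linarith
        · rw [hMr]
          calc 2 * (2 : ℝ) ^ i * N ≤ 2 * (2 : ℝ) ^ i * (2 * (X / 2 ^ i)) := by gcongr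
            _ = 4 * X := by field_simp; ring
        · rw [le_div_iff₀ hz0]
          rw [le_div_iff₀ hpow] at hzi
          have e1 : (M : ℝ) * z ≤ 2 * X := by rw [hMr]; linarith
          have e2 : (N : ℝ) * z ≤ 4 * X := by
            calc (N : ℝ) * z ≤ 2 * (X / 2 ^ i) * (2 * 2 ^ i) := by gcongr
              _ = 4 * X := by field_simp; ring
          linarith
    _ ≤ (6 * Real.log X) * Real.log X * (16 * Real.log X) *
        (6 * X / Q + 6 * X / Real.sqrt z + 6 * Q * Real.sqrt X) := by
        rw [hB2]
        gcongr
        · linarith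
        · norm_num
        · norm_num
    _ = _ := by ring

lemma sum_dyadic (I : ℕ) (F : ℕ → ℝ) :
    ∑ m ∈ Ico 1 (2 ^ I), F m = ∑ i ∈ range I, ∑ m ∈ Ico (2 ^ i) (2 ^ (i + 1)), F m := by
  induction I with
  | zero => simp
  | succ I ih =>
    rw [sum_range_succ, ← ih]
    exact (sum_Ico_consecutive F Nat.one_le_two_pow (Nat.pow_le_pow_right (by norm_num) (by omega))).symm

lemma log2_le (X : ℕ) (hX : 2 ≤ X) : ((Nat.log 2 X + 1 : ℕ) : ℝ) ≤ 3 * Real.log X := by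
  have h1 : ((2 ^ Nat.log 2 X : ℕ) : ℝ) ≤ X := by exact_mod_cast Nat.pow_log_le_self 2 (by omega)
  have h2 := Real.log_le_log (by positivity) h1
  push_cast at h2 ⊢
  rw [Real.log_pow] at h2
  have h3 := Real.log_two_gt_d9
  have h4 := log_ge X hX
  have h5 : (0 : ℝ) ≤ Nat.log 2 X := by positivity
  nlinarith

theorem typeII (P : Finset ℕ) (Q0 Q1 : ℝ) (hQ0 : 0 < Q0) (hQ1 : 0 < Q1)
    (hP : ∀ q ∈ P, q.Prime ∧ Q0 ≤ q ∧ q ≤ Q1) (a : ℤ) (ha : ∀ q ∈ P, ¬ (q : ℤ) ∣ a)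
    (X z : ℕ) (hX : 2 ≤ X) (hz : 1 ≤ z) (hQX : 2 * Q1 ≤ X) (α β : ℕ → ℝ) (hα : ∀ n, |α n| ≤ 1)
    (hβ : ∀ n, |β n| ≤ Real.log n) (hα0 : ∀ n ≤ z, α n = 0) (hβ0 : ∀ n ≤ z, β n = 0) :
    ∑ q ∈ P, |∑ m ∈ Ioc 0 X, ∑ k ∈ Ioc 0 (X / m), α m * β k * hh q a (m * k)| ≤
      5184 * Real.log X ^ 5 * (2 * X / Q0 + X / Real.sqrt z + Q1 * Real.sqrt X) := by
  have hL := log_ge X hX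
  have hXr : (0 : ℝ) < X := by exact_mod_cast (by omega : 0 < X)
  set I := Nat.log 2 X + 1 with hI
  have hXI : X < 2 ^ I := Nat.lt_pow_succ_log_self (by norm_num) X
  have hI3 : (I : ℝ) ≤ 3 * Real.log X := log2_le X hX
  set R := 2 * X / Q0 + X / Real.sqrt z + Q1 * Real.sqrt X with hR
  have hR0 : 0 ≤ R := by positivity
  have hsplit : ∀ q, ∑ m ∈ Ioc 0 X, ∑ k ∈ Ioc 0 (X / m), α m * β k * hh q a (m * k) =
      ∑ i ∈ range I, ∑ m ∈ Ico (2 ^ i) (2 ^ (i + 1)), ∑ k ∈ Ioc 0 (X / m), α m * β k * hh q a (m * k) := by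
    intro q
    rw [← sum_dyadic]
    refine sum_subset (fun m hm => ?_) (fun m hm hm' => ?_)
    · rw [mem_Ioc] at hm; rw [mem_Ico]; omega
    · rw [mem_Ioc] at hm'; rw [mem_Ico] at hm
      have : X / m = 0 := Nat.div_eq_of_lt (by omega)
      rw [this]; simp
  have hone : ∀ j ∈ range I, ∀ i ∈ range I, ∑ q ∈ P.filter (fun q => Nat.log 2 q = j),
      |∑ m ∈ Ico (2 ^ i) (2 ^ (i + 1)), ∑ k ∈ Ioc 0 (X / m), α m * β k * hh q a (m * k)| ≤
      576 * Real.log X ^ 3 * R := by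
    intro j _ i _
    rcases (P.filter (fun q => Nat.log 2 q = j)).eq_empty_or_nonempty with he | ⟨q₁, hq₁⟩
    · rw [he, sum_empty]; positivity
    have hj : ∀ q ∈ P.filter (fun q => Nat.log 2 q = j), 2 ^ j ≤ q ∧ q < 2 * 2 ^ j := by
      intro q hq
      obtain ⟨h1, h2⟩ := mem_filter.1 hq
      have h3 := Nat.pow_log_le_self 2 (hP q h1).1.ne_zero
      have h4 := Nat.lt_pow_succ_log_self (b := 2) (by norm_num) q
      rw [h2] at h3 h4
      rw [Nat.succ_eq_add_one, pow_succ] at h4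
      exact ⟨h3, by omega⟩
    obtain ⟨hq1, hq1'⟩ := mem_filter.1 hq₁
    obtain ⟨e1, e2⟩ := hj q₁ hq₁
    obtain ⟨-, e3, e4⟩ := hP q₁ hq1
    have e1' : ((2 ^ j : ℕ) : ℝ) ≤ q₁ := by exact_mod_cast e1
    have e2' : (q₁ : ℝ) < 2 * ((2 ^ j : ℕ) : ℝ) := by exact_mod_cast e2
    have hjp : (0 : ℝ) < ((2 ^ j : ℕ) : ℝ) := by positivity
    refine (typeII_ij (P.filter (fun q => Nat.log 2 q = j)) (2 ^ j) Nat.one_le_two_pow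
      (fun q hq => ⟨(hP q (mem_filter.1 hq).1).1, (hj q hq).1, (hj q hq).2.le⟩) a
      (fun q hq => ha q (mem_filter.1 hq).1) X z hX hz ?_ α β hα hβ hα0 hβ0 i).trans ?_
    · have : 2 * ((2 ^ j : ℕ) : ℝ) ≤ X := by linarith
      exact_mod_cast this
    · rw [hR]
      have f1 : (X : ℝ) / ((2 ^ j : ℕ) : ℝ) ≤ 2 * X / Q0 := by
        rw [div_le_div_iff₀ hjp hQ0]
        nlinarith
      have f2 : ((2 ^ j : ℕ) : ℝ) ≤ Q1 := by linarith
      gcongr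
  calc _ ≤ ∑ q ∈ P, ∑ i ∈ range I,
        |∑ m ∈ Ico (2 ^ i) (2 ^ (i + 1)), ∑ k ∈ Ioc 0 (X / m), α m * β k * hh q a (m * k)| := by
        refine sum_le_sum fun q _ => ?_
        rw [hsplit]
        exact abs_sum_le_sum_abs _ _
    _ = ∑ j ∈ range I, ∑ q ∈ P.filter (fun q => Nat.log 2 q = j), ∑ i ∈ range I,
        |∑ m ∈ Ico (2 ^ i) (2 ^ (i + 1)), ∑ k ∈ Ioc 0 (X / m), α m * β k * hh q a (m * k)| := by
        rw [sum_fiberwise_of_maps_to]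
        intro q hq
        rw [mem_range, hI, Nat.lt_succ_iff]
        refine Nat.log_mono_right ?_
        have := (hP q hq).2.2
        have : (q : ℝ) ≤ X := by linarith
        exact_mod_cast this
    _ = ∑ j ∈ range I, ∑ i ∈ range I, ∑ q ∈ P.filter (fun q => Nat.log 2 q = j),
        |∑ m ∈ Ico (2 ^ i) (2 ^ (i + 1)), ∑ k ∈ Ioc 0 (X / m), α m * β k * hh q a (m * k)| :=
        sum_congr rfl fun j _ => sum_comm
    _ ≤ ∑ j ∈ range I, ∑ i ∈ range I, 576 * Real.log X ^ 3 * R :=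
        sum_le_sum fun j hj => sum_le_sum fun i hi => hone j hj i hi
    _ = I * (I * (576 * Real.log X ^ 3 * R)) := by simp
    _ ≤ (3 * Real.log X) * ((3 * Real.log X) * (576 * Real.log X ^ 3 * R)) := by gcongr
    _ = _ := by ring

end LO

namespace LO
open Finset ArithmeticFunction Filter Topology
open scoped ArithmeticFunction.zeta ArithmeticFunction.Moebius

lemma hh_abs (q : ℕ) (hq : q.Prime) (a : ℤ) (n : ℕ) : |hh q a n| ≤ 1 := by
  have h2 : (2 : ℝ) ≤ q := by exact_mod_cast hq.two_le
  have h3 : 1 / ((q : ℝ) - 1) ≤ 1 := by rw [div_le_one (by linarith)]; linarith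
  have h4 : 0 ≤ 1 / ((q : ℝ) - 1) := by
    apply div_nonneg; norm_num; linarith
  unfold hh
  rw [abs_le]
  split_ifs <;> constructor <;> linarith

lemma hh_zero (q : ℕ) (a : ℤ) (ha : ¬ (q : ℤ) ∣ a) : hh q a 0 = 0 := by
  unfold hh
  rw [if_neg, if_pos (dvd_zero q)]
  · simp
  · simpa using ha

lemma sum_range_Ioc (f : ℕ → ℝ) (h0 : f 0 = 0) (Y : ℕ) :
    ∑ n ∈ range (Y + 1), f n = ∑ n ∈ Ioc 0 Y, f n := by
  symm
  refine sum_subset (fun n hn => ?_) (fun n hn hn' => ?_)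
  · rw [mem_Ioc] at hn; rw [mem_range]; omega
  · rw [mem_range] at hn; rw [mem_Ioc] at hn'
    have : n = 0 := by omega
    rw [this, h0]

lemma bv_q (M : ℕ) (hM : 0 < M) (g : ℕ → ℝ) (hg : ∀ n, |g n| ≤ 1) (hper : ∀ n, g (n + M) = g n)
    (hmul : ∀ m n, g (m * n) = g m * g n)
    (q : ℕ) (hq : q.Prime) (hqM : ¬ q ∣ M) (a : ℤ) (ha : ¬ (q : ℤ) ∣ a) (X z : ℕ) (hz : 1 ≤ z) :
    |∑ n ∈ Ioc 0 X, Λ n * (g n * hh q a n)| ≤ (1 + 6 * M) * z ^ 2 * Real.log X +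
      |∑ m ∈ Ioc 0 X, ∑ k ∈ Ioc 0 (X / m),
        (tr2 z muR m * g m) * (bb z k * g k) * hh q a (m * k)| := by
  have hT := fun m Y => typeI M hM g hg hper q hq hqM a ha m Y
  have e1 : ∀ (m Y : ℕ), ∑ k ∈ Ioc 0 Y, g (m * k) * hh q a (m * k) =
      g m * ∑ k ∈ range (Y + 1), g k * hh q a (m * k) := by
    intro m Y
    rw [sum_range_Ioc _ (by rw [mul_zero, hh_zero q a ha, mul_zero]), mul_sum]
    refine sum_congr rfl fun k _ => ?_
    rw [hmul]; ring
  have e2 : ∀ (m Y : ℕ), ∑ k ∈ Ioc 0 Y, Real.log k * (g (m * k) * hh q a (m * k)) =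
      g m * ∑ k ∈ range (Y + 1), Real.log k * (g k * hh q a (m * k)) := by
    intro m Y
    rw [sum_range_Ioc _ (by simp), mul_sum]
    refine sum_congr rfl fun k _ => ?_
    rw [hmul]; ring
  have := vaughan_bound X z hz (fun n => g n * hh q a n) (2 * M) (fun n => by
      rw [abs_mul]; exact mul_le_one₀ (hg n) (abs_nonneg _) (hh_abs q hq a n))
    (fun m Y => by
      rw [e1, abs_mul]
      exact (mul_le_of_le_one_left (abs_nonneg _) (hg m)).trans (hT m _))
    (fun m Y => by
      rw [e2, abs_mul]
      exact (mul_le_of_le_one_left (abs_nonneg _) (hg m)).trans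
        (abel_log (fun k => g k * hh q a (m * k)) _ (hT m) Y))
  refine this.trans (le_of_eq ?_)
  congr 1
  · ring
  · congr 1
    refine sum_congr rfl fun m _ => sum_congr rfl fun k _ => ?_
    rw [hmul]; ring

theorem bv (M : ℕ) (hM : 0 < M) (g : ℕ → ℝ) (hg : ∀ n, |g n| ≤ 1) (hper : ∀ n, g (n + M) = g n)
    (hmul : ∀ m n, g (m * n) = g m * g n) (a : ℤ) (ha : a.natAbs = 1) (δ ε : ℝ) (hδ : 0 < δ)
    (hδ' : δ ≤ 1 / 10) (hε : 0 < ε) :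
    ∀ᶠ X : ℕ in atTop, ∀ P : Finset ℕ,
      (∀ q ∈ P, q.Prime ∧ (X : ℝ) ^ δ ≤ q ∧ (q : ℝ) ≤ (X : ℝ) ^ (1 / 2 - δ)) →
      ∑ q ∈ P, Real.log q * |∑ n ∈ Ioc 0 X, Λ n * (g n * hh q a n)| ≤ ε * X := by
  have hlo : ∀ᶠ X : ℕ in atTop, (6 * M + 5 * 5184 + 1) * Real.log X ^ (6 : ℝ) ≤ ε * (X : ℝ) ^ (δ / 2) := by
    have h1 := (isLittleO_log_rpow_rpow_atTop (6 : ℝ) (by positivity : 0 < δ / 2)).comp_tendsto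
      tendsto_natCast_atTop_atTop
    have h2 := h1.def (by positivity : 0 < ε / (6 * M + 5 * 5184 + 1))
    filter_upwards [h2, eventually_ge_atTop 1] with X hX hX1
    simp only [Function.comp] at hX
    rw [Real.norm_of_nonneg (Real.rpow_nonneg (Real.log_natCast_nonneg X) _),
      Real.norm_of_nonneg (by positivity), div_mul_eq_mul_div, le_div_iff₀ (by positivity)] at hX
    linarith
  have hbig : ∀ᶠ X : ℕ in atTop, (M : ℝ) + 2 < (X : ℝ) ^ δ :=
    ((tendsto_rpow_atTop hδ).comp tendsto_natCast_atTop_atTop).eventually_gt_atTop _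
  have hlog1 : ∀ᶠ X : ℕ in atTop, (1 : ℝ) ≤ Real.log X :=
    (Real.tendsto_log_atTop.comp tendsto_natCast_atTop_atTop).eventually_ge_atTop _
  filter_upwards [hlo, hbig, hlog1, eventually_ge_atTop 4] with X hX hXM hL hX4
  intro P hP
  have hXr : (4 : ℝ) ≤ X := by exact_mod_cast hX4
  have hX0 : (0 : ℝ) < X := by linarith
  have hX1 : (1 : ℝ) ≤ X := by linarith
  set z := ⌊(X : ℝ) ^ δ⌋₊ with hz
  have hzle : (z : ℝ) ≤ (X : ℝ) ^ δ := Nat.floor_le (by positivity)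
  have hzge : (X : ℝ) ^ δ / 4 ≤ z := by
    have := Nat.lt_floor_add_one ((X : ℝ) ^ δ)
    rw [← hz] at this
    have : (0 : ℝ) ≤ M := by positivity
    linarith
  have hz1 : 1 ≤ z := by
    rw [hz, Nat.one_le_floor_iff]
    have : (0 : ℝ) ≤ M := by positivity
    linarith
  have hqM : ∀ q ∈ P, ¬ q ∣ M := by
    intro q hq hd
    have h1 := Nat.le_of_dvd hM hd
    have h2 := (hP q hq).2.1
    have h3 : (q : ℝ) ≤ M := by exact_mod_cast h1
    linarith
  have hqa : ∀ q ∈ P, ¬ (q : ℤ) ∣ a := by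
    intro q hq hd
    have := Int.natAbs_dvd_natAbs.2 hd
    rw [ha, Int.natAbs_natCast, Nat.dvd_one] at this
    exact (hP q hq).1.one_lt.ne' this
  set L := Real.log X with hLdef
  have hhalf : (X : ℝ) ^ (1 / 2 : ℝ) = Real.sqrt X := by rw [Real.sqrt_eq_rpow]
  have hQ1 : 2 * (X : ℝ) ^ (1 / 2 - δ) ≤ X := by
    have h1 : (X : ℝ) ^ (1 / 2 - δ) ≤ (X : ℝ) ^ (1 / 2 : ℝ) :=
      Real.rpow_le_rpow_of_exponent_le hX1 (by linarith)
    have h2 : (2 : ℝ) ≤ Real.sqrt X := by rw [Real.le_sqrt (by norm_num) hX0.le]; linarith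
    have h3 := Real.mul_self_sqrt hX0.le
    rw [hhalf] at h1
    nlinarith
  have hT := typeII P ((X : ℝ) ^ δ) ((X : ℝ) ^ (1 / 2 - δ)) (by positivity) (by positivity) hP a hqa X z
    (by omega) hz1 hQ1 (fun m => tr2 z muR m * g m) (fun k => bb z k * g k)
    (fun n => by
      rw [abs_mul]
      refine mul_le_one₀ ?_ (abs_nonneg _) (hg n)
      rw [tr2_apply]; split_ifs
      · simp
      · exact muR_abs _)
    (fun n => by
      rw [abs_mul, abs_of_nonneg (bb_nonneg z n)]
      exact (mul_le_of_le_one_right (bb_nonneg z n) (hg n)).trans (bb_le z n))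
    (fun n hn => by rw [tr2_apply, if_pos hn, zero_mul])
    (fun n hn => by rw [bb_zero z n hn, zero_mul])
  set TT : ℕ → ℝ := fun q => |∑ m ∈ Ioc 0 X, ∑ k ∈ Ioc 0 (X / m),
        (tr2 z muR m * g m) * (bb z k * g k) * hh q a (m * k)| with hTT
  have hlogq : ∀ q ∈ P, Real.log q ≤ L := by
    intro q hq
    have h1 := (hP q hq).2.2
    have h3 : (0 : ℝ) < q := by exact_mod_cast (hP q hq).1.pos
    exact Real.log_le_log h3 (by linarith)
  have hcard : (P.card : ℝ) ≤ (X : ℝ) ^ (1 / 2 - δ) := by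
    have hsub : P ⊆ Ioc 0 ⌊(X : ℝ) ^ (1 / 2 - δ)⌋₊ := by
      intro q hq
      rw [mem_Ioc]
      exact ⟨(hP q hq).1.pos, Nat.le_floor (hP q hq).2.2⟩
    have h1 := card_le_card hsub
    rw [Nat.card_Ioc, Nat.sub_zero] at h1
    calc (P.card : ℝ) ≤ ⌊(X : ℝ) ^ (1 / 2 - δ)⌋₊ := by exact_mod_cast h1
      _ ≤ _ := Nat.floor_le (by positivity)
  have hsz : (X : ℝ) / Real.sqrt z ≤ 2 * (X : ℝ) ^ (1 - δ / 2) := by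
    have h1 : (X : ℝ) ^ (δ / 2) / 2 ≤ Real.sqrt z := by
      apply Real.le_sqrt_of_sq_le
      rw [div_pow, ← Real.rpow_natCast, ← Real.rpow_mul hX0.le]
      refine le_trans (le_of_eq ?_) hzge
      norm_num
    rw [div_le_iff₀ (by positivity)]
    calc (X : ℝ) = 2 * (X : ℝ) ^ (1 - δ / 2) * ((X : ℝ) ^ (δ / 2) / 2) := by
          have : (X : ℝ) ^ (1 - δ / 2) * (X : ℝ) ^ (δ / 2) = X := by
            rw [← Real.rpow_add hX0]; norm_num
          linarith
      _ ≤ _ := by gcongr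
  have hx1 : 2 * (X : ℝ) / (X : ℝ) ^ δ ≤ 2 * (X : ℝ) ^ (1 - δ / 2) := by
    have : 2 * (X : ℝ) / (X : ℝ) ^ δ = 2 * (X : ℝ) ^ (1 - δ) := by
      rw [Real.rpow_sub hX0, Real.rpow_one]; ring
    rw [this]
    have := Real.rpow_le_rpow_of_exponent_le hX1 (by linarith : 1 - δ ≤ 1 - δ / 2)
    linarith
  have hx2 : (X : ℝ) ^ (1 / 2 - δ) * Real.sqrt X ≤ (X : ℝ) ^ (1 - δ / 2) := by
    rw [← hhalf, ← Real.rpow_add hX0]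
    exact Real.rpow_le_rpow_of_exponent_le hX1 (by linarith)
  have hx3 : (X : ℝ) ^ (1 / 2 - δ) * (z : ℝ) ^ 2 ≤ (X : ℝ) ^ (1 - δ / 2) := by
    calc (X : ℝ) ^ (1 / 2 - δ) * (z : ℝ) ^ 2 ≤ (X : ℝ) ^ (1 / 2 - δ) * ((X : ℝ) ^ δ) ^ 2 := by gcongr
      _ = (X : ℝ) ^ (1 / 2 - δ + δ * 2) := by
          rw [← Real.rpow_natCast, ← Real.rpow_mul hX0.le, ← Real.rpow_add hX0]; norm_num
      _ ≤ _ := Real.rpow_le_rpow_of_exponent_le hX1 (by linarith)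
  set W := (X : ℝ) ^ (1 - δ / 2) with hW
  have hW0 : 0 ≤ W := by positivity
  have hL26 : L ^ 2 ≤ L ^ 6 := pow_le_pow_right₀ hL (by norm_num)
  calc _ ≤ ∑ q ∈ P, L * ((1 + 6 * M) * z ^ 2 * L + TT q) := by
        refine sum_le_sum fun q hq => ?_
        exact mul_le_mul (hlogq q hq) (bv_q M hM g hg hper hmul q (hP q hq).1 (hqM q hq) a (hqa q hq) X z hz1)
          (abs_nonneg _) (by linarith)
    _ = P.card * z ^ 2 * ((1 + 6 * M) * L ^ 2) + L * ∑ q ∈ P, TT q := by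
        rw [← mul_sum, sum_add_distrib, sum_const, nsmul_eq_mul]; ring
    _ ≤ (X : ℝ) ^ (1 / 2 - δ) * z ^ 2 * ((1 + 6 * M) * L ^ 6) + L * (5184 * L ^ 5 *
        (2 * X / (X : ℝ) ^ δ + X / Real.sqrt z + (X : ℝ) ^ (1 / 2 - δ) * Real.sqrt X)) := by
        gcongr
    _ ≤ W * ((1 + 6 * M) * L ^ 6) + L * (5184 * L ^ 5 * (2 * W + 2 * W + W)) := by
        gcongr
    _ = ((6 * M + 5 * 5184 + 1) * L ^ 6) * W := by ring
    _ ≤ (ε * (X : ℝ) ^ (δ / 2)) * W := by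
        refine mul_le_mul_of_nonneg_right ?_ hW0
        refine le_trans (le_of_eq ?_) hX
        rw [← Real.rpow_natCast]; norm_num
    _ = ε * X := by
        rw [hW, mul_assoc, ← Real.rpow_add hX0]; norm_num

end LO

namespace LO
open Finset ArithmeticFunction
open scoped ArithmeticFunction.zeta

noncomputable def SM (N : ℕ) : ℝ := ∑ n ∈ Ioc 0 N, Λ n / n

lemma sum_log_eq (N : ℕ) : ∑ n ∈ Ioc 0 N, Real.log n = ∑ d ∈ Ioc 0 N, Λ d * ((N / d : ℕ) : ℝ) := by
  have := sum_Ioc_mul_zeta_eq_sum (R := ℝ) Λ N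
  rw [vonMangoldt_mul_zeta] at this
  exact this

lemma SM_upper (N : ℕ) (hN : 1 ≤ N) : SM N ≤ Real.log N + (Real.log 4 + 4) := by
  have hN0 : (0 : ℝ) < N := by exact_mod_cast hN
  have h1 : ∑ n ∈ Ioc 0 N, Real.log n ≤ N * Real.log N := by
    calc _ ≤ ∑ n ∈ Ioc 0 N, Real.log N := by
          refine sum_le_sum fun n hn => ?_
          rw [mem_Ioc] at hn
          exact Real.log_le_log (by exact_mod_cast hn.1) (by exact_mod_cast hn.2)
      _ = _ := by simp
  rw [sum_log_eq] at h1
  have h2 : N * SM N ≤ ∑ d ∈ Ioc 0 N, Λ d * ((N / d : ℕ) : ℝ) + Chebyshev.psi N := by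
    rw [SM, Chebyshev.psi, Nat.floor_natCast, mul_sum, ← sum_add_distrib]
    refine sum_le_sum fun d hd => ?_
    rw [mem_Ioc] at hd
    have hd0 : (0 : ℝ) < d := by exact_mod_cast hd.1
    have h3 : (N : ℝ) / d ≤ ((N / d : ℕ) : ℝ) + 1 := by
      rw [div_le_iff₀ hd0]
      have := Nat.lt_div_mul_add (a := N) hd.1
      have h4 : N ≤ (N / d + 1) * d := by rw [add_mul]; omega
      exact_mod_cast h4
    calc (N : ℝ) * (Λ d / d) = Λ d * (N / d) := by ring
      _ ≤ Λ d * (((N / d : ℕ) : ℝ) + 1) := mul_le_mul_of_nonneg_left h3 vonMangoldt_nonneg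
      _ = _ := by ring
  have h3 := Chebyshev.psi_le_const_mul_self hN0.le
  have h4 : N * SM N ≤ N * (Real.log N + (Real.log 4 + 4)) := by linarith
  exact le_of_mul_le_mul_left h4 hN0

lemma SM_lower (N : ℕ) (hN : 1 ≤ N) : Real.log N - 1 ≤ SM N := by
  have hN0 : (0 : ℝ) < N := by exact_mod_cast hN
  have h1 : ∑ n ∈ Ioc 0 N, Real.log n = Real.log (N.factorial) := by
    clear hN hN0
    induction N with
    | zero => simp
    | succ N ih =>
      rw [sum_Ioc_succ_top (by omega), ih, Nat.factorial_succ, Nat.cast_mul,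
        Real.log_mul (by positivity) (by positivity), add_comm]
  have h2 : N * Real.log N - N ≤ Real.log (N.factorial) := by
    have h := Real.pow_div_factorial_le_exp N hN0.le N
    have h5 := Real.log_le_log (by positivity) h
    rw [Real.log_exp, Real.log_div (by positivity) (by positivity), Real.log_pow] at h5
    linarith
  rw [← h1, sum_log_eq] at h2
  have h3 : ∑ d ∈ Ioc 0 N, Λ d * ((N / d : ℕ) : ℝ) ≤ N * SM N := by
    rw [SM, mul_sum]
    refine sum_le_sum fun d hd => ?_
    calc Λ d * ((N / d : ℕ) : ℝ) ≤ Λ d * (N / d) :=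
          mul_le_mul_of_nonneg_left Nat.cast_div_le vonMangoldt_nonneg
      _ = _ := by ring
  have h4 : N * (Real.log N - 1) ≤ N * SM N := by linarith
  exact le_of_mul_le_mul_left h4 hN0

theorem mertens : ∃ C : ℝ, 0 ≤ C ∧ ∀ w y : ℝ, 1 ≤ w → w ≤ y → ∀ P : Finset ℕ,
    (∀ q ∈ P, q.Prime ∧ w < q ∧ (q : ℝ) ≤ y) →
    ∑ q ∈ P, Real.log q / ((q : ℝ) - 1) ≤ Real.log y - Real.log w + C := by
  have hsum : Summable (fun n : ℕ => 4 * (1 / (n : ℝ) ^ (3 / 2 : ℝ))) :=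
    (Real.summable_one_div_nat_rpow.2 (by norm_num)).mul_left 4
  set C2 := ∑' n : ℕ, 4 * (1 / (n : ℝ) ^ (3 / 2 : ℝ)) with hC2
  have hC20 : 0 ≤ C2 := tsum_nonneg fun n => by positivity
  have hl2 : 0 ≤ Real.log 2 := Real.log_nonneg (by norm_num)
  have hl4 : 0 ≤ Real.log 4 := Real.log_nonneg (by norm_num)
  refine ⟨(Real.log 4 + 4) + 1 + Real.log 2 + C2, by positivity, fun w y hw hwy P hP => ?_⟩
  have hfw : 1 ≤ ⌊w⌋₊ := by rwa [Nat.one_le_floor_iff]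
  have hfy : ⌊w⌋₊ ≤ ⌊y⌋₊ := Nat.floor_le_floor hwy
  have h1 : ∑ q ∈ P, Λ q / q ≤ SM ⌊y⌋₊ - SM ⌊w⌋₊ := by
    have e : SM ⌊y⌋₊ - SM ⌊w⌋₊ = ∑ n ∈ Ioc ⌊w⌋₊ ⌊y⌋₊, Λ n / n := by
      rw [SM, SM, sub_eq_iff_eq_add, add_comm]
      exact (sum_Ioc_consecutive _ (by omega) hfy).symm
    rw [e]
    refine sum_le_sum_of_subset_of_nonneg (fun q hq => ?_) (fun n _ _ => ?_)
    · obtain ⟨h1, h2, h3⟩ := hP q hq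
      rw [mem_Ioc]
      exact ⟨(Nat.floor_lt (by linarith)).2 h2, Nat.le_floor h3⟩
    · exact div_nonneg vonMangoldt_nonneg (by positivity)
  have h2 := SM_upper ⌊y⌋₊ (by omega)
  have h3 := SM_lower ⌊w⌋₊ hfw
  have h4 : Real.log ⌊y⌋₊ ≤ Real.log y :=
    Real.log_le_log (by exact_mod_cast (by omega : 0 < ⌊y⌋₊)) (Nat.floor_le (by linarith))
  have h5 : Real.log w ≤ Real.log 2 + Real.log ⌊w⌋₊ := by
    have hf : (1 : ℝ) ≤ ⌊w⌋₊ := by exact_mod_cast hfw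
    rw [← Real.log_mul (by norm_num) (by positivity)]
    refine Real.log_le_log (by linarith) ?_
    have := Nat.lt_floor_add_one w
    linarith
  have h6 : ∑ q ∈ P, Real.log q / ((q : ℝ) - 1) ≤
      ∑ q ∈ P, (Λ q / q + 4 * (1 / (q : ℝ) ^ (3 / 2 : ℝ))) := by
    refine sum_le_sum fun q hq => ?_
    have hqp := (hP q hq).1
    rw [vonMangoldt_apply_prime hqp]
    have hq2 : (2 : ℝ) ≤ q := by exact_mod_cast hqp.two_le
    have hq0 : (0 : ℝ) < q := by linarith
    have hl : Real.log q ≤ 2 * (q : ℝ) ^ (1 / 2 : ℝ) := by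
      have := Real.log_le_rpow_div hq0.le (by norm_num : (0 : ℝ) < 1 / 2)
      linarith
    have e1 : Real.log q / ((q : ℝ) - 1) = Real.log q / q + Real.log q / (q * (q - 1)) := by
      have : (q : ℝ) - 1 ≠ 0 := by linarith
      field_simp; ring
    rw [e1]
    refine add_le_add_right ?_ _
    have e2 : (q : ℝ) ^ (3 / 2 : ℝ) * (q : ℝ) ^ (1 / 2 : ℝ) = q ^ 2 := by
      rw [← Real.rpow_add hq0]; norm_num
    have e3 : 4 * (1 / (q : ℝ) ^ (3 / 2 : ℝ)) = 4 * (q : ℝ) ^ (1 / 2 : ℝ) / q ^ 2 := by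
      rw [← e2]
      have : (q : ℝ) ^ (1 / 2 : ℝ) ≠ 0 := by positivity
      have : (q : ℝ) ^ (3 / 2 : ℝ) ≠ 0 := by positivity
      field_simp
    rw [e3, div_le_div_iff₀ (by nlinarith) (by positivity)]
    have e4 : (0 : ℝ) ≤ (q : ℝ) ^ (1 / 2 : ℝ) := by positivity
    have e5 : (q : ℝ) ^ 2 ≤ 2 * (q * (q - 1)) := by nlinarith
    calc Real.log q * (q : ℝ) ^ 2 ≤ 2 * (q : ℝ) ^ (1 / 2 : ℝ) * (2 * (q * (q - 1))) := by gcongr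
      _ = _ := by ring
  have h7 : ∑ q ∈ P, 4 * (1 / (q : ℝ) ^ (3 / 2 : ℝ)) ≤ C2 :=
    hsum.sum_le_tsum P (fun n _ => by positivity)
  rw [sum_add_distrib] at h6
  linarith

end LO

namespace LO
open Finset Filter Topology

/-- abstract properties of the quadratic character used in the argument -/
structure IsChi (M : ℕ) (χ : ℕ → ℤ) : Prop where
  pos : 0 < M
  val : ∀ n, χ n = 1 ∨ χ n = -1 ∨ χ n = 0
  per : ∀ n, χ (n + M) = χ n
  mul : ∀ m n, χ (m * n) = χ m * χ n
  cop : ∀ n, χ n ≠ 0 ↔ n.Coprime M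

lemma IsChi.mod {M : ℕ} {χ : ℕ → ℤ} (h : IsChi M χ) (n : ℕ) : χ (n % M) = χ n := by
  conv_rhs => rw [← Nat.mod_add_div n M]
  generalize n / M = j
  induction j with
  | zero => simp
  | succ j ih => rw [Nat.mul_succ, ← add_assoc, h.per, ih]

lemma count_Tq {M : ℕ} {χ : ℕ → ℤ} (h : IsChi M χ) (q : ℕ) (hq : q.Prime) (hMq : M < q)
    (X Q : ℕ) (hQ : 2 ≤ Q) :
    (((Icc 1 X).filter (fun p => p.Prime ∧ χ p ≠ 0 ∧ (q : ℤ) ∣ (p : ℤ) - χ p)).card : ℝ) ≤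
      M * Q + (X / (q * M) + 1 + (Q : ℝ) ^ 2 * (1 + 2 * Real.log Q)) *
        (q * M / (((q : ℝ) - 1) * Real.log Q)) := by
  classical
  have hM := h.pos
  have hcop : q.Coprime M := by
    rw [hq.coprime_iff_not_dvd]
    intro hd
    have := Nat.le_of_dvd hM hd
    omega
  set U := (range M).filter (fun b => M.Coprime b) with hU
  have hUcard : U.card = M.totient := rfl
  set c : ℕ → ℕ := fun b => Nat.chineseRemainder hcop ((χ b % q).toNat) b with hc
  have hsub : (Icc 1 X).filter (fun p => p.Prime ∧ χ p ≠ 0 ∧ (q : ℤ) ∣ (p : ℤ) - χ p) ⊆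
      U.biUnion (fun b => (Icc 1 X).filter (fun p => p.Prime ∧ p ≡ c b [MOD (q * M)])) := by
    intro p hp
    obtain ⟨h1, h2, h3, h4⟩ := mem_filter.1 hp
    rw [mem_biUnion]
    refine ⟨p % M, ?_, ?_⟩
    · rw [hU, mem_filter, mem_range]
      refine ⟨Nat.mod_lt _ hM, ?_⟩
      rw [Nat.coprime_comm, ← h.cop, h.mod]
      exact h3
    · rw [mem_filter]
      refine ⟨h1, h2, ?_⟩
      obtain ⟨e1, e2⟩ := (Nat.chineseRemainder hcop ((χ (p % M) % q).toNat) (p % M)).2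
      rw [← Nat.modEq_and_modEq_iff_modEq_mul hcop]
      constructor
      · refine Nat.ModEq.trans ?_ e1.symm
        rw [← Int.natCast_modEq_iff, Int.toNat_of_nonneg (Int.emod_nonneg _ (by exact_mod_cast hq.ne_zero)),
          h.mod]
        refine Int.ModEq.trans ?_ (Int.mod_modEq _ _).symm
        exact ((Int.modEq_iff_dvd).2 h4).symm
      · exact (Nat.mod_modEq p M).symm.trans e2.symm
  have hk : 0 < q * M := Nat.mul_pos hq.pos hM
  have htot : ((q * M).totient : ℝ) = (q - 1) * M.totient := by
    rw [Nat.totient_mul hcop, Nat.totient_prime hq, Nat.cast_mul, Nat.cast_sub hq.one_le, Nat.cast_one]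
  have hphi : (0 : ℝ) < M.totient := by exact_mod_cast Nat.totient_pos.2 hM
  have hphile : (M.totient : ℝ) ≤ M := by exact_mod_cast Nat.totient_le M
  have hq1 : (0 : ℝ) < q - 1 := by
    have : (1 : ℝ) < q := by exact_mod_cast hq.one_lt
    linarith
  have hlogQ : 0 < Real.log Q := Real.log_pos (by exact_mod_cast (by omega : 1 < Q))
  calc _ ≤ ((∑ b ∈ U, ((Icc 1 X).filter (fun p => p.Prime ∧ p ≡ c b [MOD (q * M)])).card : ℕ) : ℝ) := by
        exact_mod_cast (card_le_card hsub).trans card_biUnion_le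
    _ = ∑ b ∈ U, (((Icc 1 X).filter (fun p => p.Prime ∧ p ≡ c b [MOD (q * M)])).card : ℝ) := by push_cast; rfl
    _ ≤ ∑ b ∈ U, (Q + (X / ((q * M : ℕ) : ℝ) + 1 + (Q:ℝ)^2 * (1 + 2 * Real.log Q)) *
        (((q * M : ℕ) : ℝ) / (Nat.totient (q * M) * Real.log Q))) :=
        sum_le_sum fun b _ => brun_titchmarsh (q * M) (c b) X Q hk hQ
    _ = M.totient * Q + (X / (q * M) + 1 + (Q : ℝ) ^ 2 * (1 + 2 * Real.log Q)) *
        (q * M / (((q : ℝ) - 1) * Real.log Q)) := by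
        rw [sum_const, hUcard, nsmul_eq_mul, htot]
        push_cast
        field_simp
    _ ≤ _ := by gcongr

noncomputable def TT (χ : ℕ → ℤ) (X q : ℕ) : ℝ :=
  ∑ p ∈ (Icc 1 X).filter (fun p => p.Prime ∧ χ p ≠ 0 ∧ (q : ℤ) ∣ (p : ℤ) - χ p), Real.log p

lemma Tq_alg (L M Q q l X V s ε c K : ℝ) (hL1 : 1 ≤ L) (hM : 0 < M) (hQ2 : 2 ≤ Q) (hq1 : 1 < q)
    (hl : 1 / 2 ≤ l) (hX0 : 0 < X) (hε : 0 < ε)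
    (hmain : L ≤ (1 / s + ε / 4) * l) (hX' : 13 * M * L ^ 2 ≤ ε / 4 * V)
    (hqQ2 : q * Q ^ 2 * V ≤ X) (hsinv : 1 / s = K + ε / 4)
    (hc : c ≤ M * Q + (X / (q * M) + 1 + Q ^ 2 * (1 + 2 * l)) * (q * M / ((q - 1) * l))) :
    L * c * (q - 1) ≤ (K + ε) * X := by
  have hq0 : 0 < q - 1 := by linarith
  have hl0 : 0 < l := by linarith
  have hL0 : 0 < L := by linarith
  have f1 : L * M * Q * (q - 1) ≤ L * M * (q * Q ^ 2) := by
    have h1 : Q ≤ Q ^ 2 := by nlinarith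
    have h2 : Q * (q - 1) ≤ Q ^ 2 * q :=
      mul_le_mul h1 (by linarith) hq0.le (by positivity)
    have h3 := mul_le_mul_of_nonneg_left h2 (by positivity : 0 ≤ L * M)
    linarith
  have f2 : L / l ≤ 1 / s + ε / 4 := by rwa [div_le_iff₀ hl0]
  have f3 : 1 + Q ^ 2 * (1 + 2 * l) ≤ 6 * Q ^ 2 * l := by
    have : (4 : ℝ) ≤ Q ^ 2 := by nlinarith
    nlinarith
  have f4 : (1 + Q ^ 2 * (1 + 2 * l)) * (q * M * L / l) ≤ 6 * Q ^ 2 * l * (q * M * L / l) :=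
    mul_le_mul_of_nonneg_right f3 (by positivity)
  have f5 : 6 * Q ^ 2 * l * (q * M * L / l) = 6 * (q * Q ^ 2) * M * L := by field_simp
  have f6 : X * (L / l) ≤ X * (1 / s + ε / 4) := mul_le_mul_of_nonneg_left f2 hX0.le
  have f7 : L * c * (q - 1) ≤ L * (M * Q + (X / (q * M) + 1 + Q ^ 2 * (1 + 2 * l)) *
      (q * M / ((q - 1) * l))) * (q - 1) :=
    mul_le_mul_of_nonneg_right (mul_le_mul_of_nonneg_left hc hL0.le) hq0.le
  have f8 : L * (M * Q + (X / (q * M) + 1 + Q ^ 2 * (1 + 2 * l)) *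
      (q * M / ((q - 1) * l))) * (q - 1) = L * M * Q * (q - 1) + X * (L / l) +
      (1 + Q ^ 2 * (1 + 2 * l)) * (q * M * L / l) := by
    field_simp
    ring
  have hT : 0 ≤ M * (q * Q ^ 2) := by positivity
  have f9 : L * M * (q * Q ^ 2) + 6 * (q * Q ^ 2) * M * L ≤ 13 * M * L ^ 2 * (q * Q ^ 2) := by
    have hLL : L ≤ L ^ 2 := by nlinarith
    have h1 := mul_le_mul_of_nonneg_left hLL hT
    have h2 : 0 ≤ M * (q * Q ^ 2) * L ^ 2 := by positivity
    nlinarith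
  have f10 := mul_le_mul_of_nonneg_right hX' (by positivity : (0 : ℝ) ≤ q * Q ^ 2)
  have f11 : ε / 4 * V * (q * Q ^ 2) ≤ ε / 4 * X := by
    have := mul_le_mul_of_nonneg_left hqQ2 (by positivity : 0 ≤ ε / 4)
    linarith
  rw [hsinv] at f6
  have : 0 < ε * X := by positivity
  nlinarith

theorem Tq_bound {M : ℕ} {χ : ℕ → ℤ} (h : IsChi M χ) (η ε : ℝ) (hη : η < 1) (hη0 : 0 < η) (hε : 0 < ε) :
    ∀ᶠ X : ℕ in atTop, ∀ q : ℕ, q.Prime → M < q → (q : ℝ) ≤ (X : ℝ) ^ η →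
      TT χ X q ≤ (2 / (1 - η) + ε) * (X / ((q : ℝ) - 1)) := by
  have h1η : 0 < 1 - η := by linarith
  -- choice of the exponent
  set κ := ε * (1 - η) / (8 + ε * (1 - η)) with hκ
  have hκ0 : 0 < κ := by positivity
  have hκ1 : κ < 1 := by rw [hκ, div_lt_one (by positivity)]; linarith
  set s := (1 - η) * (1 - κ) / 2 with hs
  have h1κ : 1 - κ = 8 / (8 + ε * (1 - η)) := by rw [hκ]; field_simp; ring
  have hs0 : 0 < s := by
    have : 0 < 1 - κ := by linarith
    positivity
  have hsinv : 1 / s = 2 / (1 - η) + ε / 4 := by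
    rw [hs, h1κ]; field_simp; ring
  have hs2 : 2 * s - (1 - η) = - (κ * (1 - η)) := by rw [hs]; ring
  have hMr : (0 : ℝ) < M := by exact_mod_cast h.pos
  have hlo : ∀ᶠ X : ℕ in atTop, 13 * M * Real.log X ^ (2 : ℝ) ≤ ε / 4 * (X : ℝ) ^ (κ * (1 - η)) := by
    have h1 := (isLittleO_log_rpow_rpow_atTop (2 : ℝ) (by positivity : 0 < κ * (1 - η))).comp_tendsto
      tendsto_natCast_atTop_atTop
    have h2 := h1.def (by positivity : 0 < ε / 4 / (13 * M))
    filter_upwards [h2, eventually_ge_atTop 1] with X hX hX1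
    simp only [Function.comp] at hX
    rw [Real.norm_of_nonneg (Real.rpow_nonneg (Real.log_natCast_nonneg X) _),
      Real.norm_of_nonneg (by positivity), div_mul_eq_mul_div, le_div_iff₀ (by positivity)] at hX
    linarith
  have hbig : ∀ᶠ X : ℕ in atTop, 2 < (X : ℝ) ^ s :=
    ((tendsto_rpow_atTop hs0).comp tendsto_natCast_atTop_atTop).eventually_gt_atTop _
  have hlog1 : ∀ᶠ X : ℕ in atTop, 1 + (1 / s + ε / 4) * Real.log 2 / (ε / 4 * s) ≤ Real.log X :=
    (Real.tendsto_log_atTop.comp tendsto_natCast_atTop_atTop).eventually_ge_atTop _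
  filter_upwards [hlo, hbig, hlog1, eventually_ge_atTop 2] with X hX hXs hL hX2
  intro q hq hMq hqη
  have hX1 : (1 : ℝ) ≤ X := by exact_mod_cast (by omega : 1 ≤ X)
  have hX0 : (0 : ℝ) < X := by linarith
  set L := Real.log X with hLdef
  set Q := ⌊(X : ℝ) ^ s⌋₊ with hQdef
  have hQ2 : 2 ≤ Q := Nat.le_floor (by exact_mod_cast hXs.le)
  have hQle : (Q : ℝ) ≤ (X : ℝ) ^ s := Nat.floor_le (by positivity)
  have hQge : (X : ℝ) ^ s / 2 ≤ Q := by
    have := Nat.lt_floor_add_one ((X : ℝ) ^ s)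
    rw [← hQdef] at this
    linarith
  have hQ2r : (2 : ℝ) ≤ Q := by exact_mod_cast hQ2
  have hl2 := Real.log_two_gt_d9
  have hL1 : 1 ≤ L := by
    have : 0 ≤ (1 / s + ε / 4) * Real.log 2 / (ε / 4 * s) := by positivity
    linarith
  have hlogQ2 : (1 / 2 : ℝ) ≤ Real.log Q := by
    have := Real.log_le_log (by norm_num) hQ2r
    linarith
  have hlogQge : s * L - Real.log 2 ≤ Real.log Q := by
    have := Real.log_le_log (by positivity) hQge
    rwa [Real.log_div (by positivity) (by norm_num), Real.log_rpow hX0] at this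
  have hlogQle : Real.log Q ≤ L := by
    refine Real.log_le_log (by positivity) (hQle.trans ?_)
    have : (X : ℝ) ^ s ≤ (X : ℝ) ^ (1 : ℝ) :=
      Real.rpow_le_rpow_of_exponent_le hX1 (by rw [hs]; nlinarith)
    rwa [Real.rpow_one] at this
  have hmain : L ≤ (1 / s + ε / 4) * Real.log Q := by
    have e1 : (1 / s + ε / 4) * (s * L - Real.log 2) ≤ (1 / s + ε / 4) * Real.log Q := by gcongr
    have e2 : (1 / s + ε / 4) * Real.log 2 / (ε / 4 * s) ≤ L := by linarith
    rw [div_le_iff₀ (by positivity)] at e2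
    have e3 : (1 / s + ε / 4) * (s * L - Real.log 2) = L + L * (ε / 4 * s) - (1 / s + ε / 4) * Real.log 2 := by
      field_simp
    linarith
  have hq1 : (1 : ℝ) < q := by exact_mod_cast hq.one_lt
  have hq0 : (0 : ℝ) < (q : ℝ) - 1 := by linarith
  set V := (X : ℝ) ^ (κ * (1 - η)) with hV
  have hV0 : 0 < V := by positivity
  -- q * Q^2 <= X / V
  have hqQ : (q : ℝ) * (X : ℝ) ^ (2 * s) * V ≤ X := by
    calc (q : ℝ) * (X : ℝ) ^ (2 * s) * V ≤ (X : ℝ) ^ η * (X : ℝ) ^ (2 * s) * V := by gcongr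
      _ = (X : ℝ) ^ (η + 2 * s + κ * (1 - η)) := by rw [hV, Real.rpow_add hX0, Real.rpow_add hX0]
      _ = X := by
        have : η + 2 * s + κ * (1 - η) = 1 := by linarith
        rw [this, Real.rpow_one]
  have hQsq : (Q : ℝ) ^ 2 ≤ (X : ℝ) ^ (2 * s) := by
    calc (Q : ℝ) ^ 2 ≤ ((X : ℝ) ^ s) ^ 2 := by gcongr
      _ = _ := by rw [← Real.rpow_natCast, ← Real.rpow_mul hX0.le]; ring_nf
  have hqQ2 : (q : ℝ) * (Q : ℝ) ^ 2 * V ≤ X := by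
    refine le_trans ?_ hqQ
    gcongr
  have hcount := count_Tq h q hq hMq X Q hQ2
  have hTT : TT χ X q ≤ L * (((Icc 1 X).filter (fun p => p.Prime ∧ χ p ≠ 0 ∧ (q : ℤ) ∣ (p : ℤ) - χ p)).card : ℝ) := by
    unfold TT
    rw [mul_comm, ← nsmul_eq_mul, ← sum_const]
    refine sum_le_sum fun p hp => ?_
    have hp1 := mem_Icc.1 (mem_filter.1 hp).1
    exact Real.log_le_log (by exact_mod_cast hp1.1) (by exact_mod_cast hp1.2)
  refine hTT.trans ?_
  rw [← mul_div_assoc, le_div_iff₀ hq0]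
  have hlQ0 : 0 < Real.log Q := by linarith
  have hX' : 13 * M * L ^ 2 ≤ ε / 4 * V := by
    refine le_trans (le_of_eq ?_) hX
    rw [← Real.rpow_natCast]; norm_num
  exact Tq_alg L M Q q (Real.log Q) X V s ε _ (2 / (1 - η)) hL1 hMr hQ2r hq1 hlogQ2 hX0 hε hmain hX' hqQ2 hsinv hcount

end LO

namespace LO
open Finset Filter Topology
open scoped NumberTheorySymbols

/-- the quadratic character attached to `D` -/
def chi (D : ℤ) (n : ℕ) : ℤ := if n % 2 = 1 then J(D | n) else 0

lemma chi_isChi (D : ℤ) (hD : D ≠ 0) : IsChi (4 * D.natAbs) (chi D) where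
  pos := by have := Int.natAbs_pos.2 hD; omega
  val n := by
    unfold chi
    split_ifs
    · rcases jacobiSym.trichotomy D n with h | h | h <;> simp [h]
    · simp
  per n := by
    unfold chi
    have e : (n + 4 * D.natAbs) % 2 = n % 2 := by omega
    rw [e]
    split_ifs with h
    · rw [jacobiSym.mod_right D (b := n + 4 * D.natAbs) (by rw [Nat.odd_iff]; omega),
        jacobiSym.mod_right D (b := n) (Nat.odd_iff.2 h), Nat.add_mod_right]
    · rfl
  mul m n := by
    unfold chi
    rw [Nat.mul_mod]
    rcases Nat.mod_two_eq_zero_or_one m with h1 | h1 <;>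
    rcases Nat.mod_two_eq_zero_or_one n with h2 | h2 <;> simp only [h1, h2] <;> norm_num
    exact jacobiSym.mul_right' D (by omega) (by omega)
  cop n := by
    unfold chi
    rw [Nat.coprime_mul_iff_right]
    have h4 : n.Coprime 4 ↔ n % 2 = 1 := by
      rw [show (4 : ℕ) = 2 ^ 2 by norm_num, Nat.coprime_pow_right_iff (by norm_num),
        Nat.coprime_two_right, Nat.odd_iff]
    rw [h4]
    split_ifs with h
    · rw [Ne, jacobiSym.eq_zero_iff]
      have hn : n ≠ 0 := by omega
      simp only [h, hn, ne_eq, not_false_eq_true, true_and, not_not]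
      rw [Nat.coprime_comm]; rfl
    · simp [h]

lemma trace_sq_ne (A : Matrix (Fin 2) (Fin 2) ℤ) (htr : 2 < |A.trace|) : A.trace ^ 2 - 4 ≠ 0 := by
  have h := sq_abs A.trace
  nlinarith

lemma matOrd_dvd_chi (A : Matrix (Fin 2) (Fin 2) ℤ) (hA : A.det = 1)
    (p : ℕ) (hp : p.Prime) (hχ : chi (A.trace ^ 2 - 4) p ≠ 0) :
    (matOrd A p : ℤ) ∣ (p : ℤ) - chi (A.trace ^ 2 - 4) p := by
  haveI : Fact p.Prime := ⟨hp⟩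
  unfold chi at hχ ⊢
  split_ifs at hχ ⊢ with h
  · have hp2 : p ≠ 2 := by rintro rfl; omega
    obtain ⟨h1, h2⟩ := matOrd_dvd A hA p hp2
    rw [jacobiSym.legendreSym.to_jacobiSym] at h1 h2
    rcases jacobiSym.trichotomy (A.trace ^ 2 - 4) p with h0 | h0 | h0
    · exact absurd h0 hχ
    · have := h1 h0
      rw [h0]
      have e : ((p - 1 : ℕ) : ℤ) = (p : ℤ) - 1 := by
        rw [Nat.cast_sub hp.one_le]; simp
      rw [← e]; exact_mod_cast this
    · have := h2 h0
      rw [h0, sub_neg_eq_add]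
      exact_mod_cast this
  · exact absurd rfl hχ

end LO

namespace LO
open Finset Filter Topology ArithmeticFunction

lemma card_dvd_sub (d X : ℕ) (hd : 0 < d) (a : ℤ) :
    (((Icc 1 X).filter (fun n : ℕ => (d : ℤ) ∣ (n : ℤ) - a)).card : ℝ) ≤ (X : ℝ) / d + 1 := by
  have h : ((Icc 1 X).filter (fun n : ℕ => (d : ℤ) ∣ (n : ℤ) - a)).card ≤ (range (X / d + 1)).card := by
    apply card_le_card_of_injOn (fun n => n / d)
    · intro n hn
      have := mem_Icc.1 (mem_filter.1 (mem_coe.1 hn)).1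
      simp only [coe_range, Set.mem_Iio]
      exact Nat.lt_succ_of_le (Nat.div_le_div_right this.2)
    · intro m hm n hn hmn
      have h1 := (mem_filter.1 (mem_coe.1 hm)).2
      have h2 := (mem_filter.1 (mem_coe.1 hn)).2
      have h3 : (d : ℤ) ∣ (m : ℤ) - n := by
        have := dvd_sub h1 h2
        rwa [sub_sub_sub_cancel_right] at this
      have h4 : n % d = m % d := by
        have : (n : ℤ) ≡ m [ZMOD d] := (Int.modEq_iff_dvd).2 h3
        exact (Int.natCast_modEq_iff).1 this
      simp only at hmn
      rw [← Nat.div_add_mod m d, ← Nat.div_add_mod n d, hmn, h4]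
  rw [card_range] at h
  have h5 : ((X / d : ℕ) : ℝ) ≤ (X : ℝ) / d := Nat.cast_div_le
  have h6 : (((Icc 1 X).filter (fun n : ℕ => (d : ℤ) ∣ (n : ℤ) - a)).card : ℝ) ≤ ((X / d + 1 : ℕ) : ℝ) := by
    exact_mod_cast h
  push_cast at h6
  linarith

lemma TT_nonneg (χ : ℕ → ℤ) (X q : ℕ) : 0 ≤ TT χ X q :=
  sum_nonneg fun p _ => Real.log_natCast_nonneg p

lemma TT_le_theta (χ : ℕ → ℤ) (X q : ℕ) : TT χ X q ≤ Chebyshev.theta X := by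
  unfold TT Chebyshev.theta
  rw [Nat.floor_natCast]
  refine sum_le_sum_of_subset_of_nonneg ?_ (fun p _ _ => Real.log_natCast_nonneg p)
  intro p hp
  simp only [mem_filter, mem_Icc, mem_Ioc] at hp ⊢
  exact ⟨⟨by omega, by omega⟩, hp.2.1⟩

lemma TT_trivial {M : ℕ} {χ : ℕ → ℤ} (h : IsChi M χ) (X d : ℕ) (hX : 1 ≤ X) (hd : 0 < d)
    (hdX : d ≤ X + 1) : TT χ X d ≤ 6 * X * Real.log X / d := by
  have h1 : TT χ X d ≤ ∑ p ∈ (Icc 1 X).filter (fun n : ℕ => (d : ℤ) ∣ (n : ℤ) - 1) ∪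
      (Icc 1 X).filter (fun n : ℕ => (d : ℤ) ∣ (n : ℤ) - (-1)), Real.log X := by
    unfold TT
    refine (sum_le_sum (g := fun _ => Real.log X) fun p hp => ?_).trans
      (sum_le_sum_of_subset_of_nonneg ?_ fun p _ _ => Real.log_natCast_nonneg X)
    · have hp1 := mem_Icc.1 (mem_filter.1 hp).1
      exact Real.log_le_log (by exact_mod_cast hp1.1) (by exact_mod_cast hp1.2)
    · intro p hp
      obtain ⟨h1, h2, h3, h4⟩ := mem_filter.1 hp
      rw [mem_union, mem_filter, mem_filter]
      rcases h.val p with e | e | e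
      · left; rw [e] at h4; exact ⟨h1, h4⟩
      · right; rw [e] at h4; exact ⟨h1, h4⟩
      · exact absurd e h3
  refine h1.trans ?_
  rw [sum_const, nsmul_eq_mul]
  have hc := card_union_le ((Icc 1 X).filter (fun n : ℕ => (d : ℤ) ∣ (n : ℤ) - 1))
    ((Icc 1 X).filter (fun n : ℕ => (d : ℤ) ∣ (n : ℤ) - (-1)))
  have hc' : ((((Icc 1 X).filter (fun n : ℕ => (d : ℤ) ∣ (n : ℤ) - 1) ∪
      (Icc 1 X).filter (fun n : ℕ => (d : ℤ) ∣ (n : ℤ) - (-1))).card : ℕ) : ℝ) ≤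
      ((Icc 1 X).filter (fun n : ℕ => (d : ℤ) ∣ (n : ℤ) - 1)).card +
      ((Icc 1 X).filter (fun n : ℕ => (d : ℤ) ∣ (n : ℤ) - (-1))).card := by exact_mod_cast hc
  have a1 := card_dvd_sub d X hd 1
  have a2 := card_dvd_sub d X hd (-1)
  have hd0 : (0 : ℝ) < d := by exact_mod_cast hd
  have hdX' : (d : ℝ) ≤ X + 1 := by exact_mod_cast hdX
  have hX' : (1 : ℝ) ≤ X := by exact_mod_cast hX
  have a3 : (X : ℝ) / d + 1 ≤ 3 * X / d := by
    rw [div_add_one hd0.ne', div_le_div_iff_of_pos_right hd0]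
    linarith
  have a4 : 6 * X * Real.log X / d = (3 * X / d + 3 * X / d) * Real.log X := by ring
  rw [a4]
  exact mul_le_mul_of_nonneg_right (by linarith) (Real.log_natCast_nonneg X)

lemma summable_np : Summable fun n : ℕ => (if n.Prime then 0 else Λ n) / (n : ℝ) := by
  have h := ArithmeticFunction.vonMangoldt.summable_residueClass_non_primes_div (q := 1) 0
  refine h.congr fun n => ?_
  congr 2
  unfold vonMangoldt.residueClass
  rw [Set.indicator_of_mem]
  exact Subsingleton.elim _ _

lemma log_large (c : ℝ) : ∀ᶠ X : ℕ in atTop, c ≤ Real.log X :=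
  (Real.tendsto_log_atTop.comp tendsto_natCast_atTop_atTop).eventually_ge_atTop _

/-- contribution of finitely many moduli -/
lemma fin_part (χ : ℕ → ℤ) (s : Finset ℕ) (ε : ℝ) (hε : 0 < ε) :
    ∀ᶠ X : ℕ in atTop, ∑ d ∈ s, Λ d * TT χ X d ≤ ε * X * Real.log X := by
  filter_upwards [log_large ((∑ d ∈ s, Λ d) * Real.log 4 / ε)] with X hX
  rw [div_le_iff₀ hε] at hX
  have h1 : ∑ d ∈ s, Λ d * TT χ X d ≤ (∑ d ∈ s, Λ d) * (Real.log 4 * X) := by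
    rw [sum_mul]
    refine sum_le_sum fun d _ => mul_le_mul_of_nonneg_left ?_ vonMangoldt_nonneg
    exact (TT_le_theta χ X d).trans (Chebyshev.theta_le_log4_mul_x (Nat.cast_nonneg X))
  have h2 := mul_le_mul_of_nonneg_right hX (Nat.cast_nonneg (α := ℝ) X)
  linarith

/-- contribution of proper prime powers -/
lemma part_a {M : ℕ} {χ : ℕ → ℤ} (h : IsChi M χ) (ε : ℝ) (hε : 0 < ε) :
    ∀ᶠ X : ℕ in atTop, ∑ d ∈ (Icc 1 (X + 1)).filter (fun d => ¬ d.Prime), Λ d * TT χ X d ≤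
      ε * X * Real.log X := by
  obtain ⟨s, hs⟩ := summable_iff_vanishing_norm.1 summable_np (ε / 12) (by positivity)
  filter_upwards [fin_part χ s (ε / 2) (by positivity), eventually_ge_atTop 1] with X hX hX1
  set U := (Icc 1 (X + 1)).filter (fun d => ¬ d.Prime) with hU
  rw [← sum_inter_add_sum_sdiff U s]
  have h1 : ∑ d ∈ U ∩ s, Λ d * TT χ X d ≤ ε / 2 * X * Real.log X := by
    refine le_trans (sum_le_sum_of_subset_of_nonneg inter_subset_right fun d _ _ => ?_) hX
    exact mul_nonneg vonMangoldt_nonneg (TT_nonneg χ X d)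
  have h2 := (le_abs_self _).trans (hs (U \ s) sdiff_disjoint).le
  have h3 : ∑ d ∈ U \ s, Λ d * TT χ X d ≤
      ∑ d ∈ U \ s, (6 * X * Real.log X) * ((if d.Prime then 0 else Λ d) / (d : ℝ)) := by
    refine sum_le_sum fun d hd => ?_
    have hd1 := mem_filter.1 (mem_sdiff.1 hd).1
    have hd2 := mem_Icc.1 hd1.1
    rw [if_neg hd1.2]
    have := mul_le_mul_of_nonneg_left (TT_trivial h X d hX1 (by omega) hd2.2)
      (vonMangoldt_nonneg (n := d))
    refine this.trans (le_of_eq ?_)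
    ring
  rw [← mul_sum] at h3
  have h4 : 0 ≤ 6 * X * Real.log X := by
    have := Real.log_natCast_nonneg X
    positivity
  have h5 := mul_le_mul_of_nonneg_left h2 h4
  linarith

/-- moduli between `X^u` and `X^v`, by the Brun-Titchmarsh bound -/
lemma part_bd {M : ℕ} {χ : ℕ → ℤ} (h : IsChi M χ) (u v ε : ℝ) (hu : 0 ≤ u) (huv : u ≤ v) (hv0 : 0 < v) (hv : v < 1)
    (hε : 0 < ε) :
    ∀ᶠ X : ℕ in atTop, ∀ P : Finset ℕ,
      (∀ q ∈ P, q.Prime ∧ M < q ∧ (X : ℝ) ^ u < q ∧ (q : ℝ) ≤ (X : ℝ) ^ v) →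
      ∑ q ∈ P, Λ q * TT χ X q ≤ (2 / (1 - v) + ε) * (v - u + ε) * X * Real.log X := by
  obtain ⟨C, hC0, hC⟩ := mertens
  filter_upwards [Tq_bound h v ε hv hv0 hε, log_large (C / ε), eventually_ge_atTop 1] with X hT hX hX1 P hP
  have hX1' : (1 : ℝ) ≤ X := by exact_mod_cast hX1
  have hX0 : (0 : ℝ) < X := by linarith
  rw [div_le_iff₀ hε] at hX
  have h1 := hC ((X : ℝ) ^ u) ((X : ℝ) ^ v) (Real.one_le_rpow hX1' hu)
    (Real.rpow_le_rpow_of_exponent_le hX1' huv) P (fun q hq => ⟨(hP q hq).1, (hP q hq).2.2⟩)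
  rw [Real.log_rpow hX0, Real.log_rpow hX0] at h1
  have hv1 : 0 < 1 - v := by linarith
  have hK : 0 ≤ (2 / (1 - v) + ε) * X := by positivity
  calc ∑ q ∈ P, Λ q * TT χ X q ≤ ∑ q ∈ P, (2 / (1 - v) + ε) * X * (Real.log q / ((q : ℝ) - 1)) := by
        refine sum_le_sum fun q hq => ?_
        obtain ⟨a, b, c, d⟩ := hP q hq
        rw [vonMangoldt_apply_prime a]
        refine (mul_le_mul_of_nonneg_left (hT q a b d) (Real.log_natCast_nonneg q)).trans (le_of_eq ?_)
        ring
    _ = (2 / (1 - v) + ε) * X * ∑ q ∈ P, Real.log q / ((q : ℝ) - 1) := by rw [mul_sum]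
    _ ≤ (2 / (1 - v) + ε) * X * ((v - u + ε) * Real.log X) :=
        mul_le_mul_of_nonneg_left (by linarith) hK
    _ = _ := by ring

end LO

namespace LO
open Finset Filter Topology ArithmeticFunction

lemma ind_chi {M : ℕ} {χ : ℕ → ℤ} (h : IsChi M χ) (q n : ℕ) (hq : 1 < q) :
    (if χ n ≠ 0 ∧ (q : ℤ) ∣ (n : ℤ) - χ n then (1 : ℝ) else 0) ≤
      (((χ n : ℝ) ^ 2 * hh q 1 n + (χ n : ℝ) * hh q 1 n) +
       ((χ n : ℝ) ^ 2 * hh q (-1) n - (χ n : ℝ) * hh q (-1) n)) / 2 + 1 / ((q : ℝ) - 1) := by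
  have hq' : (1 : ℝ) < q := by exact_mod_cast hq
  have hE : (if q ∣ n then (0 : ℝ) else 1 / ((q : ℝ) - 1)) ≤ 1 / ((q : ℝ) - 1) := by
    have : 0 < (q : ℝ) - 1 := by linarith
    split_ifs
    · positivity
    · rfl
  have h0 : 0 < 1 / ((q : ℝ) - 1) := by
    have : 0 < (q : ℝ) - 1 := by linarith
    positivity
  unfold hh
  rcases h.val n with e | e | e <;> simp only [e] <;> push_cast
  · simp only [ne_eq, one_ne_zero, not_false_eq_true, true_and]
    linarith
  · simp only [ne_eq, neg_eq_zero, one_ne_zero, not_false_eq_true, true_and]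
    linarith
  · simp only [ne_eq, not_true_eq_false, false_and, if_false]
    linarith

lemma TT_le_bv {M : ℕ} {χ : ℕ → ℤ} (h : IsChi M χ) (q X : ℕ) (hq : 1 < q) :
    TT χ X q ≤ (|∑ n ∈ Ioc 0 X, Λ n * ((χ n : ℝ) ^ 2 * hh q 1 n)| +
      |∑ n ∈ Ioc 0 X, Λ n * ((χ n : ℝ) * hh q 1 n)| +
      |∑ n ∈ Ioc 0 X, Λ n * ((χ n : ℝ) ^ 2 * hh q (-1) n)| +
      |∑ n ∈ Ioc 0 X, Λ n * ((χ n : ℝ) * hh q (-1) n)|) / 2 + Chebyshev.psi X / ((q : ℝ) - 1) := by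
  have h1 : TT χ X q ≤ ∑ n ∈ Ioc 0 X, Λ n * (if χ n ≠ 0 ∧ (q : ℤ) ∣ (n : ℤ) - χ n then (1 : ℝ) else 0) := by
    unfold TT
    rw [sum_filter]
    have : Icc 1 X = Ioc 0 X := by ext; simp [Nat.lt_iff_add_one_le]
    rw [this]
    refine sum_le_sum fun n _ => ?_
    by_cases hp : n.Prime
    · simp only [hp, true_and]
      rw [vonMangoldt_apply_prime hp]
      split_ifs <;> simp
    · simp only [hp, false_and, if_false]
      have := vonMangoldt_nonneg (n := n)
      split_ifs <;> simp [this]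
  have h2 : ∑ n ∈ Ioc 0 X, Λ n * (if χ n ≠ 0 ∧ (q : ℤ) ∣ (n : ℤ) - χ n then (1 : ℝ) else 0) ≤
      ∑ n ∈ Ioc 0 X, Λ n * ((((χ n : ℝ) ^ 2 * hh q 1 n + (χ n : ℝ) * hh q 1 n) +
       ((χ n : ℝ) ^ 2 * hh q (-1) n - (χ n : ℝ) * hh q (-1) n)) / 2 + 1 / ((q : ℝ) - 1)) :=
    sum_le_sum fun n _ => mul_le_mul_of_nonneg_left (ind_chi h q n hq) vonMangoldt_nonneg
  have h3 : ∑ n ∈ Ioc 0 X, Λ n * ((((χ n : ℝ) ^ 2 * hh q 1 n + (χ n : ℝ) * hh q 1 n) +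
       ((χ n : ℝ) ^ 2 * hh q (-1) n - (χ n : ℝ) * hh q (-1) n)) / 2 + 1 / ((q : ℝ) - 1)) =
      (∑ n ∈ Ioc 0 X, Λ n * ((χ n : ℝ) ^ 2 * hh q 1 n) +
      ∑ n ∈ Ioc 0 X, Λ n * ((χ n : ℝ) * hh q 1 n) +
      ∑ n ∈ Ioc 0 X, Λ n * ((χ n : ℝ) ^ 2 * hh q (-1) n) -
      ∑ n ∈ Ioc 0 X, Λ n * ((χ n : ℝ) * hh q (-1) n)) / 2 + Chebyshev.psi X / ((q : ℝ) - 1) := by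
    unfold Chebyshev.psi
    rw [Nat.floor_natCast, ← sum_add_distrib, ← sum_add_distrib, ← sum_sub_distrib, sum_div, sum_div,
      ← sum_add_distrib]
    refine sum_congr rfl fun n _ => ?_
    ring
  rw [h3] at h2
  have a1 := le_abs_self (∑ n ∈ Ioc 0 X, Λ n * ((χ n : ℝ) ^ 2 * hh q 1 n))
  have a2 := le_abs_self (∑ n ∈ Ioc 0 X, Λ n * ((χ n : ℝ) * hh q 1 n))
  have a3 := le_abs_self (∑ n ∈ Ioc 0 X, Λ n * ((χ n : ℝ) ^ 2 * hh q (-1) n))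
  have a4 := neg_abs_le (∑ n ∈ Ioc 0 X, Λ n * ((χ n : ℝ) * hh q (-1) n))
  linarith

lemma psi_le_theta_add (ε : ℝ) (hε : 0 < ε) :
    ∀ᶠ X : ℕ in atTop, Chebyshev.psi X ≤ Chebyshev.theta X + ε * X := by
  have h1 := (isLittleO_log_rpow_atTop (by norm_num : (0 : ℝ) < 1 / 2)).comp_tendsto
      tendsto_natCast_atTop_atTop
  have h2 := h1.def (by positivity : 0 < ε / 2)
  filter_upwards [h2, eventually_ge_atTop 1] with X hX hX1
  have hX1' : (1 : ℝ) ≤ X := by exact_mod_cast hX1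
  have h3 := Chebyshev.psi_sub_theta_le hX1'
  simp only [Function.comp] at hX
  rw [Real.norm_of_nonneg (Real.log_natCast_nonneg X), Real.norm_of_nonneg (by positivity),
    ← Real.sqrt_eq_rpow] at hX
  have h4 := mul_le_mul_of_nonneg_left hX (Real.sqrt_nonneg X)
  have h5 := Real.mul_self_sqrt (Nat.cast_nonneg (α := ℝ) X)
  nlinarith

lemma part_c {M : ℕ} {χ : ℕ → ℤ} (h : IsChi M χ) (δ ε : ℝ) (hδ : 0 < δ) (hδ' : δ ≤ 1 / 10)
    (hε : 0 < ε) :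
    ∀ᶠ X : ℕ in atTop, ∀ P : Finset ℕ,
      (∀ q ∈ P, q.Prime ∧ (X : ℝ) ^ δ < q ∧ (q : ℝ) ≤ (X : ℝ) ^ (1 / 2 - δ)) →
      ∑ q ∈ P, Λ q * TT χ X q ≤ (1 / 2) * Chebyshev.theta X * Real.log X + ε * X * Real.log X := by
  obtain ⟨C, hC0, hC⟩ := mertens
  have hper : ∀ n, ((χ (n + M) : ℤ) : ℝ) = χ n := fun n => by rw [h.per]
  have hmul : ∀ m n, ((χ (m * n) : ℤ) : ℝ) = χ m * χ n := fun m n => by rw [h.mul]; push_cast; rfl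
  have hab : ∀ n, |((χ n : ℤ) : ℝ)| ≤ 1 := fun n => by
    rcases h.val n with e | e | e <;> simp [e]
  have hab2 : ∀ n, |((χ n : ℤ) : ℝ) ^ 2| ≤ 1 := fun n => by
    rcases h.val n with e | e | e <;> simp [e]
  have hε4 : 0 < ε / 4 := by positivity
  have b1 := bv M h.pos (fun n => (χ n : ℝ) ^ 2) hab2 (fun n => by simp only [hper])
    (fun m n => by simp only [hmul]; ring) 1 rfl δ (ε / 4) hδ hδ' hε4
  have b2 := bv M h.pos (fun n => (χ n : ℝ)) hab hper hmul 1 rfl δ (ε / 4) hδ hδ' hε4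
  have b3 := bv M h.pos (fun n => (χ n : ℝ) ^ 2) hab2 (fun n => by simp only [hper])
    (fun m n => by simp only [hmul]; ring) (-1) rfl δ (ε / 4) hδ hδ' hε4
  have b4 := bv M h.pos (fun n => (χ n : ℝ)) hab hper hmul (-1) rfl δ (ε / 4) hδ hδ' hε4
  filter_upwards [b1, b2, b3, b4, psi_le_theta_add (ε / 4) hε4, log_large (C / (2 * δ)), log_large 1,
    eventually_ge_atTop 1] with X c1 c2 c3 c4 hpsi hX hL1 hX1 P hP
  have hX1' : (1 : ℝ) ≤ X := by exact_mod_cast hX1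
  have hX0 : (0 : ℝ) < X := by linarith
  rw [div_le_iff₀ (by positivity)] at hX
  have hP' : ∀ q ∈ P, q.Prime ∧ (X : ℝ) ^ δ ≤ q ∧ (q : ℝ) ≤ (X : ℝ) ^ (1 / 2 - δ) :=
    fun q hq => ⟨(hP q hq).1, (hP q hq).2.1.le, (hP q hq).2.2⟩
  have d1 := c1 P hP'
  have d2 := c2 P hP'
  have d3 := c3 P hP'
  have d4 := c4 P hP'
  have h1 := hC ((X : ℝ) ^ δ) ((X : ℝ) ^ (1 / 2 - δ)) (Real.one_le_rpow hX1' hδ.le)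
    (Real.rpow_le_rpow_of_exponent_le hX1' (by linarith)) P hP
  rw [Real.log_rpow hX0, Real.log_rpow hX0] at h1
  have h2 : ∑ q ∈ P, Real.log q / ((q : ℝ) - 1) ≤ 1 / 2 * Real.log X := by linarith
  have hpsi0 : 0 ≤ Chebyshev.psi X := Chebyshev.psi_nonneg _
  have h3 := mul_le_mul_of_nonneg_left h2 hpsi0
  have h4 : ∑ q ∈ P, Λ q * TT χ X q ≤ (∑ q ∈ P, Real.log q * |∑ n ∈ Ioc 0 X, Λ n * ((χ n : ℝ) ^ 2 * hh q 1 n)| +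
      ∑ q ∈ P, Real.log q * |∑ n ∈ Ioc 0 X, Λ n * ((χ n : ℝ) * hh q 1 n)| +
      ∑ q ∈ P, Real.log q * |∑ n ∈ Ioc 0 X, Λ n * ((χ n : ℝ) ^ 2 * hh q (-1) n)| +
      ∑ q ∈ P, Real.log q * |∑ n ∈ Ioc 0 X, Λ n * ((χ n : ℝ) * hh q (-1) n)|) / 2 +
      Chebyshev.psi X * ∑ q ∈ P, Real.log q / ((q : ℝ) - 1) := by
    rw [← sum_add_distrib, ← sum_add_distrib, ← sum_add_distrib, sum_div, mul_sum, ← sum_add_distrib]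
    refine sum_le_sum fun q hq => ?_
    have hqp := (hP q hq).1
    rw [vonMangoldt_apply_prime hqp]
    refine (mul_le_mul_of_nonneg_left (TT_le_bv h q X hqp.one_lt) (Real.log_natCast_nonneg q)).trans
      (le_of_eq ?_)
    ring
  have hL0 : 0 ≤ Real.log X := by linarith
  have h5 := mul_le_mul_of_nonneg_right hpsi hL0
  have h6 : ε * X ≤ ε * X * Real.log X := by
    have : 0 ≤ ε * X := by positivity
    nlinarith
  have h7 : 0 ≤ ε * X * Real.log X := by positivity
  nlinarith

end LO

namespace LO
open Finset Filter Topology ArithmeticFunction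

/-- the primes up to `X` at which the character does not vanish -/
def SS (χ : ℕ → ℤ) (X : ℕ) : Finset ℕ := (Icc 1 X).filter (fun p => p.Prime ∧ χ p ≠ 0)

/-- the shifted prime `p - χ(p)` -/
def mm (χ : ℕ → ℤ) (p : ℕ) : ℕ := ((p : ℤ) - χ p).natAbs

lemma mm_bounds {M : ℕ} {χ : ℕ → ℤ} (h : IsChi M χ) (p : ℕ) (hp : p.Prime) :
    (mm χ p : ℤ) = p - χ p ∧ p ≤ 2 * mm χ p ∧ mm χ p ≤ p + 1 := by
  have := hp.two_le
  unfold mm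
  rcases h.val p with e | e | e <;> rw [e] <;> omega

lemma swap_sum {M : ℕ} {χ : ℕ → ℤ} (h : IsChi M χ) (X : ℕ) (R : ℕ → Prop) [DecidablePred R] :
    ∑ d ∈ (Icc 1 (X + 1)).filter R, Λ d * TT χ X d =
      ∑ p ∈ SS χ X, Real.log p * ∑ d ∈ (mm χ p).divisors.filter R, Λ d := by
  have h1 : ∀ d, TT χ X d = ∑ p ∈ SS χ X, if d ∣ mm χ p then Real.log p else 0 := by
    intro d
    unfold TT SS mm
    rw [← sum_filter, filter_filter]
    refine sum_congr (filter_congr fun p _ => ?_) fun _ _ => rfl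
    rw [Int.natCast_dvd, and_assoc]
  simp_rw [h1, mul_sum]
  rw [sum_comm]
  refine sum_congr rfl fun p hp => ?_
  have hp' := (mem_filter.1 hp)
  have hb := mm_bounds h p hp'.2.1
  have hpX := (mem_Icc.1 hp'.1).2
  have hp2 := hp'.2.1.two_le
  have e : (mm χ p).divisors.filter R = ((Icc 1 (X + 1)).filter R).filter (fun d => d ∣ mm χ p) := by
    ext d
    simp only [mem_filter, Nat.mem_divisors, mem_Icc]
    constructor
    · rintro ⟨⟨h1, h2⟩, h3⟩
      have := Nat.le_of_dvd (by omega) h1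
      have := Nat.pos_of_dvd_of_pos h1 (by omega)
      exact ⟨⟨⟨by omega, by omega⟩, h3⟩, h1⟩
    · rintro ⟨⟨_, h3⟩, h1⟩
      exact ⟨⟨h1, by omega⟩, h3⟩
  rw [e, sum_filter (p := fun d => d ∣ mm χ p)]
  refine sum_congr rfl fun d _ => ?_
  split_ifs <;> ring

lemma lower {M : ℕ} {χ : ℕ → ℤ} (h : IsChi M χ) (t : ℝ) (ht : 0 < t) (ht1 : t < 1) :
    ∀ᶠ X : ℕ in atTop, (1 - t) * Chebyshev.theta X * Real.log X - t * X * Real.log X ≤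
      ∑ d ∈ Icc 1 (X + 1), Λ d * TT χ X d := by
  set KM := ∑ p ∈ M.primeFactors, Real.log p with hKM
  have hK0 : 0 ≤ KM := sum_nonneg fun p _ => Real.log_natCast_nonneg p
  have hpow : ∀ᶠ X : ℕ in atTop, 4 * Real.log 4 / t ≤ (X : ℝ) ^ t :=
    ((tendsto_rpow_atTop ht).comp tendsto_natCast_atTop_atTop).eventually_ge_atTop _
  have hlin : ∀ᶠ X : ℕ in atTop, 4 * KM / t ≤ (X : ℝ) :=
    tendsto_natCast_atTop_atTop.eventually_ge_atTop _
  filter_upwards [hpow, hlin, log_large (4 * Real.log 2 * Real.log 4 / t), eventually_ge_atTop 1]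
    with X e1 e2 e3 hX1
  have hX1' : (1 : ℝ) ≤ X := by exact_mod_cast hX1
  have hX0 : (0 : ℝ) < X := by linarith
  have hL0 := Real.log_natCast_nonneg X
  rw [div_le_iff₀ ht] at e1 e2 e3
  set L := Real.log X with hL
  have hsw := swap_sum h X (fun _ => True)
  simp only [filter_true, vonMangoldt_sum] at hsw
  rw [hsw]
  set Y := (X : ℝ) ^ (1 - t) with hY
  have hY0 : 0 < Y := by positivity
  have hYt : Y * (X : ℝ) ^ t = X := by
    rw [hY, ← Real.rpow_add hX0, sub_add_cancel, Real.rpow_one]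
  have hl2 : 0 < Real.log 2 := Real.log_pos (by norm_num)
  have hl4 : 0 < Real.log 4 := Real.log_pos (by norm_num)
  -- pointwise bound
  have hpt : ∀ p ∈ SS χ X, Real.log p * ((1 - t) * L - Real.log 2) -
      (if (p : ℝ) ≤ Y then Real.log p * L else 0) ≤ Real.log p * Real.log (mm χ p) := by
    intro p hp
    have hp' := mem_filter.1 hp
    have hb := mm_bounds h p hp'.2.1
    have hp2 := hp'.2.1.two_le
    have hlp := Real.log_natCast_nonneg p
    have hm1 : 1 ≤ mm χ p := by omega
    split_ifs with hpY
    · have : 0 ≤ Real.log p * Real.log (mm χ p) := mul_nonneg hlp (Real.log_natCast_nonneg _)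
      have h2 : (1 - t) * L - Real.log 2 ≤ L := by nlinarith
      have := mul_le_mul_of_nonneg_left h2 hlp
      linarith
    · rw [sub_zero]
      apply mul_le_mul_of_nonneg_left _ hlp
      push Not at hpY
      have h1 : (1 - t) * L ≤ Real.log p := by
        rw [hL, ← Real.log_rpow hX0]
        exact Real.log_le_log hY0 hpY.le
      have h2 : Real.log p ≤ Real.log 2 + Real.log (mm χ p) := by
        rw [← Real.log_mul (by norm_num) (by exact_mod_cast (by omega : mm χ p ≠ 0))]
        exact Real.log_le_log (by exact_mod_cast hp'.2.1.pos) (by exact_mod_cast hb.2.1)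
      linarith
  refine le_trans ?_ (sum_le_sum hpt)
  rw [sum_sub_distrib, ← sum_mul]
  have hth : Chebyshev.theta X ≤ ∑ p ∈ SS χ X, Real.log p + KM := by
    unfold Chebyshev.theta SS
    rw [Nat.floor_natCast]
    have hsub : (Ioc 0 X).filter Nat.Prime ⊆
        (Icc 1 X).filter (fun p => p.Prime ∧ χ p ≠ 0) ∪ M.primeFactors := by
      intro p hp
      obtain ⟨h1, h2⟩ := mem_filter.1 hp
      have := mem_Ioc.1 h1
      rw [mem_union, mem_filter, mem_Icc]
      by_cases hc : χ p = 0
      · right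
        have := (not_congr (h.cop p)).1 (not_not.2 hc)
        rw [h2.coprime_iff_not_dvd, not_not] at this
        exact Nat.mem_primeFactors.2 ⟨h2, this, h.pos.ne'⟩
      · left
        exact ⟨⟨by omega, by omega⟩, h2, hc⟩
    refine (sum_le_sum_of_subset_of_nonneg hsub fun p _ _ => Real.log_natCast_nonneg p).trans ?_
    rw [hKM, ← sum_union_inter]
    have : 0 ≤ ∑ p ∈ (Icc 1 X).filter (fun p => p.Prime ∧ χ p ≠ 0) ∩ M.primeFactors, Real.log (p : ℝ) :=
      sum_nonneg fun p _ => Real.log_natCast_nonneg p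
    linarith
  have hth2 : ∑ p ∈ SS χ X, Real.log p ≤ Chebyshev.theta X := by
    unfold Chebyshev.theta SS
    rw [Nat.floor_natCast]
    refine sum_le_sum_of_subset_of_nonneg ?_ fun p _ _ => Real.log_natCast_nonneg p
    intro p hp
    simp only [mem_filter, mem_Icc, mem_Ioc] at hp ⊢
    exact ⟨⟨by omega, by omega⟩, hp.2.1⟩
  have hsmall : ∑ p ∈ SS χ X, (if (p : ℝ) ≤ Y then Real.log p * L else 0) ≤ Real.log 4 * Y * L := by
    rw [← sum_filter, ← sum_mul]
    apply mul_le_mul_of_nonneg_right _ hL0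
    refine le_trans ?_ (Chebyshev.theta_le_log4_mul_x hY0.le)
    unfold Chebyshev.theta SS
    refine sum_le_sum_of_subset_of_nonneg ?_ fun p _ _ => Real.log_natCast_nonneg p
    intro p hp
    simp only [mem_filter, mem_Icc, mem_Ioc] at hp ⊢
    exact ⟨⟨by omega, Nat.le_floor hp.2⟩, hp.1.2.1⟩
  have hthX := Chebyshev.theta_le_log4_mul_x hX0.le
  set σ := ∑ p ∈ SS χ X, Real.log p with hσ
  set T := Chebyshev.theta X with hT
  -- bound each error term by (t/4) X L
  have g1 : Real.log 4 * Y ≤ t / 4 * X := by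
    have := mul_le_mul_of_nonneg_left e1 hY0.le
    nlinarith
  have g1' := mul_le_mul_of_nonneg_right g1 hL0
  have g2 : KM ≤ t / 4 * X := by linarith
  have g2' := mul_le_mul_of_nonneg_right g2 hL0
  have g3 : σ * Real.log 2 ≤ t / 4 * X * L := by
    have a1 : σ * Real.log 2 ≤ Real.log 4 * X * Real.log 2 :=
      mul_le_mul_of_nonneg_right (hth2.trans hthX) hl2.le
    have a2 := mul_le_mul_of_nonneg_right e3 hX0.le
    linarith
  have g4 : (1 - t) * L * T ≤ (1 - t) * L * (σ + KM) :=
    mul_le_mul_of_nonneg_left hth (mul_nonneg (by linarith) hL0)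
  have g5 : 0 ≤ t * L * KM := by positivity
  have g6 : 0 ≤ t * X * L := by positivity
  nlinarith


open Classical in
lemma part_e {M : ℕ} {χ : ℕ → ℤ} (h : IsChi M χ) (X : ℕ) (v : ℝ) :
    ∑ d ∈ (Icc 1 (X + 1)).filter (fun q : ℕ => q.Prime ∧ (X : ℝ) ^ v < q), Λ d * TT χ X d ≤
      (((SS χ X).filter (fun p => ∃ q : ℕ, q.Prime ∧ (X : ℝ) ^ v < q ∧ q ∣ mm χ p)).card : ℝ) *
        (Real.log X * Real.log ((X : ℝ) + 1)) := by
  rw [swap_sum h, ← nsmul_eq_mul, ← sum_const, sum_filter]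
  refine sum_le_sum fun p hp => ?_
  have hp' := mem_filter.1 hp
  have hb := mm_bounds h p hp'.2.1
  have hpX := mem_Icc.1 hp'.1
  have hp2 := hp'.2.1.two_le
  split_ifs with hq
  · have h1 : Real.log p ≤ Real.log X :=
      Real.log_le_log (by exact_mod_cast hpX.1) (by exact_mod_cast hpX.2)
    have h2 : ∑ d ∈ (mm χ p).divisors.filter (fun q : ℕ => q.Prime ∧ (X : ℝ) ^ v < q), Λ d ≤
        Real.log ((X : ℝ) + 1) := by
      calc _ ≤ ∑ d ∈ (mm χ p).divisors, Λ d :=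
            sum_le_sum_of_subset_of_nonneg (filter_subset _ _) fun _ _ _ => vonMangoldt_nonneg
        _ = Real.log (mm χ p) := vonMangoldt_sum
        _ ≤ _ := Real.log_le_log (by exact_mod_cast (by omega : 0 < mm χ p))
            (by exact_mod_cast (by omega : mm χ p ≤ X + 1))
    exact mul_le_mul h1 h2 (sum_nonneg fun _ _ => vonMangoldt_nonneg) (Real.log_natCast_nonneg X)
  · have : (mm χ p).divisors.filter (fun q : ℕ => q.Prime ∧ (X : ℝ) ^ v < q) = ∅ := by
      rw [filter_eq_empty_iff]
      intro q hq1 hq2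
      exact hq ⟨q, hq2.1, hq2.2, Nat.dvd_of_mem_divisors hq1⟩
    rw [this]; simp

end LO

namespace LO
open Finset Filter Topology ArithmeticFunction

lemma cover (s : Finset ℕ) (f : ℕ → ℝ) (hf : ∀ d, 0 ≤ f d) (p1 p2 p3 p4 p5 p6 : ℕ → Prop)
    [DecidablePred p1] [DecidablePred p2] [DecidablePred p3] [DecidablePred p4] [DecidablePred p5]
    [DecidablePred p6]
    (h : ∀ d ∈ s, p1 d ∨ p2 d ∨ p3 d ∨ p4 d ∨ p5 d ∨ p6 d) :
    ∑ d ∈ s, f d ≤ ∑ d ∈ s.filter p1, f d + ∑ d ∈ s.filter p2, f d + ∑ d ∈ s.filter p3, f d +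
      ∑ d ∈ s.filter p4, f d + ∑ d ∈ s.filter p5, f d + ∑ d ∈ s.filter p6, f d := by
  simp only [sum_filter, ← sum_add_distrib]
  refine sum_le_sum fun d hd => ?_
  have hn : ∀ (p : ℕ → Prop) [DecidablePred p], 0 ≤ if p d then f d else 0 := fun p _ => by
    have := hf d
    split_ifs <;> linarith
  have n1 := hn p1
  have n2 := hn p2
  have n3 := hn p3
  have n4 := hn p4
  have n5 := hn p5
  have n6 := hn p6
  have hp : ∀ (p : ℕ → Prop) [DecidablePred p], p d → f d = if p d then f d else 0 := fun p _ hp => by rw [if_pos hp]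
  rcases h d hd with h | h | h | h | h | h <;> have := hp _ h <;> linarith

open Classical in
lemma key {M : ℕ} {χ : ℕ → ℤ} (h : IsChi M χ) (v t : ℝ) (hv : 1 / 2 < v) (hv1 : v < 1)
    (ht : 0 < t) (ht1 : t ≤ 1 / 10) :
    ∀ᶠ X : ℕ in atTop, (1 / 2 - t) * Chebyshev.theta X * Real.log X -
      (4 * t + (2 / (1 - t) + t) * (2 * t) + (2 / (1 - v) + t) * (v - 1 / 2 + 2 * t)) * X * Real.log X ≤
      (((SS χ X).filter (fun p => ∃ q : ℕ, q.Prime ∧ (X : ℝ) ^ v < q ∧ q ∣ mm χ p)).card : ℝ) *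
        (Real.log X * Real.log ((X : ℝ) + 1)) := by
  have hM : ∀ᶠ X : ℕ in atTop, (M : ℝ) ≤ (X : ℝ) ^ (1 / 2 - t) :=
    ((tendsto_rpow_atTop (by linarith : 0 < 1 / 2 - t)).comp
      tendsto_natCast_atTop_atTop).eventually_ge_atTop _
  filter_upwards [hM, lower h t ht (by linarith), part_a h t ht, fin_part χ (range (M + 1)) t ht,
    part_bd h 0 t t le_rfl ht.le ht (by linarith) ht, part_c h t t ht ht1 ht,
    part_bd h (1 / 2 - t) v t (by linarith) (by linarith) (by linarith) hv1 ht]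
    with X hXM hlow ha hfin hb hc hd
  have he := part_e h X v
  have hf : ∀ d, 0 ≤ Λ d * TT χ X d := fun d => mul_nonneg vonMangoldt_nonneg (TT_nonneg χ X d)
  have hcov := cover (Icc 1 (X + 1)) (fun d => Λ d * TT χ X d) hf (fun d => ¬ d.Prime)
    (fun d => d.Prime ∧ d ≤ M) (fun d => d.Prime ∧ M < d ∧ (d : ℝ) ≤ (X : ℝ) ^ t)
    (fun d => d.Prime ∧ (X : ℝ) ^ t < d ∧ (d : ℝ) ≤ (X : ℝ) ^ (1 / 2 - t))
    (fun d => d.Prime ∧ (X : ℝ) ^ (1 / 2 - t) < d ∧ (d : ℝ) ≤ (X : ℝ) ^ v)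
    (fun d => d.Prime ∧ (X : ℝ) ^ v < d) (by
      intro d _
      by_cases h1 : d.Prime
      swap
      · exact Or.inl h1
      by_cases h2 : d ≤ M
      · exact Or.inr (Or.inl ⟨h1, h2⟩)
      by_cases h3 : (d : ℝ) ≤ (X : ℝ) ^ t
      · exact Or.inr (Or.inr (Or.inl ⟨h1, not_le.1 h2, h3⟩))
      by_cases h4 : (d : ℝ) ≤ (X : ℝ) ^ (1 / 2 - t)
      · exact Or.inr (Or.inr (Or.inr (Or.inl ⟨h1, not_le.1 h3, h4⟩)))
      by_cases h5 : (d : ℝ) ≤ (X : ℝ) ^ v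
      · exact Or.inr (Or.inr (Or.inr (Or.inr (Or.inl ⟨h1, not_le.1 h4, h5⟩))))
      · exact Or.inr (Or.inr (Or.inr (Or.inr (Or.inr ⟨h1, not_le.1 h5⟩)))))
  have ga : ∑ d ∈ (Icc 1 (X + 1)).filter (fun d => ¬ d.Prime), Λ d * TT χ X d ≤ t * X * Real.log X := by
    convert ha
  have gf : ∑ d ∈ (Icc 1 (X + 1)).filter (fun d => d.Prime ∧ d ≤ M), Λ d * TT χ X d ≤
      t * X * Real.log X := by
    refine le_trans (sum_le_sum_of_subset_of_nonneg ?_ fun d _ _ => hf d) hfin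
    intro d hd
    have := (mem_filter.1 hd).2.2
    rw [mem_range]; omega
  have gb := hb ((Icc 1 (X + 1)).filter (fun d : ℕ => d.Prime ∧ M < d ∧ (d : ℝ) ≤ (X : ℝ) ^ t)) (by
    intro q hq
    obtain ⟨h1, h2, h3⟩ := (mem_filter.1 hq).2
    refine ⟨h1, h2, ?_, h3⟩
    rw [Real.rpow_zero]; exact_mod_cast h1.one_lt)
  have gc := hc ((Icc 1 (X + 1)).filter
    (fun d : ℕ => d.Prime ∧ (X : ℝ) ^ t < d ∧ (d : ℝ) ≤ (X : ℝ) ^ (1 / 2 - t)))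
    (fun q hq => (mem_filter.1 hq).2)
  have gd := hd ((Icc 1 (X + 1)).filter
    (fun d : ℕ => d.Prime ∧ (X : ℝ) ^ (1 / 2 - t) < d ∧ (d : ℝ) ≤ (X : ℝ) ^ v)) (by
    intro q hq
    obtain ⟨h1, h2, h3⟩ := (mem_filter.1 hq).2
    exact ⟨h1, by exact_mod_cast hXM.trans_lt h2, h2, h3⟩)
  have e1 : (2 / (1 - t) + t) * (t - 0 + t) = (2 / (1 - t) + t) * (2 * t) := by ring
  have e2 : (2 / (1 - v) + t) * (v - (1 / 2 - t) + t) = (2 / (1 - v) + t) * (v - 1 / 2 + 2 * t) := by ring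
  rw [e1] at gb
  rw [e2] at gd
  linarith

end LO

namespace LO
open Finset Filter Topology ArithmeticFunction

open Classical in
lemma count_split (A : Matrix (Fin 2) (Fin 2) ℤ) (hA : A.det = 1) (htr : 2 < |A.trace|) :
    ∃ C : ℕ, ∀ (X : ℕ) (v : ℝ), 1 ≤ X → v < 1 →
      (((SS (chi (A.trace ^ 2 - 4)) X).filter (fun p => ∃ q : ℕ, q.Prime ∧ (X : ℝ) ^ v < q ∧
        q ∣ mm (chi (A.trace ^ 2 - 4)) p)).card : ℝ) ≤
      (((Icc 1 X).filter (fun p => p.Prime ∧ (X : ℝ) ^ v < matOrd A p)).card : ℝ) +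
        C * (2 * (X : ℝ) ^ (1 - v)) ^ 2 := by
  obtain ⟨C, hC⟩ := small_order_count A hA htr
  refine ⟨C, fun X v hX hv => ?_⟩
  set χ := chi (A.trace ^ 2 - 4) with hχ
  have hchi : IsChi _ χ := chi_isChi _ (trace_sq_ne A htr)
  have hX0 : (0 : ℝ) < X := by exact_mod_cast hX
  have hX1 : (1 : ℝ) ≤ X := by exact_mod_cast hX
  set N' := (SS χ X).filter (fun p => ∃ q : ℕ, q.Prime ∧ (X : ℝ) ^ v < q ∧ q ∣ mm χ p) with hN'
  set y := ⌊2 * (X : ℝ) ^ (1 - v)⌋₊ with hy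
  set T := N'.filter (fun p => (matOrd A p : ℝ) ≤ (X : ℝ) ^ v) with hT
  have hcard := hC y T (by
    intro p hp
    obtain ⟨hp1, hpo⟩ := mem_filter.1 hp
    obtain ⟨hp2, q, hq, hqX, hqm⟩ := mem_filter.1 hp1
    obtain ⟨hp3, hpp, hpχ⟩ := mem_filter.1 hp2
    have hpX := (mem_Icc.1 hp3).2
    have hb := mm_bounds hchi p hpp
    have h2 := hpp.two_le
    have hdvd : matOrd A p ∣ mm χ p := by
      have := matOrd_dvd_chi A hA p hpp hpχ
      rw [← hχ, ← hb.1] at this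
      exact_mod_cast this
    have hm0 : 0 < mm χ p := by omega
    have hpos : 0 < matOrd A p := Nat.pos_of_dvd_of_pos hdvd hm0
    refine ⟨hpp, hpos, ?_⟩
    have hlt : matOrd A p < q := by exact_mod_cast hpo.trans_lt hqX
    have hco : (matOrd A p).Coprime q := by
      rw [Nat.coprime_comm, hq.coprime_iff_not_dvd]
      intro hd
      have := Nat.le_of_dvd hpos hd
      omega
    obtain ⟨k, hk⟩ := hqm
    rw [hk] at hdvd
    have hd2 : matOrd A p ∣ k := hco.dvd_of_dvd_mul_left hdvd
    have hk0 : 0 < k := by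
      rcases Nat.eq_zero_or_pos k with e | e
      · rw [e, mul_zero] at hk; omega
      · exact e
    refine (Nat.le_of_dvd hk0 hd2).trans (Nat.le_floor ?_)
    have h3 : (q : ℝ) * k ≤ 2 * X := by
      have : q * k ≤ 2 * X := by omega
      exact_mod_cast this
    have h4 : (X : ℝ) ^ v * k ≤ 2 * X :=
      le_trans (mul_le_mul_of_nonneg_right hqX.le (Nat.cast_nonneg k)) h3
    have h5 : (0 : ℝ) < (X : ℝ) ^ v := by positivity
    rw [Real.rpow_sub hX0, Real.rpow_one, mul_div_assoc', le_div_iff₀ h5]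
    linarith)
  have hsub : N' ⊆ (Icc 1 X).filter (fun p => p.Prime ∧ (X : ℝ) ^ v < matOrd A p) ∪ T := by
    intro p hp
    rw [mem_union]
    by_cases hc : (matOrd A p : ℝ) ≤ (X : ℝ) ^ v
    · right; exact mem_filter.2 ⟨hp, hc⟩
    · left
      have := mem_filter.1 (mem_filter.1 hp).1
      exact mem_filter.2 ⟨this.1, this.2.1, not_le.1 hc⟩
  have h1 := (card_le_card hsub).trans (card_union_le _ _)
  have h2 : (N'.card : ℝ) ≤ ((Icc 1 X).filter (fun p => p.Prime ∧ (X : ℝ) ^ v < matOrd A p)).card + T.card := by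
    exact_mod_cast h1
  have h3 : (T.card : ℝ) ≤ C * (y : ℝ) ^ 2 := by exact_mod_cast hcard
  have h4 : (y : ℝ) ≤ 2 * (X : ℝ) ^ (1 - v) := Nat.floor_le (by positivity)
  have h5 : (C : ℝ) * (y : ℝ) ^ 2 ≤ C * (2 * (X : ℝ) ^ (1 - v)) ^ 2 :=
    mul_le_mul_of_nonneg_left (pow_le_pow_left₀ (Nat.cast_nonneg y) h4 2) (Nat.cast_nonneg C)
  linarith

lemma theta_lower (t : ℝ) (ht : 0 < t) (ht1 : t < 1) :
    ∀ᶠ X : ℕ in atTop, (1 - t) * X ≤ Chebyshev.theta X := by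
  have h1 := tendsto_natCast_atTop_atTop (R := ℝ) |>.eventually (psi_lower (t / 2) (by positivity) (by linarith))
  filter_upwards [h1, psi_le_theta_add (t / 2) (by positivity)] with X a b
  linarith

lemma pi_upper (t : ℝ) (ht : 0 < t) :
    ∀ᶠ X : ℕ in atTop, (Nat.primeCounting X : ℝ) * Real.log X ≤ (1 + t) * Chebyshev.theta X := by
  obtain ⟨C, hC⟩ := Chebyshev.primeCounting_sub_theta_div_log_isBigO.bound
  have h1 := tendsto_natCast_atTop_atTop (R := ℝ) |>.eventually hC
  filter_upwards [h1, theta_lower (1 / 2) (by norm_num) (by norm_num), log_large (2 * |C| / t), log_large 1]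
    with X a b c d
  rw [Nat.floor_natCast] at a
  have hL : 0 < Real.log X := by linarith
  have hX : (0 : ℝ) ≤ X := Nat.cast_nonneg X
  rw [Real.norm_of_nonneg (by positivity : 0 ≤ (X : ℝ) / Real.log X ^ 2)] at a
  have a1 := (le_abs_self _).trans a
  have a2 : C * ((X : ℝ) / Real.log X ^ 2) ≤ |C| * ((X : ℝ) / Real.log X ^ 2) :=
    mul_le_mul_of_nonneg_right (le_abs_self C) (by positivity)
  have a3 := mul_le_mul_of_nonneg_right (a1.trans a2) hL.le
  have a4 : (Nat.primeCounting X - Chebyshev.theta X / Real.log X) * Real.log X =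
      Nat.primeCounting X * Real.log X - Chebyshev.theta X := by field_simp
  have a5 : |C| * ((X : ℝ) / Real.log X ^ 2) * Real.log X = |C| * X / Real.log X := by field_simp
  rw [a4, a5] at a3
  rw [div_le_iff₀ ht] at c
  have a6 : |C| * X / Real.log X ≤ t * Chebyshev.theta X := by
    rw [div_le_iff₀ hL]
    have e1 : t * ((1 / 2) * X) ≤ t * Chebyshev.theta X :=
      mul_le_mul_of_nonneg_left (by linarith) ht.le
    have e2 := mul_le_mul_of_nonneg_right e1 hL.le
    have e3 := mul_le_mul_of_nonneg_right c hX
    linarith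
  linarith

lemma small_pi (K ε v : ℝ) (hv : 1 / 2 < v) (hv1 : v < 1) (hK : 0 ≤ K) (hε : 0 < ε) :
    ∀ᶠ X : ℕ in atTop, K * (2 * (X : ℝ) ^ (1 - v)) ^ 2 ≤ ε * Nat.primeCounting X := by
  have h1 := (isLittleO_log_rpow_atTop (by linarith : (0 : ℝ) < 2 * v - 1)).comp_tendsto
      tendsto_natCast_atTop_atTop
  have h2 := h1.def (by positivity : 0 < ε / (8 * (K + 1)))
  filter_upwards [h2, theta_lower (1 / 2) (by norm_num) (by norm_num), log_large 1, eventually_ge_atTop 1]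
    with X a b d hX1
  have hX0 : (0 : ℝ) < X := by exact_mod_cast hX1
  simp only [Function.comp] at a
  have hL : 0 < Real.log X := by linarith
  rw [Real.norm_of_nonneg hL.le, Real.norm_of_nonneg (by positivity)] at a
  have hpi := Chebyshev.theta_le_pi_mul_log X
  have e1 : (X : ℝ) ^ (2 * v - 1) * ((X : ℝ) ^ (1 - v)) ^ 2 = X := by
    rw [← Real.rpow_natCast, ← Real.rpow_mul hX0.le, ← Real.rpow_add hX0]
    norm_num
    ring_nf
    simp
  set W := ((X : ℝ) ^ (1 - v)) ^ 2 with hW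
  have hW0 : 0 < W := by positivity
  rw [div_mul_eq_mul_div, le_div_iff₀ (by positivity)] at a
  have e2 := mul_le_mul_of_nonneg_right a hW0.le
  have e3 : K * (2 * (X : ℝ) ^ (1 - v)) ^ 2 = 4 * K * W := by rw [hW]; ring
  rw [e3]
  have e4 : 4 * K * W * Real.log X ≤ ε * Nat.primeCounting X * Real.log X := by
    have f1 : ε * ((1 / 2) * X) ≤ ε * (Nat.primeCounting X * Real.log X) :=
      mul_le_mul_of_nonneg_left (by linarith) hε.le
    have f2 : 0 ≤ W * Real.log X := by positivity
    nlinarith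
  exact le_of_mul_le_mul_right e4 hL

lemma log_succ (t : ℝ) (ht : 0 < t) : ∀ᶠ X : ℕ in atTop, Real.log ((X : ℝ) + 1) ≤ (1 + t) * Real.log X := by
  filter_upwards [log_large (Real.log 2 / t), eventually_ge_atTop 1] with X a hX1
  have hX1' : (1 : ℝ) ≤ X := by exact_mod_cast hX1
  rw [div_le_iff₀ ht] at a
  have h1 : Real.log ((X : ℝ) + 1) ≤ Real.log (2 * X) := Real.log_le_log (by linarith) (by linarith)
  rw [Real.log_mul (by norm_num) (by linarith)] at h1
  linarith

end LO

namespace LO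
open Finset Filter Topology ArithmeticFunction

/-- the final constant -/
lemma exists_t (v ε : ℝ) (hv1 : v < 1) (hε : 0 < ε) :
    ∃ t : ℝ, 0 < t ∧ t ≤ 1 / 10 ∧ (3 - 5 * v) / (2 * (1 - v)) - ε <
      (1 / 2 - t - (4 * t + (2 / (1 - t) + t) * (2 * t) + (2 / (1 - v) + t) * (v - 1 / 2 + 2 * t)) / (1 - t)) /
        (1 + t) ^ 2 := by
  have hv0 : (1 - v) ≠ 0 := by linarith
  have hcont : ContinuousAt (fun t : ℝ => (1 / 2 - t - (4 * t + (2 / (1 - t) + t) * (2 * t) +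
      (2 / (1 - v) + t) * (v - 1 / 2 + 2 * t)) / (1 - t)) / (1 + t) ^ 2) 0 := by
    have h1 : ContinuousAt (fun t : ℝ => 1 - t) 0 := by fun_prop
    have h2 : ContinuousAt (fun t : ℝ => 2 / (1 - t)) 0 := ContinuousAt.div (by fun_prop) h1 (by norm_num)
    refine ContinuousAt.div ?_ (by fun_prop) (by norm_num)
    refine ContinuousAt.sub (by fun_prop) (ContinuousAt.div ?_ h1 (by norm_num))
    fun_prop
  have hval : (3 - 5 * v) / (2 * (1 - v)) - ε < (1 / 2 - 0 - (4 * 0 + (2 / (1 - 0) + 0) * (2 * 0) +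
      (2 / (1 - v) + 0) * (v - 1 / 2 + 2 * 0)) / (1 - 0)) / (1 + 0) ^ 2 := by
    have : (3 - 5 * v) / (2 * (1 - v)) = (1 / 2 - 0 - (4 * 0 + (2 / (1 - 0) + 0) * (2 * 0) +
      (2 / (1 - v) + 0) * (v - 1 / 2 + 2 * 0)) / (1 - 0)) / (1 + 0) ^ 2 := by
      field_simp
      ring
    linarith
  have hev := hcont.eventually (lt_mem_nhds hval)
  have hev2 : ∀ᶠ t : ℝ in 𝓝 0, t < 1 / 10 := gt_mem_nhds (by norm_num)
  have hev3 := (hev.and hev2).filter_mono (nhdsWithin_le_nhds (s := Set.Ioi 0))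
  obtain ⟨t, ⟨h1, h2⟩, h3⟩ := (hev3.and self_mem_nhdsWithin).exists
  exact ⟨t, h3, h2.le, h1⟩

open Classical in
lemma main_nat (A : Matrix (Fin 2) (Fin 2) ℤ) (hA : A.det = 1) (htr : 2 < |A.trace|)
    (v ε : ℝ) (hv : 1 / 2 < v) (hv1 : v < 1) (hε : 0 < ε) :
    ∀ᶠ X : ℕ in atTop, ((3 - 5 * v) / (2 * (1 - v)) - ε) * Nat.primeCounting X ≤
      (((Icc 1 X).filter (fun p => p.Prime ∧ (X : ℝ) ^ v < matOrd A p)).card : ℝ) := by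
  obtain ⟨t, ht, ht1, hG⟩ := exists_t v (ε / 2) hv1 (by positivity)
  obtain ⟨C, hC⟩ := count_split A hA htr
  have hchi := chi_isChi _ (trace_sq_ne A htr)
  filter_upwards [key hchi v t hv hv1 ht ht1, theta_lower t ht (by linarith), pi_upper t ht,
    small_pi C (ε / 2) v hv hv1 (Nat.cast_nonneg C) (by positivity), log_succ t ht, log_large 1,
    eventually_ge_atTop 1] with X h1 h2 h3 h4 h5 h6 hX1
  have h7 := hC X v hX1 hv1
  set N' := (((SS (chi (A.trace ^ 2 - 4)) X).filter (fun p => ∃ q : ℕ, q.Prime ∧ (X : ℝ) ^ v < q ∧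
        q ∣ mm (chi (A.trace ^ 2 - 4)) p)).card : ℝ) with hN'
  set N := (((Icc 1 X).filter (fun p => p.Prime ∧ (X : ℝ) ^ v < matOrd A p)).card : ℝ) with hN
  have hN0 : 0 ≤ N := Nat.cast_nonneg _
  have hN'0 : 0 ≤ N' := Nat.cast_nonneg _
  have hpi0 : (0 : ℝ) ≤ Nat.primeCounting X := Nat.cast_nonneg _
  set F := 4 * t + (2 / (1 - t) + t) * (2 * t) + (2 / (1 - v) + t) * (v - 1 / 2 + 2 * t) with hF
  have hF0 : 0 ≤ F := by
    have a1 : 0 < 1 - t := by linarith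
    have a2 : 0 < 1 - v := by linarith
    have a3 : 0 ≤ v - 1 / 2 + 2 * t := by linarith
    positivity
  set c := (3 - 5 * v) / (2 * (1 - v)) with hc
  set G := (1 / 2 - t - F / (1 - t)) / (1 + t) ^ 2 with hGd
  set L := Real.log X with hL
  set θ := Chebyshev.theta X with hθ
  have hL0 : 0 < L := by linarith
  suffices hsuff : (c - ε / 2) * Nat.primeCounting X ≤ N' by linarith
  by_cases hc0 : c - ε / 2 ≤ 0
  · exact (mul_nonpos_of_nonpos_of_nonneg hc0 hpi0).trans hN'0
  push Not at hc0
  have hG0 : 0 < G := hc0.trans hG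
  have ht1' : 0 < 1 - t := by linarith
  have hHG : 1 / 2 - t - F / (1 - t) = G * (1 + t) ^ 2 := by
    rw [hGd]; field_simp
  have hFX : F * X ≤ F / (1 - t) * θ := by
    rw [div_mul_eq_mul_div, le_div_iff₀ ht1']
    have := mul_le_mul_of_nonneg_left h2 hF0
    linarith
  have g1 : N' * (L * Real.log ((X : ℝ) + 1)) ≤ N' * (L * ((1 + t) * L)) :=
    mul_le_mul_of_nonneg_left (mul_le_mul_of_nonneg_left h5 hL0.le) hN'0
  have g2 : ((1 / 2 - t) * θ - F * X) * L ≤ ((1 + t) * N' * L) * L := by linarith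
  have g3 := le_of_mul_le_mul_right g2 hL0
  have g4 : G * (1 + t) ^ 2 * θ ≤ (1 + t) * N' * L := by
    rw [← hHG]; linarith
  have g5 : G * (1 + t) * ((Nat.primeCounting X : ℝ) * L) ≤ G * (1 + t) * ((1 + t) * θ) :=
    mul_le_mul_of_nonneg_left h3 (by positivity)
  have g6 : (G * Nat.primeCounting X) * ((1 + t) * L) ≤ N' * ((1 + t) * L) := by linarith
  have g7 := le_of_mul_le_mul_right g6 (by positivity)
  exact (mul_le_mul_of_nonneg_right hG.le hpi0).trans g7

lemma exists_v (η ε : ℝ) (hη₁ : 1 / 2 < η) (hη₂ : η < 3 / 5) (hε : 0 < ε) :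
    ∃ v : ℝ, η < v ∧ v < 1 ∧ (3 - 5 * η) / (2 * (1 - η)) - ε < (3 - 5 * v) / (2 * (1 - v)) := by
  have hcont : ContinuousAt (fun v : ℝ => (3 - 5 * v) / (2 * (1 - v))) η := by
    refine ContinuousAt.div (by fun_prop) (by fun_prop) ?_
    have : 0 < 1 - η := by linarith
    positivity
  have hev := hcont.eventually (lt_mem_nhds (by linarith :
    (3 - 5 * η) / (2 * (1 - η)) - ε < (3 - 5 * η) / (2 * (1 - η))))
  have hev2 : ∀ᶠ t : ℝ in 𝓝 η, t < 1 := gt_mem_nhds (by linarith)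
  have hev3 := (hev.and hev2).filter_mono (nhdsWithin_le_nhds (s := Set.Ioi η))
  obtain ⟨t, ⟨h1, h2⟩, h3⟩ := (hev3.and self_mem_nhdsWithin).exists
  exact ⟨t, h3, h2, h1⟩

end LO

/-- For `1/2 < η < 3/5` and `c(η) = (3-5η)/(2(1-η))`, the number of primes
`p ≤ x` with `ord(A,p) > x^η` is at least `(c(η) - ε) π(x)` for large `x`. -/
theorem large_order_positive_proportion_of_primes
    (A : Matrix (Fin 2) (Fin 2) ℤ) (hA : A.det = 1) (htr : 2 < |A.trace|)
    (η : ℝ) (hη₁ : 1 / 2 < η) (hη₂ : η < 3 / 5) :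
    ∀ ε : ℝ, 0 < ε → ∃ x₀ : ℝ, ∀ x : ℝ, x₀ ≤ x →
      ((3 - 5 * η) / (2 * (1 - η)) - ε) * (Nat.primeCounting ⌊x⌋₊ : ℝ) ≤
        ({p : ℕ | p.Prime ∧ (p : ℝ) ≤ x ∧ x ^ η < (matOrd A p : ℝ)}.ncard : ℝ) := by
  classical
  intro ε hε
  obtain ⟨v, hv, hv1, hcv⟩ := LO.exists_v η (ε / 2) hη₁ hη₂ (by positivity)
  have hmain := (tendsto_nat_floor_atTop (α := ℝ)).eventually
    (LO.main_nat A hA htr v (ε / 2) (by linarith) hv1 (by positivity))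
  have hpow : ∀ᶠ X : ℕ in Filter.atTop, (2 : ℝ) ^ η ≤ (X : ℝ) ^ (v - η) :=
    ((tendsto_rpow_atTop (by linarith : 0 < v - η)).comp
      tendsto_natCast_atTop_atTop).eventually_ge_atTop _
  have hpow' := (tendsto_nat_floor_atTop (α := ℝ)).eventually hpow
  obtain ⟨x₀, hx₀⟩ := Filter.eventually_atTop.1 ((hmain.and hpow').and (Filter.eventually_ge_atTop 1))
  refine ⟨x₀, fun x hx => ?_⟩
  obtain ⟨⟨h1, h2⟩, h3⟩ := hx₀ x hx
  set X := ⌊x⌋₊ with hX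
  have hX1 : 1 ≤ X := Nat.le_floor (by exact_mod_cast h3)
  have hX1' : (1 : ℝ) ≤ X := by exact_mod_cast hX1
  have hX0 : (0 : ℝ) < X := by linarith
  have hxX : x ≤ 2 * X := by
    have := Nat.lt_floor_add_one x
    rw [← hX] at this
    linarith
  have hpw : x ^ η ≤ (X : ℝ) ^ v := by
    calc x ^ η ≤ (2 * (X : ℝ)) ^ η := Real.rpow_le_rpow (by linarith) hxX (by linarith)
      _ = 2 ^ η * (X : ℝ) ^ η := Real.mul_rpow (by norm_num) hX0.le
      _ ≤ (X : ℝ) ^ (v - η) * (X : ℝ) ^ η := mul_le_mul_of_nonneg_right h2 (by positivity)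
      _ = (X : ℝ) ^ v := by rw [← Real.rpow_add hX0, sub_add_cancel]
  have hpi0 : (0 : ℝ) ≤ Nat.primeCounting X := Nat.cast_nonneg _
  have hle : ((3 - 5 * η) / (2 * (1 - η)) - ε) * (Nat.primeCounting X : ℝ) ≤
      ((3 - 5 * v) / (2 * (1 - v)) - ε / 2) * (Nat.primeCounting X : ℝ) :=
    mul_le_mul_of_nonneg_right (by linarith) hpi0
  refine (hle.trans h1).trans ?_
  have hfin : {p : ℕ | p.Prime ∧ (p : ℝ) ≤ x ∧ x ^ η < (matOrd A p : ℝ)}.Finite := by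
    refine (Set.finite_Iic X).subset fun p hp => ?_
    exact Nat.le_floor hp.2.1
  have hsub : (((Finset.Icc 1 X).filter (fun p => p.Prime ∧ (X : ℝ) ^ v < matOrd A p) : Finset ℕ) : Set ℕ) ⊆
      {p : ℕ | p.Prime ∧ (p : ℝ) ≤ x ∧ x ^ η < (matOrd A p : ℝ)} := by
    intro p hp
    obtain ⟨a, b, c⟩ := Finset.mem_filter.1 (Finset.mem_coe.1 hp)
    refine ⟨b, ?_, hpw.trans_lt c⟩
    have : (p : ℝ) ≤ X := by exact_mod_cast (Finset.mem_Icc.1 a).2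
    exact this.trans (Nat.floor_le (by linarith))
  have hcard := Set.ncard_le_ncard hsub hfin
  rw [Set.ncard_coe_finset] at hcard
  convert (Nat.cast_le (α := ℝ)).2 hcard
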